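/- Let g be a real transcendental entire function. Then g' + g² has infinitely many non-real zeros. -/

import Mathlib

open Complex

namespace RiccatiZeros

open Metric Set Filter Topology ComplexConjugate

/-- A zero-free holomorphic function on a disc has a holomorphic logarithm. -/
theorem exists_log_of_ball {f : ℂ → ℂ} {c : ℂ} {R : ℝ} (hf : DifferentiableOn ℂ f (ball c R))
    (h0 : ∀ z ∈ ball c R, f z ≠ 0) :
    ∃ L : ℂ → ℂ, ∀ z ∈ ball c R, exp (L z) = f z ∧ HasDerivAt L (deriv f z / f z) z := by
  rcases le_or_gt R 0 with hR | hR
  · exact ⟨0, fun z hz => by simp [ball_eq_empty.2 hR] at hz⟩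
  have hfd : DifferentiableOn ℂ (fun z => deriv f z / f z) (ball c R) :=
    (hf.deriv isOpen_ball).div hf h0
  obtain ⟨L, hLc, hL⟩ := hfd.isExactOn_ball.with_val_at c (log (f c))
  have hc : c ∈ ball c R := mem_ball_self hR
  refine ⟨L, fun z hz => ⟨?_, hL z hz⟩⟩
  have hder : ∀ x ∈ ball c R, HasDerivAt (fun z => f z * exp (-L z)) 0 x := by
    intro x hx
    have h1 := (hf.differentiableAt (isOpen_ball.mem_nhds hx)).hasDerivAt
    have h2 := (hL x hx).neg.cexp
    have hne := h0 x hx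
    refine (h1.mul h2).congr_deriv ?_
    field_simp
    ring
  have hconst := isOpen_ball.is_const_of_deriv_eq_zero (convex_ball c R).isPreconnected
    (fun x hx => (hder x hx).differentiableAt.differentiableWithinAt)
    (fun x hx => (hder x hx).deriv) hz hc
  simp only [hLc, exp_neg, exp_log (h0 c hc), mul_inv_cancel₀ (h0 c hc)] at hconst
  exact ((mul_inv_eq_one₀ (exp_ne_zero _)).1 hconst).symm

section HalfPlane

variable {f : ℂ → ℂ} {c z : ℂ} {R : ℝ}

theorem norm_sub_div_add_conj_le_one {a w : ℂ} (ha : 0 < a.re) (hw : 0 < w.re) :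
    ‖(w - a) / (w + conj a)‖ ≤ 1 := by
  rw [norm_div]
  apply div_le_one_of_le₀ _ (norm_nonneg _)
  rw [← sq_le_sq₀ (norm_nonneg _) (norm_nonneg _), ← normSq_eq_norm_sq, ← normSq_eq_norm_sq,
    normSq_apply, normSq_apply]
  simp only [sub_re, sub_im, add_re, add_im, conj_re, conj_im]
  nlinarith [mul_pos ha hw]

theorem add_conj_ne_zero {a w : ℂ} (ha : 0 < a.re) (hw : 0 < w.re) : w + conj a ≠ 0 := by
  intro h
  have := congrArg re h
  simp at this
  linarith

theorem differentiableOn_cayley (hf : DifferentiableOn ℂ f (ball c R))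
    (hpos : ∀ z ∈ ball c R, 0 < (f z).re) (hc : 0 < (f c).re) :
    DifferentiableOn ℂ (fun z => (f z - f c) / (f z + conj (f c))) (ball c R) :=
  (hf.sub_const _).div (hf.add_const _) fun z hz => add_conj_ne_zero hc (hpos z hz)

/-- **Schwarz–Pick** for maps of a disc into the right half-plane. -/
theorem norm_sub_le_of_re_pos (hf : DifferentiableOn ℂ f (ball c R))
    (hpos : ∀ z ∈ ball c R, 0 < (f z).re) (hz : z ∈ ball c R) :
    ‖f z - f c‖ ≤ ‖f z + conj (f c)‖ * (‖z - c‖ / R) := by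
  have hR : 0 < R := nonempty_ball.1 ⟨z, hz⟩
  have hc := hpos c (mem_ball_self hR)
  have h1 := dist_le_div_mul_dist_of_mapsTo_ball (R₂ := 1) (differentiableOn_cayley hf hpos hc)
    (fun w hw => by
      simpa [dist_zero_right] using norm_sub_div_add_conj_le_one hc (hpos w hw)) hz
  simp only [sub_self, zero_div, dist_zero_right, norm_div, dist_eq_norm z c] at h1
  rw [div_le_iff₀ (norm_pos_iff.2 (add_conj_ne_zero hc (hpos z hz)))] at h1
  calc _ ≤ _ := h1
    _ = _ := by ring

theorem norm_deriv_le_of_re_pos (hf : DifferentiableOn ℂ f (ball c R))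
    (hpos : ∀ z ∈ ball c R, 0 < (f z).re) (hR : 0 < R) :
    ‖deriv f c‖ ≤ 2 * (f c).re / R := by
  have hc := hpos c (mem_ball_self hR)
  have h1 := norm_deriv_le_div_of_mapsTo_ball (R₂ := 1) (differentiableOn_cayley hf hpos hc)
    (fun w hw => by
      simpa [dist_zero_right] using norm_sub_div_add_conj_le_one hc (hpos w hw)) hR
  have hfc := (hf.differentiableAt (ball_mem_nhds c hR)).hasDerivAt
  have hne := add_conj_ne_zero hc hc
  have h2 : HasDerivAt (fun z => (f z - f c) / (f z + conj (f c))) _ c :=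
    (hfc.sub_const (f c)).div (hfc.add_const (conj (f c))) hne
  rw [show deriv (fun z => (f z - f c) / (f z + conj (f c))) c = deriv f c / (f c + conj (f c)) by
    rw [h2.deriv]; field_simp; ring, add_conj, norm_div, norm_real, Real.norm_of_nonneg (by linarith),
    div_le_iff₀ (by linarith)] at h1
  calc _ ≤ _ := h1
    _ = _ := by ring

/-- **Harnack's inequality** on a disc. -/
theorem re_le_of_re_pos (hf : DifferentiableOn ℂ f (ball c R))
    (hpos : ∀ z ∈ ball c R, 0 < (f z).re) (hz : z ∈ ball c R) :
    (f c).re * (R - ‖z - c‖) ≤ (f z).re * (R + ‖z - c‖) := by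
  have hR : 0 < R := nonempty_ball.1 ⟨z, hz⟩
  have hc := hpos c (mem_ball_self hR)
  have h1 := norm_sub_le_of_re_pos hf hpos hz
  have hzp := hpos z hz
  set d := ‖z - c‖ / R with hd
  have hd0 : 0 ≤ d := by positivity
  have hd1 : d < 1 := by
    rw [hd, div_lt_one hR, ← dist_eq_norm]; exact hz
  have h2 : ‖z - c‖ = d * R := by rw [hd]; field_simp
  have h3 : ‖f z - f c‖ ^ 2 ≤ ‖f z + conj (f c)‖ ^ 2 * d ^ 2 := by
    rw [← mul_pow]; gcongr
  rw [← normSq_eq_norm_sq, ← normSq_eq_norm_sq, normSq_apply, normSq_apply] at h3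
  simp only [sub_re, sub_im, add_re, add_im, conj_re, conj_im] at h3
  have h4 : ((f z).re - (f c).re) ^ 2 ≤ (d * ((f z).re + (f c).re)) ^ 2 := by
    have : ((f z).im + -(f c).im) * ((f z).im + -(f c).im) * d ^ 2 ≤
      ((f z).im + -(f c).im) * ((f z).im + -(f c).im) * 1 := by
      apply mul_le_mul_of_nonneg_left _ (mul_self_nonneg _)
      nlinarith
    nlinarith
  have h5 := abs_le.1 (abs_le_of_sq_le_sq h4 (by positivity))
  rw [h2]
  nlinarith [h5.1, h5.2]

end HalfPlane

theorem exists_hasFDerivAt_norm_sq {h : ℂ → ℂ} {z : ℂ} (hd : DifferentiableAt ℂ h z) :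
    ∃ L : ℂ →L[ℝ] ℝ, HasFDerivAt (fun z => ‖h z‖ ^ 2) L z ∧ ‖L‖ ≤ 2 * ‖h z‖ * ‖deriv h z‖ := by
  have h1 := (hd.hasFDerivAt.restrictScalars ℝ).norm_sq
  refine ⟨_, h1, ?_⟩
  refine ContinuousLinearMap.opNorm_le_bound _ (by positivity) fun v => ?_
  have h2 : fderiv ℂ h z v = v * deriv h z := by
    rw [← smul_eq_mul, ← fderiv_apply_one_eq_deriv, ← map_smul, smul_eq_mul, mul_one]
  simp only [smul_apply, ContinuousLinearMap.comp_apply,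
    ContinuousLinearMap.coe_restrictScalars', h2, innerSL_apply_apply, nsmul_eq_mul, Nat.cast_ofNat]
  rw [norm_mul, Real.norm_ofNat]
  have := norm_inner_le_norm (𝕜 := ℝ) (h z) (v * deriv h z)
  rw [norm_mul] at this
  nlinarith

/-- A function with bounded spherical derivative that is large at the centre of a disc stays
away from zero on a smaller disc. -/
theorem half_lt_norm_of_spherical_bound {K : ℝ} (hK : 1 ≤ K) {h : ℂ → ℂ} {c : ℂ}
    (hd : DifferentiableOn ℂ h (ball c 1))
    (hb : ∀ z ∈ ball c 1, ‖deriv h z‖ ≤ K * (1 + ‖h z‖ ^ 2)) (hc : 1 ≤ ‖h c‖) {z : ℂ}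
    (hz : z ∈ ball c (1 / (4 * K))) : 1 / 2 < ‖h z‖ := by
  have hε : 1 / (4 * K) ≤ 1 := by rw [div_le_one (by linarith)]; linarith
  have hsub : ball c (1 / (4 * K)) ⊆ ball c 1 := ball_subset_ball hε
  have key : ∀ x ∈ ball c (1 / (4 * K)), ∃ L : ℂ →L[ℝ] ℝ,
      HasFDerivAt (fun z => (1 + ‖h z‖ ^ 2)⁻¹) L x ∧ ‖L‖ ≤ K := by
    intro x hx
    obtain ⟨L, hL, hLn⟩ := exists_hasFDerivAt_norm_sq
      (hd.differentiableAt (isOpen_ball.mem_nhds (hsub hx)))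
    have hp : 0 < 1 + ‖h x‖ ^ 2 := by positivity
    refine ⟨_, (hasDerivAt_inv hp.ne').comp_hasFDerivAt x (hL.const_add 1), ?_⟩
    rw [norm_smul, norm_neg, norm_inv, norm_pow, Real.norm_of_nonneg hp.le,
      inv_mul_le_iff₀ (by positivity)]
    have := hb x (hsub hx)
    calc ‖L‖ ≤ 2 * ‖h x‖ * (K * (1 + ‖h x‖ ^ 2)) := hLn.trans (by gcongr)
      _ ≤ (1 + ‖h x‖ ^ 2) * (K * (1 + ‖h x‖ ^ 2)) := by
        gcongr
        nlinarith [sq_nonneg (‖h x‖ - 1)]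
      _ = _ := by ring
  choose! L hL hLn using key
  have h1 := (convex_ball c (1 / (4 * K))).norm_image_sub_le_of_norm_hasFDerivWithin_le
    (fun x hx => (hL x hx).hasFDerivWithinAt) hLn (mem_ball_self (by positivity)) hz
  have h2 : ‖z - c‖ < 1 / (4 * K) := by rw [← dist_eq_norm]; exact hz
  have h3 : K * ‖z - c‖ ≤ 1 / 4 := by
    calc K * ‖z - c‖ ≤ K * (1 / (4 * K)) := by gcongr
      _ = 1 / 4 := by field_simp
  have h4 : (1 + ‖h c‖ ^ 2)⁻¹ ≤ 1 / 2 := by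
    rw [inv_le_comm₀ (by positivity) (by norm_num)]
    nlinarith
  have h5 : (1 + ‖h z‖ ^ 2)⁻¹ ≤ 3 / 4 := by
    have := (le_abs_self _).trans (h1.trans h3)
    linarith
  rw [inv_le_comm₀ (by positivity) (by norm_num)] at h5
  by_contra! h6
  nlinarith [norm_nonneg (h z)]

theorem norm_mul_norm_deriv_le_of_spherical_bound {K : ℝ} (hK : 1 ≤ K) {h : ℂ → ℂ} {c : ℂ}
    (hd : DifferentiableOn ℂ h (ball c 1))
    (hb : ∀ z ∈ ball c 1, ‖deriv h z‖ ≤ K * (1 + ‖h z‖ ^ 2)) :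
    ‖h c‖ * ‖deriv h c‖ ≤ 8 * K * ((2 + ‖h c‖ ^ 2) * Real.log (2 + ‖h c‖ ^ 2)) := by
  have hlog : 1 / 2 ≤ Real.log (2 + ‖h c‖ ^ 2) := by
    have : Real.log 2 ≤ Real.log (2 + ‖h c‖ ^ 2) :=
      Real.log_le_log (by norm_num) (by nlinarith [sq_nonneg ‖h c‖])
    linarith [Real.log_two_gt_d9]
  have hbc := hb c (mem_ball_self one_pos)
  rcases le_total ‖h c‖ 1 with h1 | h1
  · calc ‖h c‖ * ‖deriv h c‖ ≤ 1 * (K * (1 + ‖h c‖ ^ 2)) := by gcongr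
      _ ≤ 8 * K * ((2 + ‖h c‖ ^ 2) * (1 / 2)) := by nlinarith [sq_nonneg ‖h c‖]
      _ ≤ _ := by gcongr
  have hε0 : 0 < 1 / (4 * K) := by positivity
  have hε : 1 / (4 * K) ≤ 1 := by rw [div_le_one (by linarith)]; linarith
  have hsub : ball c (1 / (4 * K)) ⊆ ball c 1 := ball_subset_ball hε
  have hhalf := fun z hz => half_lt_norm_of_spherical_bound hK hd hb h1 (z := z) hz
  obtain ⟨L, hL⟩ := exists_log_of_ball (f := fun z => 2 * h z) (c := c) (R := 1 / (4 * K))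
    ((hd.mono hsub).const_mul 2) (fun z hz h0 => by
      have := hhalf z hz
      rw [(mul_eq_zero_iff_left two_ne_zero).1 h0, norm_zero] at this
      linarith)
  have hre : ∀ z ∈ ball c (1 / (4 * K)), (L z).re = Real.log (2 * ‖h z‖) := by
    intro z hz
    rw [← Real.log_exp (L z).re, ← norm_exp, (hL z hz).1, norm_mul, Complex.norm_ofNat]
  have hc := mem_ball_self (x := c) hε0
  have h2 := norm_deriv_le_of_re_pos
    (fun z hz => (hL z hz).2.differentiableAt.differentiableWithinAt)
    (fun z hz => by rw [hre z hz]; exact Real.log_pos (by linarith [hhalf z hz])) hε0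
  have hdc := (hd.differentiableAt (ball_mem_nhds c one_pos))
  rw [(hL c hc).2.deriv, hre c hc, deriv_const_mul _ hdc,
    mul_div_mul_left _ _ two_ne_zero, norm_div, div_le_iff₀ (by linarith)] at h2
  have h3 : Real.log (2 * ‖h c‖) ≤ Real.log (2 + ‖h c‖ ^ 2) :=
    Real.log_le_log (by linarith) (by nlinarith [sq_nonneg (‖h c‖ - 1)])
  calc ‖h c‖ * ‖deriv h c‖ ≤ ‖h c‖ * (2 * Real.log (2 * ‖h c‖) / (1 / (4 * K)) * ‖h c‖) := by
        gcongr
    _ = 8 * K * (‖h c‖ ^ 2 * Real.log (2 * ‖h c‖)) := by field_simp; ring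
    _ ≤ _ := by
      gcongr
      · exact Real.log_nonneg (by linarith)
      · linarith

theorem log_norm_le_mul_dist {K : ℝ} {H : ℂ → ℂ} {z₀ z₁ : ℂ}
    (hd : Differentiable ℂ H) (hb : ‖deriv H z₁‖ ≤ K * (1 + ‖H z₁‖ ^ 2)) (h₁ : ‖H z₁‖ ≤ 1)
    (hball : ∀ z ∈ ball z₀ (dist z₀ z₁), 1 < ‖H z‖) (hne : z₀ ≠ z₁) :
    Real.log ‖H z₀‖ ≤ 4 * K * dist z₀ z₁ := by
  set d := dist z₀ z₁ with hdd
  have hd0 : 0 < d := dist_pos.2 hne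
  have hdn : ‖z₀ - z₁‖ = d := by rw [hdd, dist_eq_norm]
  obtain ⟨L, hL⟩ := exists_log_of_ball (f := H) (c := z₀) (R := d) hd.differentiableOn
    (fun z hz h0 => by have := hball z hz; rw [h0, norm_zero] at this; linarith)
  have hre : ∀ z ∈ ball z₀ d, (L z).re = Real.log ‖H z‖ := by
    intro z hz
    rw [← Real.log_exp (L z).re, ← norm_exp, (hL z hz).1]
  have key : ∀ t ∈ Ioo (0 : ℝ) 1, Real.log ‖H z₀‖ / 2 ≤
      ‖t⁻¹ • (H (z₁ + (0 + t : ℝ) * (z₀ - z₁)) - H (z₁ + (0 : ℝ) * (z₀ - z₁)))‖ := by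
    intro t ht
    have hzt : ‖z₁ + t * (z₀ - z₁) - z₀‖ = (1 - t) * d := by
      rw [show z₁ + t * (z₀ - z₁) - z₀ = -(((1 - t : ℝ) : ℂ) * (z₀ - z₁)) by push_cast; ring,
        norm_neg, norm_mul, norm_real, Real.norm_of_nonneg (by linarith [ht.2]), hdn]
    have hmem : z₁ + t * (z₀ - z₁) ∈ ball z₀ d := by
      rw [mem_ball, dist_eq_norm, hzt]
      nlinarith [ht.1]
    have h2 := re_le_of_re_pos
      (fun z hz => (hL z hz).2.differentiableAt.differentiableWithinAt)
      (fun z hz => by rw [hre z hz]; exact Real.log_pos (hball z hz)) hmem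
    rw [hzt, hre _ (mem_ball_self hd0), hre _ hmem] at h2
    have h3 : 0 < Real.log ‖H (z₁ + t * (z₀ - z₁))‖ := Real.log_pos (hball _ hmem)
    have h4 : Real.log ‖H z₀‖ * t ≤ Real.log ‖H (z₁ + t * (z₀ - z₁))‖ * 2 := by
      have : Real.log ‖H z₀‖ * t * d ≤ Real.log ‖H (z₁ + t * (z₀ - z₁))‖ * 2 * d := by
        nlinarith [mul_pos (mul_pos h3 hd0) ht.1]
      exact le_of_mul_le_mul_right this hd0
    have h5 := Real.log_le_sub_one_of_pos (zero_lt_one.trans (hball _ hmem))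
    have h6 := norm_sub_norm_le (H (z₁ + t * (z₀ - z₁))) (H z₁)
    rw [norm_smul, norm_inv, Real.norm_of_nonneg ht.1.le, le_inv_mul_iff₀ ht.1]
    simp only [zero_add, ofReal_zero, zero_mul, add_zero]
    linarith
  have hder : HasDerivAt (fun t : ℝ => H (z₁ + t * (z₀ - z₁))) (deriv H z₁ * (z₀ - z₁)) 0 := by
    have h1 : HasDerivAt (fun t : ℝ => z₁ + t * (z₀ - z₁)) (1 * (z₀ - z₁)) 0 :=
      (((hasDerivAt_id (0 : ℝ)).ofReal_comp).mul_const (z₀ - z₁)).const_add z₁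
    have h2 : HasDerivAt H (deriv H z₁) (z₁ + ((0 : ℝ) : ℂ) * (z₀ - z₁)) := by
      simpa using (hd z₁).hasDerivAt
    simpa [Function.comp_def] using h2.comp (0 : ℝ) h1
  have hlim := (hder.tendsto_slope_zero_right).norm
  have h7 : Real.log ‖H z₀‖ / 2 ≤ ‖deriv H z₁ * (z₀ - z₁)‖ :=
    ge_of_tendsto hlim (by filter_upwards [Ioo_mem_nhdsGT one_pos] with t ht using key t ht)
  rw [norm_mul, hdn] at h7
  have hK : 0 ≤ K := by
    by_contra! hK
    nlinarith [norm_nonneg (deriv H z₁), sq_nonneg ‖H z₁‖]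
  have h8 : ‖deriv H z₁‖ ≤ 2 * K := by
    have : ‖H z₁‖ ^ 2 ≤ 1 := pow_le_one₀ (norm_nonneg _) h₁
    nlinarith
  nlinarith

/-- An entire function with bounded spherical derivative is of exponential type. -/
theorem exists_norm_le_exp_of_spherical_bound {K : ℝ} {H : ℂ → ℂ} (hd : Differentiable ℂ H)
    (hb : ∀ z, ‖deriv H z‖ ≤ K * (1 + ‖H z‖ ^ 2)) :
    ∃ A, 0 ≤ A ∧ ∀ z, ‖H z‖ ≤ Real.exp (A * (1 + ‖z‖)) := by
  have hK : 0 ≤ K := by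
    by_contra! hK
    nlinarith [norm_nonneg (deriv H 0), sq_nonneg ‖H 0‖, hb 0]
  by_cases hall : ∀ z, 1 < ‖H z‖
  · have h0 : ∀ z, H z ≠ 0 := fun z hz => by
      have := hall z; rw [hz, norm_zero] at this; linarith
    have hbd : Bornology.IsBounded (range fun z => (H z)⁻¹) := by
      refine (isBounded_iff_forall_norm_le).2 ⟨1, ?_⟩
      rintro _ ⟨z, rfl⟩
      rw [norm_inv]
      exact inv_le_one_of_one_le₀ (hall z).le
    refine ⟨‖H 0‖, norm_nonneg _, fun z => ?_⟩
    have h1 := (hd.inv h0).apply_eq_apply_of_bounded hbd z 0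
    rw [inv_inj.1 h1]
    have := Real.add_one_le_exp (‖H 0‖ * (1 + ‖z‖))
    nlinarith [norm_nonneg (H 0), norm_nonneg z, mul_nonneg (norm_nonneg (H 0)) (norm_nonneg z)]
  · push Not at hall
    obtain ⟨a, ha⟩ := hall
    refine ⟨4 * K * (1 + ‖a‖), by positivity, fun z => ?_⟩
    rcases le_or_gt ‖H z‖ 1 with h1 | h1
    · exact h1.trans (Real.one_le_exp (by positivity))
    have hcl : IsClosed {w | ‖H w‖ ≤ 1} := isClosed_le hd.continuous.norm continuous_const
    obtain ⟨z₁, hz₁, hdist⟩ := hcl.exists_infDist_eq_dist ⟨a, ha⟩ z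
    have h2 := log_norm_le_mul_dist (z₀ := z) hd (hb z₁) hz₁ (fun w hw => by
      by_contra! hw1
      have := infDist_le_dist_of_mem (x := z) (s := {w | ‖H w‖ ≤ 1}) hw1
      rw [mem_ball, dist_comm] at hw
      linarith) (fun h => by rw [h] at h1; exact absurd hz₁ (not_le.2 h1))
    have h3 : dist z z₁ ≤ ‖z‖ + ‖a‖ := by
      rw [← hdist]
      have h4 : dist z a ≤ ‖z‖ + ‖a‖ := dist_eq_norm z a ▸ norm_sub_le z a
      exact (infDist_le_dist_of_mem (s := {w | ‖H w‖ ≤ 1}) ha).trans h4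
    rw [← Real.log_le_iff_le_exp (by linarith)]
    refine h2.trans ?_
    rw [mul_assoc (4 * K)]
    gcongr
    nlinarith [norm_nonneg a, norm_nonneg z, mul_nonneg (norm_nonneg a) (norm_nonneg z)]

/-- A zero-free entire function of exponential type is the exponential of an affine function. -/
theorem exists_eq_exp_of_ne_zero {P : ℂ → ℂ} (hd : Differentiable ℂ P) (h0 : ∀ z, P z ≠ 0) {A : ℝ}
    (hA0 : 0 ≤ A) (hA : ∀ z, ‖P z‖ ≤ Real.exp (A * (1 + ‖z‖))) :
    ∃ α β : ℂ, ∀ z, P z = exp (α * z + β) := by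
  have hq : Differentiable ℂ (fun z => deriv P z / P z) := hd.deriv.div hd h0
  have hbd : ∀ w, ‖deriv P w / P w‖ ≤ 2 * (2 * A + 2) := by
    intro w
    set l := Real.log ‖P w‖ with hl
    set r := 1 + ‖w‖ + |l| with hr
    have hr1 : 1 ≤ r := by rw [hr]; linarith [norm_nonneg w, abs_nonneg l]
    obtain ⟨L, hL⟩ := exists_log_of_ball (f := P) (c := w) (R := r) hd.differentiableOn
      (fun z _ => h0 z)
    have hre : ∀ z ∈ ball w r, (L z).re = Real.log ‖P z‖ := by
      intro z hz
      rw [← Real.log_exp (L z).re, ← norm_exp, (hL z hz).1]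
    have hw := mem_ball_self (x := w) (by linarith : 0 < r)
    have hder := fun z hz => (hL z hz).2.const_sub ((A * (1 + ‖w‖ + r) + 1 : ℝ) : ℂ)
    have h1 := norm_deriv_le_of_re_pos (f := fun z => ((A * (1 + ‖w‖ + r) + 1 : ℝ) : ℂ) - L z)
      (fun z hz => (hder z hz).differentiableAt.differentiableWithinAt)
      (fun z hz => by
        rw [sub_re, ofReal_re, hre z hz]
        have h2 : Real.log ‖P z‖ ≤ A * (1 + ‖z‖) := by
          rw [Real.log_le_iff_le_exp (norm_pos_iff.2 (h0 z))]
          exact hA z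
        have h3 : ‖z‖ ≤ ‖w‖ + r := by
          rw [mem_ball, dist_eq_norm] at hz
          linarith [norm_sub_norm_le z w]
        nlinarith) (by linarith)
    rw [(hder w hw).deriv, norm_neg, sub_re, ofReal_re, hre w hw, ← hl] at h1
    refine h1.trans ?_
    rw [div_le_iff₀ (by linarith)]
    have h4 := neg_abs_le l
    have h5 : 1 + ‖w‖ ≤ r := by rw [hr]; linarith [abs_nonneg l]
    have h6 : |l| ≤ r := by rw [hr]; linarith [norm_nonneg w]
    nlinarith
  obtain ⟨α, hα⟩ := hq.exists_eq_const_of_bounded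
    ((isBounded_iff_forall_norm_le).2 ⟨_, by rintro _ ⟨z, rfl⟩; exact hbd z⟩)
  have hder : ∀ x, HasDerivAt (fun z => P z * exp (-(α * z))) 0 x := by
    intro x
    have h2 : HasDerivAt (fun z => -(α * z)) (-(α * 1)) x :=
      ((hasDerivAt_id x).const_mul α).neg
    refine ((hd x).hasDerivAt.mul h2.cexp).congr_deriv ?_
    have := congrFun hα x
    simp only [Function.const_apply] at this
    rw [← this]
    field_simp [h0 x]
    ring
  refine ⟨α, log (P 0), fun z => ?_⟩
  have hconst := is_const_of_deriv_eq_zero (fun x => (hder x).differentiableAt)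
    (fun x => (hder x).deriv) z 0
  simp only [mul_zero, neg_zero, exp_zero, mul_one, exp_neg] at hconst
  rw [exp_add, exp_log (h0 0), ← hconst]
  field_simp [exp_ne_zero]

theorem eq_zero_of_linear_ode {w b : ℂ → ℂ} (hb : Differentiable ℂ b)
    (hw : ∀ z, HasDerivAt w (b z * w z) z) {z₀ : ℂ} (h0 : w z₀ = 0) (z : ℂ) : w z = 0 := by
  obtain ⟨B, hB⟩ := (hb.differentiableOn (s := ball 0 (‖z₀‖ + ‖z‖ + 1))).isExactOn_ball
  have hder : ∀ x ∈ ball 0 (‖z₀‖ + ‖z‖ + 1), HasDerivAt (fun x => w x * exp (-B x)) 0 x := by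
    intro x hx
    refine ((hw x).mul (hB x hx).neg.cexp).congr_deriv ?_
    ring
  have h1 := isOpen_ball.is_const_of_deriv_eq_zero (convex_ball _ _).isPreconnected
    (fun x hx => (hder x hx).differentiableAt.differentiableWithinAt)
    (fun x hx => (hder x hx).deriv) (x := z) (y := z₀)
    (by rw [mem_ball_zero_iff]; linarith [norm_nonneg z₀])
    (by rw [mem_ball_zero_iff]; linarith [norm_nonneg z])
  simpa [h0, exp_ne_zero] using h1

theorem deriv_eq_zero_of_riccati_const {H : ℂ → ℂ} (hd : Differentiable ℂ H) {a : ℂ}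
    (hP : ∀ z, deriv H z + H z ^ 2 = a) (z : ℂ) : deriv H z = 0 := by
  obtain ⟨c, hc⟩ := IsAlgClosed.exists_pow_nat_eq a two_pos
  have hw : ∀ z, HasDerivAt (fun z => H z - c) (-(H z + c) * (H z - c)) z := fun z =>
    ((hd z).hasDerivAt.sub_const c).congr_deriv (by linear_combination hP z - hc)
  by_cases h0 : ∃ z₀, H z₀ - c = 0
  · obtain ⟨z₀, h0⟩ := h0
    have h1 := eq_zero_of_linear_ode (b := fun z => -(H z + c)) (by fun_prop) hw h0
    have h2 : deriv H z = -(H z + c) * (H z - c) := by linear_combination hP z - hc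
    rw [h2, h1 z, mul_zero]
  push Not at h0
  have hv : ∀ z, HasDerivAt (fun z => (H z - c)⁻¹) (1 + 2 * c * (H z - c)⁻¹) z := fun z => by
    refine ((hw z).inv (h0 z)).congr_deriv ?_
    have := h0 z
    field_simp
    ring
  rcases eq_or_ne c 0 with rfl | hc0
  · have h1 : ∀ x, HasDerivAt (fun z => (H z - 0)⁻¹ - z) 0 x := fun x =>
      ((hv x).sub (hasDerivAt_id x)).congr_deriv (by simp)
    have h2 := is_const_of_deriv_eq_zero (fun x => (h1 x).differentiableAt)
      (fun x => (h1 x).deriv) (-(H 0 - 0)⁻¹) 0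
    simp only [sub_zero, sub_neg_eq_add, add_eq_right, inv_eq_zero] at h2
    exact absurd (by rw [sub_zero, sub_zero, h2]) (h0 (-(H 0 - 0)⁻¹))
  have h1 : ∀ x, HasDerivAt (fun z => ((H z - c)⁻¹ + 1 / (2 * c)) * exp (-(2 * c * z))) 0 x := by
    intro x
    have h2 : HasDerivAt (fun z => -(2 * c * z)) (-(2 * c * 1)) x :=
      ((hasDerivAt_id x).const_mul (2 * c)).neg
    refine (((hv x).add_const (1 / (2 * c))).mul h2.cexp).congr_deriv ?_
    field_simp
    ring
  obtain ⟨A, hA⟩ : ∃ A, ∀ x, (H x - c)⁻¹ + 1 / (2 * c) = A * exp (2 * c * x) := by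
    refine ⟨((H 0 - c)⁻¹ + 1 / (2 * c)) * exp (-(2 * c * 0)), fun x => ?_⟩
    rw [← is_const_of_deriv_eq_zero (fun x => (h1 x).differentiableAt) (fun x => (h1 x).deriv) x 0,
      mul_assoc, ← exp_add, neg_add_cancel, exp_zero, mul_one]
  rcases eq_or_ne A 0 with rfl | hA0
  · have h2 := hA z
    have h3 := (hw z).deriv
    rw [deriv_sub_const] at h3
    rw [h3]
    have h4 := h0 z
    field_simp at h2
    simp only [mul_zero, zero_mul] at h2
    linear_combination (-(H z - c)) * h2
  · exfalso
    have h2 := hA (log (1 / (2 * c * A)) / (2 * c))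
    rw [mul_div_cancel₀ _ (by simpa using hc0), exp_log (by simp [hc0, hA0])] at h2
    have h3 : (H (log (1 / (2 * c * A)) / (2 * c)) - c)⁻¹ = 0 := by
      have : A * (1 / (2 * c * A)) = 1 / (2 * c) := by field_simp
      rw [this] at h2
      linear_combination h2
    exact h0 _ (inv_eq_zero.1 h3)

/-- An entire solution of `H' + H² = exp` would be non-periodic if its spherical derivative
were bounded. -/
theorem not_periodic_of_riccati_exp {K : ℝ} {H : ℂ → ℂ} (hd : Differentiable ℂ H)
    (hb : ∀ z, ‖deriv H z‖ ≤ K * (1 + ‖H z‖ ^ 2)) (hP : ∀ z, deriv H z + H z ^ 2 = exp z) :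
    ∃ z, H z ≠ H (z + 2 * Real.pi * I) := by
  by_contra! hper
  have hK : 0 ≤ K := by
    by_contra! hK
    nlinarith [norm_nonneg (deriv H 0), sq_nonneg ‖H 0‖, hb 0]
  obtain ⟨X, hX⟩ : ∃ X : ℝ, ∀ z : ℂ, X < z.re → 1 < ‖H z‖ := by
    refine ⟨Real.log (2 * K + 1), fun z hz => ?_⟩
    rw [Real.log_lt_iff_lt_exp (by linarith), ← norm_exp, ← hP z] at hz
    have h1 := norm_add_le (deriv H z) (H z ^ 2)
    rw [norm_pow] at h1
    by_contra! h2
    have h3 : ‖H z‖ ^ 2 ≤ 1 := pow_le_one₀ (norm_nonneg _) h2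
    nlinarith [hb z]
  have hH0 : ∀ z : ℂ, X < z.re → H z ≠ 0 := fun z hz h0 => by
    have := hX z hz
    rw [h0, norm_zero] at this
    linarith
  have hw : ∀ z : ℂ, X + 4 ≤ z.re → ‖(exp (z / 2) / H z) ^ 2 - 1‖ ≤ 1 / 2 := by
    intro z hz
    have hsub : ∀ w ∈ ball z 4, 1 < ‖H w‖ := fun w hw => hX w (by
      rw [mem_ball, dist_comm, dist_eq_norm] at hw
      have := (re_le_norm (z - w)).trans_lt hw
      rw [sub_re] at this
      linarith)
    obtain ⟨L, hL⟩ := exists_log_of_ball (f := H) (c := z) (R := 4) hd.differentiableOn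
      (fun w hw h0 => by have := hsub w hw; rw [h0, norm_zero] at this; linarith)
    have hre : ∀ w ∈ ball z 4, (L w).re = Real.log ‖H w‖ := by
      intro w hw
      rw [← Real.log_exp (L w).re, ← norm_exp, (hL w hw).1]
    have hz4 := mem_ball_self (x := z) (by norm_num : (0 : ℝ) < 4)
    have h1 := norm_deriv_le_of_re_pos
      (fun z hz => (hL z hz).2.differentiableAt.differentiableWithinAt)
      (fun w hw => by rw [hre w hw]; exact Real.log_pos (hsub w hw)) (by norm_num : (0 : ℝ) < 4)
    rw [(hL z hz4).2.deriv, hre z hz4] at h1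
    have hHz := hH0 z (by linarith)
    have h2 : (exp (z / 2) / H z) ^ 2 - 1 = deriv H z / H z / H z := by
      rw [div_pow, ← exp_nat_mul]
      push_cast
      rw [mul_div_cancel₀ _ two_ne_zero, ← hP z]
      field_simp
      ring
    rw [h2, norm_div, div_le_iff₀ (norm_pos_iff.2 hHz)]
    have h3 := Real.log_le_sub_one_of_pos (norm_pos_iff.2 hHz)
    linarith
  have hre0 : ∀ z : ℂ, X + 4 ≤ z.re → (exp (z / 2) / H z).re ≠ 0 := by
    intro z hz h0
    have h1 := (re_le_norm _).trans ((norm_neg _).trans_le (hw z hz))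
    rw [neg_re, sub_re, one_re, sq, mul_re, h0] at h1
    nlinarith [mul_self_nonneg (exp (z / 2) / H z).im]
  set q : ℝ → ℝ := fun t => (exp (((X + 4 : ℝ) + t * I) / 2) / H ((X + 4 : ℝ) + t * I)).re with hq
  have hqre : ∀ t : ℝ, (((X + 4 : ℝ) : ℂ) + t * I).re = X + 4 := fun t => by simp
  have hqc : Continuous q := by
    refine continuous_re.comp (Continuous.div (by fun_prop) ?_ fun t => hH0 _ (by
      rw [hqre]; linarith))
    exact hd.continuous.comp (by fun_prop)
  have hq0 : ∀ t, q t ≠ 0 := fun t => hre0 _ (hqre t).ge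
  have hq1 : q (2 * Real.pi) = -q 0 := by
    have h1 : (((X + 4 : ℝ) : ℂ) + (2 * Real.pi : ℝ) * I) / 2 =
      ((X + 4 : ℝ) + (0 : ℝ) * I) / 2 + Real.pi * I := by push_cast; ring
    have h2 : (((X + 4 : ℝ) : ℂ) + (2 * Real.pi : ℝ) * I) =
      ((X + 4 : ℝ) + (0 : ℝ) * I) + 2 * Real.pi * I := by push_cast; ring
    simp only [hq]
    rw [h1, exp_add, exp_pi_mul_I, h2, ← hper, mul_neg_one, neg_div, neg_re]
  obtain ⟨t, ht⟩ : (0 : ℝ) ∈ range q := by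
    rcases le_total (q 0) 0 with h | h
    · exact mem_range_of_exists_le_of_exists_ge hqc ⟨0, h⟩ ⟨2 * Real.pi, by linarith⟩
    · exact mem_range_of_exists_le_of_exists_ge hqc ⟨2 * Real.pi, by linarith⟩ ⟨0, h⟩
  exact hq0 t ht

theorem not_riccati_exp {K : ℝ} {H : ℂ → ℂ} (hd : Differentiable ℂ H)
    (hb : ∀ z, ‖deriv H z‖ ≤ K * (1 + ‖H z‖ ^ 2)) (hP : ∀ z, deriv H z + H z ^ 2 = exp z) :
    False := by
  set τ : ℂ := 2 * Real.pi * I with hτ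
  have hτe : ∀ z, exp (z + τ) = exp z := exp_periodic
  have hD : ∀ z, HasDerivAt (fun z => H z - H (z + τ))
      (-(H z + H (z + τ)) * (H z - H (z + τ))) z := by
    intro z
    have h1 : HasDerivAt (fun z => H (z + τ)) (deriv H (z + τ)) z :=
      (hd (z + τ)).hasDerivAt.comp_add_const z τ
    refine ((hd z).hasDerivAt.sub h1).congr_deriv ?_
    linear_combination hP z - hP (z + τ) - hτe z
  have hD0 : ∀ z, H z - H (z + τ) ≠ 0 := by
    intro z₀ h0
    obtain ⟨z, hz⟩ := not_periodic_of_riccati_exp hd hb hP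
    have h1 := eq_zero_of_linear_ode (b := fun z => -(H z + H (z + τ)))
      (by fun_prop) hD h0 z
    exact hz (sub_eq_zero.1 h1)
  obtain ⟨A, hA0, hA⟩ := exists_norm_le_exp_of_spherical_bound hd hb
  obtain ⟨α, β, hαβ⟩ := exists_eq_exp_of_ne_zero (P := fun z => H z - H (z + τ))
    (fun z => (hD z).differentiableAt) hD0 (A := A + A * ‖τ‖ + 1) (by positivity) (fun z => by
      have h1 := norm_sub_le (H z) (H (z + τ))
      have h2 : Real.exp (A * (1 + ‖z‖)) ≤ Real.exp (A * (1 + ‖z‖) + A * ‖τ‖) := by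
        gcongr; linarith [mul_nonneg hA0 (norm_nonneg τ)]
      have h3 : Real.exp (A * (1 + ‖z + τ‖)) ≤ Real.exp (A * (1 + ‖z‖) + A * ‖τ‖) := by
        gcongr; nlinarith [norm_add_le z τ]
      have h4 : Real.exp (A * (1 + ‖z‖) + A * ‖τ‖ + 1) ≤
          Real.exp ((A + A * ‖τ‖ + 1) * (1 + ‖z‖)) := by
        gcongr; nlinarith [norm_nonneg z, mul_nonneg hA0 (norm_nonneg τ),
          mul_nonneg (mul_nonneg hA0 (norm_nonneg τ)) (norm_nonneg z)]
      rw [Real.exp_add _ 1] at h4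
      have h5 := Real.add_one_le_exp 1
      nlinarith [hA z, hA (z + τ), Real.exp_pos (A * (1 + ‖z‖) + A * ‖τ‖)])
  have hlin : ∀ z, HasDerivAt (fun z => α * z + β) α z := fun z => by
    simpa using ((hasDerivAt_id z).const_mul α).add_const β
  have hsum : ∀ z, H z = (exp (α * z + β) - α) / 2 := by
    intro z
    have h1 := (hD z).unique ((hlin z).cexp.congr_of_eventuallyEq
      (Eventually.of_forall fun z => hαβ z))
    rw [← hαβ z] at h1
    have h2 : -(H z + H (z + τ)) = α := mul_right_cancel₀ (hD0 z) (h1.trans (mul_comm _ _))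
    rw [← hαβ z, ← h2]
    ring
  have hfin : ∀ z, exp (2 * (α * z + β)) + α ^ 2 = 4 * exp z := by
    intro z
    have h1 : HasDerivAt H (exp (α * z + β) * α / 2) z :=
      (((hlin z).cexp.sub_const α).div_const 2).congr_of_eventuallyEq
      (Eventually.of_forall fun z => hsum z)
    have h2 := hP z
    rw [h1.deriv, hsum z] at h2
    rw [two_mul, exp_add, ← h2]
    ring
  have hE : ∀ z, HasDerivAt (fun z => exp (2 * (α * z + β))) (2 * α * exp (2 * (α * z + β))) z :=
    fun z => ((hlin z).const_mul 2).cexp.congr_deriv (by ring)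
  have hfin1 : ∀ z, 2 * α * exp (2 * (α * z + β)) = 4 * exp z := fun z =>
    ((hE z).add_const (α ^ 2)).unique (((hasDerivAt_exp z).const_mul 4).congr_of_eventuallyEq
      (Eventually.of_forall hfin))
  have hfin2 : 2 * α * (2 * α * exp (2 * (α * 0 + β))) = 4 * exp 0 :=
    ((hE 0).const_mul (2 * α)).unique (((hasDerivAt_exp 0).const_mul 4).congr_of_eventuallyEq
      (Eventually.of_forall hfin1))
  rw [hfin1 0, exp_zero] at hfin2
  have h1 : α = 1 / 2 := by linear_combination hfin2 / 8
  have h2 := hfin 0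
  have h3 := hfin1 0
  rw [h1] at h2 h3
  norm_num at h2 h3
  rw [h3] at h2
  norm_num at h2

/-- An entire function with bounded spherical derivative whose Riccati expression `H' + H²` is
zero-free or identically zero is constant. -/
theorem deriv_eq_zero_of_spherical_bound {K : ℝ} {H : ℂ → ℂ} (hd : Differentiable ℂ H)
    (hb : ∀ z, ‖deriv H z‖ ≤ K * (1 + ‖H z‖ ^ 2))
    (hP : (∀ z, deriv H z + H z ^ 2 = 0) ∨ ∀ z, deriv H z + H z ^ 2 ≠ 0) (z : ℂ) :
    deriv H z = 0 := by
  rcases hP with hP | hP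
  · exact deriv_eq_zero_of_riccati_const hd hP z
  have hK : 0 ≤ K := by
    by_contra! hK
    nlinarith [norm_nonneg (deriv H 0), sq_nonneg ‖H 0‖, hb 0]
  obtain ⟨A, hA0, hA⟩ := exists_norm_le_exp_of_spherical_bound hd hb
  obtain ⟨α, β, hαβ⟩ := exists_eq_exp_of_ne_zero (P := fun z => deriv H z + H z ^ 2)
    (hd.deriv.add (hd.pow 2)) hP (A := 2 * A + (2 * K + 1)) (by positivity) (fun z => by
      have h1 := norm_add_le (deriv H z) (H z ^ 2)
      rw [norm_pow] at h1
      have h2 : ‖H z‖ ^ 2 ≤ Real.exp (2 * A * (1 + ‖z‖)) := by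
        calc _ ≤ Real.exp (A * (1 + ‖z‖)) ^ 2 := by gcongr; exact hA z
          _ = _ := by rw [← Real.exp_nat_mul]; congr 1; push_cast; ring
      have h3 : 1 ≤ Real.exp (2 * A * (1 + ‖z‖)) := Real.one_le_exp (by positivity)
      have h4 : 2 * K + 1 ≤ Real.exp ((2 * K + 1) * (1 + ‖z‖)) := by
        have := Real.add_one_le_exp ((2 * K + 1) * (1 + ‖z‖))
        nlinarith [mul_nonneg hK (norm_nonneg z), norm_nonneg z]
      rw [add_mul, Real.exp_add]
      have h5 : ‖deriv H z + H z ^ 2‖ ≤ Real.exp (2 * A * (1 + ‖z‖)) * (2 * K + 1) := by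
        nlinarith [hb z]
      exact h5.trans (by gcongr))
  rcases eq_or_ne α 0 with rfl | hα
  · exact deriv_eq_zero_of_riccati_const hd (a := exp β) (fun z => by simpa using hαβ z) z
  exfalso
  set s : ℂ := (-β + 2 * log α) / α with hs
  have hd1 : ∀ z, HasDerivAt (fun z => H (z / α + s) / α) (deriv H (z / α + s) / α ^ 2) z := by
    intro z
    have h1 : HasDerivAt (fun z => z / α + s) (1 / α) z :=
      ((hasDerivAt_id z).div_const α).add_const s
    refine (((hd (z / α + s)).hasDerivAt.comp z h1).div_const α).congr_deriv ?_
    field_simp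
  refine not_riccati_exp (K := K * ((‖α‖ ^ 2)⁻¹ + 1)) (H := fun z => H (z / α + s) / α)
    (fun z => (hd1 z).differentiableAt) (fun z => ?_) (fun z => ?_)
  · rw [(hd1 z).deriv, norm_div, norm_div, norm_pow, div_pow]
    have hα' : 0 < ‖α‖ := norm_pos_iff.2 hα
    rw [div_le_iff₀ (by positivity)]
    refine (hb _).trans ?_
    rw [mul_assoc, mul_assoc]
    gcongr
    have : ((‖α‖ ^ 2)⁻¹ + 1) * ((1 + ‖H (z / α + s)‖ ^ 2 / ‖α‖ ^ 2) * ‖α‖ ^ 2) =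
      1 + ‖H (z / α + s)‖ ^ 2 + (‖α‖ ^ 2 + ‖H (z / α + s)‖ ^ 2 / ‖α‖ ^ 2) := by
      field_simp
      ring
    rw [this]
    linarith [show 0 ≤ ‖α‖ ^ 2 + ‖H (z / α + s)‖ ^ 2 / ‖α‖ ^ 2 by positivity]
  · have h1 := hαβ (z / α + s)
    have h2 : α * (z / α + s) + β = z + (log α + log α) := by
      rw [hs]; field_simp; ring
    simp only [h2, exp_add, exp_log hα] at h1
    rw [(hd1 z).deriv, div_pow, ← add_div, h1]
    field_simp

theorem log_two_add_sq_pos (x : ℝ) : 0 < Real.log (2 + x ^ 2) :=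
  Real.log_pos (by nlinarith [sq_nonneg x])

theorem log_two_add_norm_sq_le {K : ℝ} (hK : 1 ≤ K) {h : ℂ → ℂ} {c z : ℂ} {R : ℝ}
    (hd : DifferentiableOn ℂ h (ball c (R + 1)))
    (hb : ∀ z ∈ ball c (R + 1), ‖deriv h z‖ ≤ K * (1 + ‖h z‖ ^ 2)) (hz : z ∈ ball c R) :
    Real.log (2 + ‖h z‖ ^ 2) ≤ Real.log (2 + ‖h c‖ ^ 2) * Real.exp (16 * K * ‖z - c‖) := by
  have hR : 0 < R := nonempty_ball.1 ⟨z, hz⟩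
  have hsub : ball c R ⊆ ball c (R + 1) := ball_subset_ball (by linarith)
  have key : ∀ x ∈ ball c R, ∃ L : ℂ →L[ℝ] ℝ,
      HasFDerivAt (fun z => Real.log (Real.log (2 + ‖h z‖ ^ 2))) L x ∧ ‖L‖ ≤ 16 * K := by
    intro x hx
    obtain ⟨L, hL, hLn⟩ := exists_hasFDerivAt_norm_sq
      (hd.differentiableAt (isOpen_ball.mem_nhds (hsub hx)))
    have hsub1 : ball x 1 ⊆ ball c (R + 1) := ball_subset_ball' (by
      rw [mem_ball] at hx
      linarith)
    have h1 := norm_mul_norm_deriv_le_of_spherical_bound hK (hd.mono hsub1)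
      (fun z hz => hb z (hsub1 hz))
    have hy : 0 < 2 + ‖h x‖ ^ 2 := by positivity
    have hl := log_two_add_sq_pos ‖h x‖
    refine ⟨_, ((hL.const_add 2).log hy.ne').log hl.ne', ?_⟩
    rw [norm_smul, norm_smul, norm_inv, norm_inv, Real.norm_of_nonneg hy.le,
      Real.norm_of_nonneg hl.le, inv_mul_le_iff₀ hl, inv_mul_le_iff₀ hy]
    linarith
  choose! L hL hLn using key
  have h1 := (convex_ball c R).norm_image_sub_le_of_norm_hasFDerivWithin_le
    (fun x hx => (hL x hx).hasFDerivWithinAt) hLn (mem_ball_self hR) hz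
  have h2 := (le_abs_self _).trans h1
  have h3 : Real.log (Real.log (2 + ‖h z‖ ^ 2)) ≤
      Real.log (Real.log (2 + ‖h c‖ ^ 2)) + 16 * K * ‖z - c‖ := by linarith
  rw [Real.log_le_iff_le_exp (log_two_add_sq_pos _), Real.exp_add,
    Real.exp_log (log_two_add_sq_pos _)] at h3
  exact h3

/-- A Hurwitz-type theorem: locally uniform limits of zero-free functions. -/
theorem eq_zero_or_ne_zero_of_tendsto {ι : Type*} {p : Filter ι} [p.NeBot] {F : ι → ℂ → ℂ}
    {P : ℂ → ℂ} {U : Set ℂ} (hU : IsOpen U) (hUc : IsPreconnected U)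
    (hF : ∀ᶠ n in p, DifferentiableOn ℂ (F n) U) (hlim : TendstoLocallyUniformlyOn F P p U)
    (h0 : ∀ᶠ n in p, ∀ z ∈ U, F n z ≠ 0) : (∀ z ∈ U, P z = 0) ∨ ∀ z ∈ U, P z ≠ 0 := by
  have hP : DifferentiableOn ℂ P U := hlim.differentiableOn hF hU
  have hPa : AnalyticOnNhd ℂ P U := hP.analyticOnNhd hU
  by_contra! hcon
  obtain ⟨⟨z₁, hz₁, hne⟩, z₀, hz₀, hzero⟩ := hcon
  rcases (hPa z₀ hz₀).eventually_eq_zero_or_eventually_ne_zero with h | h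
  · exact hne (hPa.eqOn_zero_of_preconnected_of_eventuallyEq_zero hUc hz₀ h hz₁)
  rw [eventually_nhdsWithin_iff] at h
  obtain ⟨r, hr, hball⟩ := nhds_basis_closedBall.mem_iff.1 (h.and (hU.mem_nhds hz₀))
  have hcpt : IsCompact (closedBall z₀ r) := isCompact_closedBall z₀ r
  have hsub : closedBall z₀ r ⊆ U := fun z hz => (hball hz).2
  have hsph : (sphere z₀ r).Nonempty := NormedSpace.sphere_nonempty.2 hr.le
  obtain ⟨w, hw, hmin⟩ := (isCompact_sphere z₀ r).exists_isMinOn hsph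
    ((hP.continuousOn.mono (sphere_subset_closedBall.trans hsub)).norm)
  have hm : 0 < ‖P w‖ := norm_pos_iff.2 ((hball (sphere_subset_closedBall hw)).1 (by
    rintro rfl
    simp at hw
    exact hr.ne hw))
  have hun := (tendstoLocallyUniformlyOn_iff_forall_isCompact hU).1 hlim _ hsub hcpt
  obtain ⟨n, ⟨hn1, hn2⟩, hn3⟩ := ((hF.and h0).and
    (Metric.tendstoUniformlyOn_iff.1 hun (‖P w‖ / 3) (by positivity))).exists
  have h1 : ‖F n z₀‖ < ‖P w‖ / 3 := by
    have := hn3 z₀ (mem_closedBall_self hr.le)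
    rwa [hzero, dist_zero_left] at this
  have h2 : ∀ z ∈ frontier (ball z₀ r), ‖(F n z)⁻¹‖ ≤ (2 * ‖P w‖ / 3)⁻¹ := by
    intro z hz
    rw [frontier_ball _ hr.ne'] at hz
    rw [norm_inv]
    gcongr
    have h3 := hn3 z (sphere_subset_closedBall hz)
    have h4 : ‖P w‖ ≤ ‖P z‖ := hmin hz
    rw [dist_eq_norm] at h3
    linarith [norm_sub_norm_le (P z) (F n z)]
  have hd : DifferentiableOn ℂ (fun z => (F n z)⁻¹) (closedBall z₀ r) :=
    (hn1.mono hsub).inv fun z hz => hn2 z (hsub hz)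
  have h3 := norm_le_of_forall_mem_frontier_norm_le isBounded_ball
    (hd.diffContOnCl_ball subset_rfl) h2 (subset_closure (mem_ball_self hr))
  rw [norm_inv, inv_le_inv₀ (norm_pos_iff.2 (hn2 z₀ hz₀)) (by positivity)] at h3
  linarith

/-- Pointwise convergence of locally equi-Lipschitz functions is locally uniform. -/
theorem tendstoLocallyUniformlyOn_of_lipschitz {p : Filter ℕ} [p.NeBot] {F : ℕ → ℂ → ℂ}
    {H : ℂ → ℂ} {U : Set ℂ} {L : ℝ} (hL : 0 < L)
    (hF : ∀ᶠ n in p, ∀ x ∈ U, ∀ y ∈ U, ‖F n x - F n y‖ ≤ L * ‖x - y‖)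
    (hlim : ∀ x ∈ U, Tendsto (fun n => F n x) p (𝓝 (H x))) :
    TendstoLocallyUniformlyOn F H p U := by
  have hH : ∀ x ∈ U, ∀ y ∈ U, ‖H x - H y‖ ≤ L * ‖x - y‖ := fun x hx y hy =>
    le_of_tendsto ((hlim x hx).sub (hlim y hy)).norm (by
      filter_upwards [hF] with n hn using hn x hx y hy)
  rw [Metric.tendstoLocallyUniformlyOn_iff]
  intro ε hε x hx
  refine ⟨U ∩ ball x (ε / (3 * L)), inter_mem self_mem_nhdsWithin
    (mem_nhdsWithin_of_mem_nhds (ball_mem_nhds x (by positivity))), ?_⟩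
  filter_upwards [hF, (Metric.tendsto_nhds.1 (hlim x hx)) (ε / 3) (by positivity)] with n hn hnx
  rintro y ⟨hyU, hy⟩
  rw [mem_ball, dist_eq_norm, lt_div_iff₀ (by positivity)] at hy
  have h1 := hH y hyU x hx
  have h2 := hn x hx y hyU
  rw [norm_sub_rev x y] at h2
  rw [dist_comm, dist_eq_norm] at hnx
  have h3 : H y - F n y = (H y - H x) + (H x - F n x) + (F n x - F n y) := by ring
  rw [dist_eq_norm, h3]
  refine (norm_add₃_le).trans_lt ?_
  linarith

theorem norm_le_of_le_mul_log {x : ℝ} (hx : 0 ≤ x)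
    (h : x * (1 + x ^ 2) ≤ 32 * ((2 + x ^ 2) * Real.log (2 + x ^ 2))) :
    x ≤ 2 + 256 * Real.log 256 := by
  have hlog := log_two_add_sq_pos x
  have h1 : x ≤ 64 * Real.log (2 + x ^ 2) := by
    by_contra! h2
    nlinarith [mul_nonneg hlog.le (sq_nonneg x), sq_nonneg x]
  have h2 : Real.log (2 + x ^ 2) ≤ 2 * Real.log (2 + x) := by
    rw [← Real.log_rpow (by linarith)]
    refine Real.log_le_log (by positivity) ?_
    norm_num
    nlinarith
  have h3 : Real.log (2 + x) ≤ (2 + x) / 256 - 1 + Real.log 256 := by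
    have h4 := Real.log_le_sub_one_of_pos (show 0 < (2 + x) / 256 by positivity)
    rw [Real.log_div (by positivity) (by norm_num)] at h4
    linarith
  linarith

theorem not_exists_rescaled_sequence (H : ℕ → ℂ → ℂ)
    (hd : ∀ n, DifferentiableOn ℂ (H n) (ball 0 n))
    (hb : ∀ n : ℕ, ∀ z ∈ ball (0 : ℂ) n, ‖deriv (H n) z‖ ≤ 4 * (1 + ‖H n z‖ ^ 2))
    (h0 : ∀ n, 1 + ‖H n 0‖ ^ 2 ≤ ‖deriv (H n) 0‖)
    (hP : ∀ n : ℕ, ∀ z ∈ ball (0 : ℂ) n, deriv (H n) z + H n z ^ 2 ≠ 0) : False := by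
  set B : ℝ := 2 + 256 * Real.log 256 with hB
  have hB0 : ∀ n, 1 ≤ n → ‖H n 0‖ ≤ B := by
    intro n hn
    have hsub : ball (0 : ℂ) 1 ⊆ ball 0 n := ball_subset_ball (by exact_mod_cast hn)
    have h1 := norm_mul_norm_deriv_le_of_spherical_bound (by norm_num : (1 : ℝ) ≤ 4)
      ((hd n).mono hsub) (fun z hz => hb n z (hsub hz))
    refine norm_le_of_le_mul_log (norm_nonneg _) ?_
    calc _ ≤ ‖H n 0‖ * ‖deriv (H n) 0‖ := by gcongr; exact h0 n
      _ ≤ _ := h1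
      _ = _ := by ring
  have hloc : ∀ R : ℝ, 0 < R → ∃ M, ∀ n : ℕ, R + 1 ≤ n → ∀ z ∈ ball (0 : ℂ) R, ‖H n z‖ ≤ M := by
    intro R hR
    refine ⟨Real.exp (Real.log (2 + B ^ 2) * Real.exp (16 * 4 * R)), fun n hn z hz => ?_⟩
    have hsub : ball (0 : ℂ) (R + 1) ⊆ ball 0 n := ball_subset_ball hn
    have h1 := log_two_add_norm_sq_le (by norm_num : (1 : ℝ) ≤ 4)
      ((hd n).mono hsub) (fun z hz => hb n z (hsub hz)) hz
    have hn1 : 1 ≤ n := by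
      have : (1 : ℝ) ≤ n := by linarith
      exact_mod_cast this
    have h2 : Real.log (2 + ‖H n z‖ ^ 2) ≤ Real.log (2 + B ^ 2) * Real.exp (16 * 4 * R) := by
      refine h1.trans ?_
      rw [mem_ball, dist_eq_norm] at hz
      have := hB0 n hn1
      have := log_two_add_sq_pos B
      gcongr
    rw [Real.log_le_iff_le_exp (by positivity)] at h2
    nlinarith [sq_nonneg (‖H n z‖ - 1)]
  set p : Filter ℕ := (hyperfilter ℕ : Filter ℕ) with hp
  have hlarge : ∀ R : ℝ, ∀ᶠ n : ℕ in p, R ≤ n := fun R =>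
    (Nat.hyperfilter_le_atTop) ((tendsto_natCast_atTop_atTop (R := ℝ)).eventually_ge_atTop R)
  have hex : ∀ z : ℂ, ∃ w, Tendsto (fun n => H n z) p (𝓝 w) := by
    intro z
    obtain ⟨M, hM⟩ := hloc (‖z‖ + 1) (by positivity)
    have hz : z ∈ ball (0 : ℂ) (‖z‖ + 1) := by simp
    obtain ⟨w, -, hw⟩ := (isCompact_closedBall (0 : ℂ) M).ultrafilter_le_nhds
      ((hyperfilter ℕ).map fun n => H n z) (by
        have h1 : ∀ᶠ n in p, H n z ∈ closedBall 0 M := by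
          filter_upwards [hlarge (‖z‖ + 1 + 1)] with n hn
          simpa using hM n hn z hz
        exact le_principal_iff.2 h1)
    exact ⟨w, hw⟩
  choose G hG using hex
  have htlu : ∀ R : ℝ, 0 < R → TendstoLocallyUniformlyOn H G p (ball 0 R) := by
    intro R hR
    obtain ⟨M, hM⟩ := hloc R hR
    refine tendstoLocallyUniformlyOn_of_lipschitz (L := 4 * (1 + M ^ 2)) (by positivity) ?_
      (fun x _ => hG x)
    filter_upwards [hlarge (R + 1)] with n hn x hx y hy
    have hsub : ball (0 : ℂ) R ⊆ ball 0 n := ball_subset_ball (by linarith)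
    refine (convex_ball (0 : ℂ) R).norm_image_sub_le_of_norm_deriv_le (𝕜 := ℂ)
      (fun z hz => (hd n).differentiableAt (isOpen_ball.mem_nhds (hsub hz))) (fun z hz => ?_) hy hx
    have := hM n hn z hz
    refine (hb n z (hsub hz)).trans ?_
    gcongr
  have hdR : ∀ R : ℝ, ∀ᶠ n in p, DifferentiableOn ℂ (H n) (ball 0 R) := fun R => by
    filter_upwards [hlarge R] with n hn using (hd n).mono (ball_subset_ball hn)
  have hGd : Differentiable ℂ G := fun z =>
    ((htlu (‖z‖ + 1) (by positivity)).differentiableOn (hdR _) isOpen_ball).differentiableAt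
      (isOpen_ball.mem_nhds (by simp))
  have hder : ∀ R : ℝ, 0 < R → TendstoLocallyUniformlyOn (fun n => deriv (H n)) (deriv G) p
      (ball 0 R) := fun R hR => (htlu R hR).deriv (hdR R) isOpen_ball
  have hder1 : ∀ z, Tendsto (fun n => deriv (H n) z) p (𝓝 (deriv G z)) := fun z =>
    (hder (‖z‖ + 1) (by positivity)).tendsto_at (by simp)
  have hGb : ∀ z, ‖deriv G z‖ ≤ 4 * (1 + ‖G z‖ ^ 2) := fun z =>
    le_of_tendsto_of_tendsto (hder1 z).norm ((((hG z).norm.pow 2).const_add 1).const_mul 4) (by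
      filter_upwards [hlarge (‖z‖ + 1)] with n hn
      exact hb n z (by rw [mem_ball_zero_iff]; linarith))
  have hG0 : 1 + ‖G 0‖ ^ 2 ≤ ‖deriv G 0‖ :=
    le_of_tendsto_of_tendsto' (((hG 0).norm.pow 2).const_add 1) (hder1 0).norm h0
  have hPR : ∀ R : ℝ, 0 < R → (∀ z ∈ ball (0 : ℂ) R, deriv G z + G z ^ 2 = 0) ∨
      ∀ z ∈ ball (0 : ℂ) R, deriv G z + G z ^ 2 ≠ 0 := by
    intro R hR
    have h1 := (htlu R hR).mul₀ (htlu R hR) hGd.continuous.continuousOn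
      hGd.continuous.continuousOn
    have h2 := (hder R hR).add h1
    refine eq_zero_or_ne_zero_of_tendsto (p := p)
      (F := fun n z => deriv (H n) z + H n z ^ 2) isOpen_ball
      (convex_ball (0 : ℂ) R).isPreconnected ?_ ?_ ?_
    · filter_upwards [hdR R] with n hn using (hn.deriv isOpen_ball).add (hn.pow 2)
    · simp only [sq]
      exact h2
    · filter_upwards [hlarge R] with n hn z hz using hP n z (ball_subset_ball hn hz)
  have hPall : (∀ z, deriv G z + G z ^ 2 = 0) ∨ ∀ z, deriv G z + G z ^ 2 ≠ 0 := by
    by_contra! hcon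
    obtain ⟨⟨z₁, hz₁⟩, z₀, hz₀⟩ := hcon
    rcases hPR (‖z₀‖ + ‖z₁‖ + 1) (by positivity) with h | h
    · exact hz₁ (h z₁ (by rw [mem_ball_zero_iff]; linarith [norm_nonneg z₀]))
    · exact h z₀ (by rw [mem_ball_zero_iff]; linarith [norm_nonneg z₁]) hz₀
  rw [deriv_eq_zero_of_spherical_bound hGd hGb hPall 0, norm_zero] at hG0
  nlinarith [sq_nonneg ‖G 0‖]

/-- The rescaling step of Zalcman's lemma. -/
theorem exists_rescaling {G : ℂ → ℂ} (hd : DifferentiableOn ℂ G (ball 0 2))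
    (hP : ∀ z ∈ ball (0 : ℂ) 2, deriv G z + G z ^ 2 ≠ 0) {s : ℝ} (hs : 1 ≤ s)
    (hbig : s ^ 2 * (1 + ‖G 0‖ ^ 2) ≤ ‖deriv G 0‖) :
    ∃ H : ℂ → ℂ, DifferentiableOn ℂ H (ball 0 (s / 2)) ∧
      (∀ z ∈ ball (0 : ℂ) (s / 2), ‖deriv H z‖ ≤ 4 * (1 + ‖H z‖ ^ 2)) ∧
      1 + ‖H 0‖ ^ 2 ≤ ‖deriv H 0‖ ∧ ∀ z ∈ ball (0 : ℂ) (s / 2), deriv H z + H z ^ 2 ≠ 0 := by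
  have hsub : closedBall (0 : ℂ) 1 ⊆ ball 0 2 := closedBall_subset_ball (by norm_num)
  have hGc : ContinuousOn (fun x : ℝ × ℂ => G x.2) (Icc 0 1 ×ˢ closedBall 0 1) :=
    (hd.continuousOn.mono hsub).comp continuousOn_snd fun x hx => hx.2
  have hGc' : ContinuousOn (fun x : ℝ × ℂ => deriv G x.2) (Icc 0 1 ×ˢ closedBall 0 1) :=
    ((hd.deriv isOpen_ball).continuousOn.mono hsub).comp continuousOn_snd fun x hx => hx.2
  have hρc : ContinuousOn (fun x : ℝ × ℂ => x.1 * (1 - ‖x.2‖)) (Icc 0 1 ×ˢ closedBall 0 1) :=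
    Continuous.continuousOn (by fun_prop)
  set A : Set (ℝ × ℂ) := {x ∈ Icc 0 1 ×ˢ closedBall 0 1 |
    1 + (x.1 * (1 - ‖x.2‖)) ^ 2 * ‖G x.2‖ ^ 2 ≤ (x.1 * (1 - ‖x.2‖)) ^ 2 * ‖deriv G x.2‖} with hA
  have hcpt : IsCompact (Icc (0 : ℝ) 1 ×ˢ closedBall (0 : ℂ) 1) :=
    isCompact_Icc.prod (isCompact_closedBall _ _)
  have hAc : IsCompact A := hcpt.of_isClosed_subset
    (hcpt.isClosed.isClosed_le
      (continuousOn_const.add ((hρc.pow 2).mul (hGc.norm.pow 2))) ((hρc.pow 2).mul hGc'.norm)) (fun x hx => hx.1)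
  have hs0 : 0 < s := by linarith
  have hs1 : s⁻¹ ≤ 1 := inv_le_one_of_one_le₀ hs
  have hmem : ((s⁻¹, 0) : ℝ × ℂ) ∈ A := by
    refine ⟨⟨⟨by positivity, hs1⟩, by simp⟩, ?_⟩
    simp only [norm_zero, sub_zero, mul_one]
    have h1 : s⁻¹ ^ 2 * (s ^ 2 * (1 + ‖G 0‖ ^ 2)) ≤ s⁻¹ ^ 2 * ‖deriv G 0‖ := by gcongr
    have h2 : s⁻¹ ^ 2 * (s ^ 2 * (1 + ‖G 0‖ ^ 2)) = 1 + 1 * ‖G 0‖ ^ 2 := by field_simp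
    have h3 : s⁻¹ ^ 2 * ‖G 0‖ ^ 2 ≤ 1 * ‖G 0‖ ^ 2 := by
      gcongr
      exact pow_le_one₀ (by positivity) hs1
    linarith
  obtain ⟨⟨t, z₀⟩, ⟨⟨⟨ht0, ht1⟩, hz₀⟩, hz₀A⟩, hmin⟩ := hAc.exists_isMinOn ⟨_, hmem⟩
    continuous_fst.continuousOn
  simp only at hz₀A ht0 ht1 hz₀
  have hts : t ≤ s⁻¹ := hmin hmem
  have hz₀1 : ‖z₀‖ ≤ 1 := by simpa using hz₀
  have ht : 0 < t := by
    rcases ht0.eq_or_lt with rfl | h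
    · norm_num at hz₀A
    · exact h
  have hd0 : 0 < 1 - ‖z₀‖ := by
    rcases (sub_nonneg.2 hz₀1).eq_or_lt with h | h
    · rw [← h] at hz₀A
      norm_num at hz₀A
    · exact h
  have hle : ∀ z ∈ closedBall (0 : ℂ) 1,
      (t * (1 - ‖z‖)) ^ 2 * ‖deriv G z‖ ≤ 1 + (t * (1 - ‖z‖)) ^ 2 * ‖G z‖ ^ 2 := by
    intro z hz
    have h1 : Tendsto (fun τ : ℝ => (τ * (1 - ‖z‖)) ^ 2 * ‖deriv G z‖) (𝓝[<] t)
        (𝓝 ((t * (1 - ‖z‖)) ^ 2 * ‖deriv G z‖)) :=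
      (Continuous.tendsto (by fun_prop) t).mono_left nhdsWithin_le_nhds
    have h2 : Tendsto (fun τ : ℝ => 1 + (τ * (1 - ‖z‖)) ^ 2 * ‖G z‖ ^ 2) (𝓝[<] t)
        (𝓝 (1 + (t * (1 - ‖z‖)) ^ 2 * ‖G z‖ ^ 2)) :=
      (Continuous.tendsto (by fun_prop) t).mono_left nhdsWithin_le_nhds
    refine le_of_tendsto_of_tendsto h1 h2 ?_
    filter_upwards [Ioo_mem_nhdsLT ht] with τ hτ
    by_contra! hcon
    have h3 : t ≤ τ := hmin (show (τ, z) ∈ A from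
      ⟨⟨⟨hτ.1.le, hτ.2.le.trans ht1⟩, hz⟩, hcon.le⟩)
    exact absurd hτ.2 (not_lt.2 h3)
  set ρ := t * (1 - ‖z₀‖) with hρ
  have hρ0 : 0 < ρ := mul_pos ht hd0
  have hball : ∀ ζ ∈ ball (0 : ℂ) (s / 2), (1 - ‖z₀‖) / 2 ≤ 1 - ‖z₀ + ρ * ζ‖ := by
    intro ζ hζ
    rw [mem_ball_zero_iff] at hζ
    have h1 := norm_add_le z₀ (ρ * ζ)
    rw [norm_mul, norm_real, Real.norm_of_nonneg hρ0.le] at h1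
    have h2 : ρ * ‖ζ‖ ≤ (1 - ‖z₀‖) / 2 := by
      calc ρ * ‖ζ‖ ≤ s⁻¹ * (1 - ‖z₀‖) * (s / 2) := by
            rw [hρ]; gcongr
        _ = _ := by field_simp
    linarith
  have hmem2 : ∀ ζ ∈ ball (0 : ℂ) (s / 2), z₀ + ρ * ζ ∈ closedBall (0 : ℂ) 1 := by
    intro ζ hζ
    rw [mem_closedBall_zero_iff]
    linarith [hball ζ hζ]
  have hder : ∀ ζ ∈ ball (0 : ℂ) (s / 2),
      HasDerivAt (fun ζ => ρ * G (z₀ + ρ * ζ)) (ρ ^ 2 * deriv G (z₀ + ρ * ζ)) ζ := by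
    intro ζ hζ
    have h1 := (hd.differentiableAt (isOpen_ball.mem_nhds (hsub (hmem2 ζ hζ)))).hasDerivAt
    have h2 : HasDerivAt (fun ζ : ℂ => z₀ + ρ * ζ) (ρ * 1) ζ :=
      ((hasDerivAt_id ζ).const_mul (ρ : ℂ)).const_add z₀
    refine ((h1.comp ζ h2).const_mul (ρ : ℂ)).congr_deriv ?_
    ring
  have hnorm : ∀ ζ, ‖(ρ : ℂ) * G (z₀ + ρ * ζ)‖ ^ 2 = ρ ^ 2 * ‖G (z₀ + ρ * ζ)‖ ^ 2 := by
    intro ζ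
    rw [norm_mul, norm_real, Real.norm_of_nonneg hρ0.le, mul_pow]
  have hnorm' : ∀ w : ℂ, ‖(ρ : ℂ) ^ 2 * w‖ = ρ ^ 2 * ‖w‖ := by
    intro w
    rw [norm_mul, norm_pow, norm_real, Real.norm_of_nonneg hρ0.le]
  refine ⟨fun ζ => ρ * G (z₀ + ρ * ζ),
    fun ζ hζ => (hder ζ hζ).differentiableAt.differentiableWithinAt, fun ζ hζ => ?_, ?_,
    fun ζ hζ => ?_⟩
  · rw [(hder ζ hζ).deriv, hnorm, hnorm']
    have h1 := hle _ (hmem2 ζ hζ)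
    have h2 := hball ζ hζ
    set τ := t * (1 - ‖z₀ + ρ * ζ‖) with hτ
    have h3 : ρ ≤ 2 * τ := by rw [hρ, hτ]; nlinarith
    have h4 : 0 < τ := by linarith
    have h5 : ρ ^ 2 ≤ 4 * τ ^ 2 := by nlinarith
    have h6 : ρ ^ 2 * (τ ^ 2 * ‖deriv G (z₀ + ρ * ζ)‖) ≤
      ρ ^ 2 * (1 + τ ^ 2 * ‖G (z₀ + ρ * ζ)‖ ^ 2) := by gcongr
    have h7 : τ ^ 2 * (ρ ^ 2 * ‖deriv G (z₀ + ρ * ζ)‖) ≤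
      τ ^ 2 * (4 * (1 + ρ ^ 2 * ‖G (z₀ + ρ * ζ)‖ ^ 2)) := by
      nlinarith [mul_nonneg (mul_nonneg (sq_nonneg ρ) (sq_nonneg τ))
        (sq_nonneg ‖G (z₀ + ρ * ζ)‖)]
    exact le_of_mul_le_mul_left h7 (by positivity)
  · rw [(hder 0 (mem_ball_self (by positivity))).deriv, hnorm, hnorm']
    simpa using hz₀A
  · rw [(hder ζ hζ).deriv]
    have h1 := hP _ (hsub (hmem2 ζ hζ))
    rw [mul_pow, ← mul_add]
    exact mul_ne_zero (pow_ne_zero _ (by exact_mod_cast hρ0.ne')) h1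

/-- Functions on a disc with `G' + G² ≠ 0` have uniformly bounded spherical derivative at the
centre. -/
theorem exists_spherical_bound : ∃ C : ℝ, 1 ≤ C ∧ ∀ G : ℂ → ℂ, DifferentiableOn ℂ G (ball 0 2) →
    (∀ z ∈ ball (0 : ℂ) 2, deriv G z + G z ^ 2 ≠ 0) → ‖deriv G 0‖ ≤ C * (1 + ‖G 0‖ ^ 2) := by
  by_contra! hcon
  have hex : ∀ n : ℕ, ∃ H : ℂ → ℂ, DifferentiableOn ℂ H (ball 0 n) ∧
      (∀ z ∈ ball (0 : ℂ) n, ‖deriv H z‖ ≤ 4 * (1 + ‖H z‖ ^ 2)) ∧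
      1 + ‖H 0‖ ^ 2 ≤ ‖deriv H 0‖ ∧ ∀ z ∈ ball (0 : ℂ) n, deriv H z + H z ^ 2 ≠ 0 := by
    intro n
    have hn : (0 : ℝ) ≤ n := n.cast_nonneg
    obtain ⟨G, hd, hP, hG⟩ := hcon ((2 * n + 1 : ℝ) ^ 2) (by nlinarith)
    obtain ⟨H, h1, h2, h3, h4⟩ := exists_rescaling hd hP (by linarith) hG.le
    have hsub : ball (0 : ℂ) n ⊆ ball 0 ((2 * n + 1) / 2) := ball_subset_ball (by linarith)
    exact ⟨H, h1.mono hsub, fun z hz => h2 z (hsub hz), h3, fun z hz => h4 z (hsub hz)⟩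
  choose H h1 h2 h3 h4 using hex
  exact not_exists_rescaled_sequence H h1 h2 h3 h4

theorem hasDerivAt_rescale {g : ℂ → ℂ} (hg : Differentiable ℂ g) (ρ : ℝ) (z ζ : ℂ) :
    HasDerivAt (fun ζ : ℂ => (ρ : ℂ) * g (z + ρ * ζ)) ((ρ : ℂ) ^ 2 * deriv g (z + ρ * ζ)) ζ := by
  have h1 := (hg (z + ρ * ζ)).hasDerivAt
  have h2 : HasDerivAt (fun ζ : ℂ => z + ρ * ζ) (ρ * 1) ζ :=
    ((hasDerivAt_id ζ).const_mul (ρ : ℂ)).const_add z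
  refine ((h1.comp ζ h2).const_mul (ρ : ℂ)).congr_deriv ?_
  ring

theorem exists_im_sq_mul_norm_deriv_le {g : ℂ → ℂ} (hg : Differentiable ℂ g)
    (hfin : {z : ℂ | deriv g z + g z ^ 2 = 0 ∧ 0 < z.im}.Finite) :
    ∃ C R : ℝ, 1 ≤ C ∧ 0 < R ∧ ∀ z : ℂ, 0 < z.im → R ≤ ‖z‖ →
      z.im ^ 2 * ‖deriv g z‖ ≤ C * (1 + z.im ^ 2 * ‖g z‖ ^ 2) := by
  obtain ⟨C, hC, hCG⟩ := exists_spherical_bound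
  obtain ⟨M, hM⟩ := hfin.isBounded.exists_norm_le
  refine ⟨16 * C, 2 * |M| + 1, by linarith, by positivity, fun z hz hzR => ?_⟩
  set y := z.im with hy
  set ρ : ℝ := y / 4 with hρ
  have hρ0 : 0 < ρ := by positivity
  have hyz : y ≤ ‖z‖ := (le_abs_self _).trans (abs_im_le_norm z)
  have h1 := hCG (fun ζ => (ρ : ℂ) * g (z + ρ * ζ))
    (fun ζ _ => (hasDerivAt_rescale hg ρ z ζ).differentiableAt.differentiableWithinAt) ?_
  · rw [(hasDerivAt_rescale hg ρ z 0).deriv] at h1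
    simp only [mul_zero, add_zero, norm_mul, norm_pow, norm_real, Real.norm_of_nonneg hρ0.le] at h1
    rw [hρ] at h1
    nlinarith [mul_nonneg (sq_nonneg y) (sq_nonneg ‖g z‖), norm_nonneg (deriv g z)]
  · intro ζ hζ
    rw [(hasDerivAt_rescale hg ρ z ζ).deriv, mul_pow, ← mul_add]
    refine mul_ne_zero (pow_ne_zero _ (by exact_mod_cast hρ0.ne')) fun h0 => ?_
    rw [mem_ball_zero_iff] at hζ
    have h2 : ‖(ρ : ℂ) * ζ‖ < y / 2 := by
      rw [norm_mul, norm_real, Real.norm_of_nonneg hρ0.le, hρ]; nlinarith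
    have h3 : |((ρ : ℂ) * ζ).im| < y / 2 := (abs_im_le_norm _).trans_lt h2
    have h4 := hM (z + ρ * ζ) ⟨h0, by rw [add_im]; linarith [neg_lt_of_abs_lt h3]⟩
    have h5 := norm_sub_le_norm_add z (ρ * ζ)
    linarith [le_abs_self M]

theorem exists_im_cube_mul_le {g : ℂ → ℂ} (hg : Differentiable ℂ g)
    (hfin : {z : ℂ | deriv g z + g z ^ 2 = 0 ∧ 0 < z.im}.Finite) :
    ∃ C R : ℝ, 1 ≤ C ∧ 0 < R ∧ ∀ z : ℂ, 0 < z.im → R ≤ ‖z‖ →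
      z.im ^ 3 * (‖g z‖ * ‖deriv g z‖) ≤ C * ((2 + z.im ^ 2 * ‖g z‖ ^ 2) *
        Real.log (2 + z.im ^ 2 * ‖g z‖ ^ 2)) := by
  obtain ⟨C, R, hC, hR, hCR⟩ := exists_im_sq_mul_norm_deriv_le hg hfin
  refine ⟨8 * (8 * (9 * C)), 2 * R, by linarith, by linarith, fun z hz hzR => ?_⟩
  set y := z.im with hy
  set ρ : ℝ := y / 2 with hρ
  have hρ0 : 0 < ρ := by positivity
  have hyz : y ≤ ‖z‖ := (le_abs_self _).trans (abs_im_le_norm z)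
  have h1 := norm_mul_norm_deriv_le_of_spherical_bound (K := 9 * C) (by linarith) (c := 0)
    (h := fun ζ => (ρ : ℂ) * g (z + ρ * ζ))
    (fun ζ _ => (hasDerivAt_rescale hg ρ z ζ).differentiableAt.differentiableWithinAt) ?_
  · rw [(hasDerivAt_rescale hg ρ z 0).deriv] at h1
    simp only [mul_zero, add_zero, norm_mul, norm_pow, norm_real, Real.norm_of_nonneg hρ0.le] at h1
    have h2 : (ρ * ‖g z‖) ^ 2 ≤ y ^ 2 * ‖g z‖ ^ 2 := by
      rw [hρ]; nlinarith [mul_nonneg (sq_nonneg y) (sq_nonneg ‖g z‖)]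
    have h3 : (2 + (ρ * ‖g z‖) ^ 2) * Real.log (2 + (ρ * ‖g z‖) ^ 2) ≤
        (2 + y ^ 2 * ‖g z‖ ^ 2) * Real.log (2 + y ^ 2 * ‖g z‖ ^ 2) := by
      have := log_two_add_sq_pos (ρ * ‖g z‖)
      gcongr
    calc y ^ 3 * (‖g z‖ * ‖deriv g z‖) = 8 * (ρ * ‖g z‖ * (ρ ^ 2 * ‖deriv g z‖)) := by
          rw [hρ]; ring
      _ ≤ 8 * (8 * (9 * C) * ((2 + (ρ * ‖g z‖) ^ 2) * Real.log (2 + (ρ * ‖g z‖) ^ 2))) := by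
          gcongr
      _ ≤ 8 * (8 * (9 * C) * ((2 + y ^ 2 * ‖g z‖ ^ 2) * Real.log (2 + y ^ 2 * ‖g z‖ ^ 2))) := by
          gcongr
      _ = _ := by ring
  · intro ζ hζ
    rw [(hasDerivAt_rescale hg ρ z ζ).deriv]
    simp only [norm_mul, norm_pow, norm_real, Real.norm_of_nonneg hρ0.le]
    rw [mem_ball_zero_iff] at hζ
    have h2 : ‖(ρ : ℂ) * ζ‖ < y / 2 := by
      rw [norm_mul, norm_real, Real.norm_of_nonneg hρ0.le, hρ]; nlinarith
    have h3 := abs_lt.1 ((abs_im_le_norm _).trans_lt h2)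
    set w := z + ρ * ζ with hw
    have hwim : w.im = y + ((ρ : ℂ) * ζ).im := by rw [hw, add_im]
    have h5 := norm_sub_le_norm_add z (ρ * ζ)
    have h6 := hCR w (by linarith) (by linarith)
    have h7 : ρ ≤ w.im := by linarith
    have h8 : w.im ≤ 3 * ρ := by linarith
    calc ρ ^ 2 * ‖deriv g w‖ ≤ w.im ^ 2 * ‖deriv g w‖ := by gcongr
      _ ≤ _ := h6
      _ ≤ C * (1 + (3 * ρ) ^ 2 * ‖g w‖ ^ 2) := by gcongr; linarith
      _ ≤ 9 * C * (1 + (ρ * ‖g w‖) ^ 2) := by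
        nlinarith [mul_nonneg (sq_nonneg ρ) (sq_nonneg ‖g w‖)]

/-- A logarithmic measure of the size of `g` at a point of the upper half plane. -/
noncomputable def logSize (g : ℂ → ℂ) (z : ℂ) : ℝ := Real.log (2 + z.im ^ 2 * ‖g z‖ ^ 2)

theorem half_lt_logSize (g : ℂ → ℂ) (z : ℂ) : 1 / 2 < logSize g z := by
  have h1 : Real.log 2 ≤ logSize g z :=
    Real.log_le_log (by norm_num) (by linarith [mul_nonneg (sq_nonneg z.im) (sq_nonneg ‖g z‖)])
  linarith [Real.log_two_gt_d9]

theorem exp_logSize (g : ℂ → ℂ) (z : ℂ) :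
    Real.exp (logSize g z) = 2 + z.im ^ 2 * ‖g z‖ ^ 2 :=
  Real.exp_log (by positivity)

theorem im_mul_norm_le_exp_logSize (g : ℂ → ℂ) (z : ℂ) :
    z.im * ‖g z‖ ≤ Real.exp (logSize g z) := by
  rw [exp_logSize]
  nlinarith [sq_nonneg (z.im * ‖g z‖ - 1)]

theorem logSize_le_along_path {g : ℂ → ℂ} (hg : Differentiable ℂ g)
    (hfin : {z : ℂ | deriv g z + g z ^ 2 = 0 ∧ 0 < z.im}.Finite) :
    ∃ C R : ℝ, 0 ≤ C ∧ 0 < R ∧ ∀ (γ γ' : ℝ → ℂ) (a b : ℝ),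
      (∀ t ∈ uIcc a b, HasDerivAt γ (γ' t) t ∧ 0 < (γ t).im ∧ R ≤ ‖γ t‖ ∧ ‖γ' t‖ ≤ (γ t).im) →
      logSize g (γ b) ≤ Real.exp (C * |b - a|) * logSize g (γ a) := by
  obtain ⟨C, R, hC, hR, hCR⟩ := exists_im_cube_mul_le hg hfin
  refine ⟨4 + 2 * C, R, by linarith, hR, fun γ γ' a b hγ => ?_⟩
  have hder : ∀ t ∈ uIcc a b, ∃ d : ℝ, HasDerivAt (fun t => Real.log (logSize g (γ t))) d t ∧
      |d| ≤ 4 + 2 * C := by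
    intro t ht
    obtain ⟨h1, h2, h3, h4⟩ := hγ t ht
    obtain ⟨L, hL, hL'⟩ := exists_hasFDerivAt_norm_sq (hg (γ t))
    have h5 : HasDerivAt (fun t => ‖g (γ t)‖ ^ 2) (L (γ' t)) t := hL.comp_hasDerivAt t h1
    have h6 : HasDerivAt (fun t => (γ t).im) (γ' t).im t :=
      imCLM.hasFDerivAt.comp_hasDerivAt t h1
    set y := (γ t).im with hy
    set u := logSize g (γ t) with hu
    have hu0 : 1 / 2 < u := half_lt_logSize g (γ t)
    set A := ‖g (γ t)‖ with hA
    have hE : 0 < 2 + y ^ 2 * A ^ 2 := by positivity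
    have h7 : HasDerivAt (fun t => 2 + (γ t).im ^ 2 * ‖g (γ t)‖ ^ 2)
        (2 * y * (γ' t).im * A ^ 2 + y ^ 2 * L (γ' t)) t :=
      (((h6.pow 2).mul h5).const_add 2).congr_deriv (by simp [hy, hA])
    have h9 : HasDerivAt (fun t => Real.log (logSize g (γ t)))
        ((2 * y * (γ' t).im * A ^ 2 + y ^ 2 * L (γ' t)) / (2 + y ^ 2 * A ^ 2) / u) t :=
      (h7.log hE.ne').log (by rw [← logSize]; linarith)
    refine ⟨_, h9, ?_⟩
    have h10 : |(γ' t).im| ≤ y := (abs_im_le_norm _).trans h4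
    have h11 : |L (γ' t)| ≤ 2 * A * ‖deriv g (γ t)‖ * y :=
      (L.le_opNorm _).trans (by gcongr)
    have h12 : y ^ 3 * (A * ‖deriv g (γ t)‖) ≤ C * ((2 + y ^ 2 * A ^ 2) * u) := hCR _ h2 h3
    rw [div_div, abs_div, abs_of_pos (mul_pos hE (by linarith : 0 < u)),
      div_le_iff₀ (mul_pos hE (by linarith : 0 < u))]
    calc |2 * y * (γ' t).im * A ^ 2 + y ^ 2 * L (γ' t)|
        ≤ |2 * y * (γ' t).im * A ^ 2| + |y ^ 2 * L (γ' t)| := abs_add_le _ _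
      _ = 2 * y * |(γ' t).im| * A ^ 2 + y ^ 2 * |L (γ' t)| := by
        simp only [abs_mul, abs_pow, abs_two, abs_of_pos h2, abs_of_nonneg (norm_nonneg _), hA]
      _ ≤ 2 * y * y * A ^ 2 + y ^ 2 * (2 * A * ‖deriv g (γ t)‖ * y) := by gcongr
      _ = 2 * (y ^ 2 * A ^ 2) + 2 * (y ^ 3 * (A * ‖deriv g (γ t)‖)) := by ring
      _ ≤ 2 * (2 + y ^ 2 * A ^ 2) + 2 * (C * ((2 + y ^ 2 * A ^ 2) * u)) := by linarith
      _ ≤ _ := by nlinarith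
  choose! d hd using hder
  have h1 := (convex_uIcc a b).norm_image_sub_le_of_norm_hasDerivWithin_le
    (fun t ht => (hd t ht).1.hasDerivWithinAt) (fun t ht => (hd t ht).2) left_mem_uIcc right_mem_uIcc
  have hpos : ∀ z, 0 < logSize g z := fun z => by linarith [half_lt_logSize g z]
  rw [← Real.exp_log (hpos (γ a)), ← Real.exp_add, ← Real.log_le_iff_le_exp (hpos _)]
  have h2 := le_of_abs_le h1
  rw [Real.norm_eq_abs] at h2
  linarith

theorem exists_logSize_compare {g : ℂ → ℂ} (hg : Differentiable ℂ g)
    (hfin : {z : ℂ | deriv g z + g z ^ 2 = 0 ∧ 0 < z.im}.Finite) :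
    ∃ (K R : ℝ) (N : ℕ), 1 ≤ K ∧ 1 ≤ R ∧ 1 ≤ N ∧
      (∀ x r η : ℝ, R ≤ r → |x| ≤ 4 * r → 0 < η → η ≤ r → (R ≤ |x| ∨ R ≤ η) →
        logSize g ⟨x, η⟩ ≤ K * (r / η) ^ N * logSize g ⟨0, r⟩ ∧
        logSize g ⟨0, r⟩ ≤ K * (r / η) ^ N * logSize g ⟨x, η⟩) ∧
      ∀ r, R ≤ r → logSize g ⟨0, r⟩ ≤ K * r ^ N := by
  obtain ⟨C, R, hC, hR, hCR⟩ := logSize_le_along_path hg hfin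
  have hpos : ∀ z, 0 < logSize g z := fun z => by linarith [half_lt_logSize g z]
  have habs : ∀ z : ℂ, |z.re| ≤ ‖z‖ ∧ |z.im| ≤ ‖z‖ := fun z => ⟨abs_re_le_norm z, abs_im_le_norm z⟩
  have hhor : ∀ x x' r : ℝ, R ≤ r → |x' - x| ≤ 4 * r →
      logSize g ⟨x', r⟩ ≤ Real.exp (C * 4) * logSize g ⟨x, r⟩ := by
    intro x x' r hr hx
    have hr0 : 0 < r := hR.trans_le hr
    have h1 := hCR (fun t => (r : ℂ) * t + r * I) (fun _ => r) (x / r) (x' / r) (fun t _ => by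
      refine ⟨?_, ?_, ?_, ?_⟩
      · simpa using ((ofRealCLM.hasDerivAt (x := t)).const_mul (r : ℂ)).add_const (r * I)
      · simpa using hr0
      · refine le_trans ?_ (habs _).2
        simpa using hr.trans (le_abs_self r)
      · simp [abs_of_pos hr0])
    have h2 : ∀ s : ℝ, (r : ℂ) * ((s / r : ℝ) : ℂ) + r * I = ⟨s, r⟩ := fun s => by
      apply Complex.ext <;> simp [mul_div_cancel₀ _ hr0.ne']
    simp only [h2] at h1
    refine h1.trans ?_
    have := hpos ⟨x, r⟩
    gcongr
    rw [← sub_div, abs_div, abs_of_pos hr0, div_le_iff₀ hr0]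
    exact hx
  have hvert : ∀ x a b : ℝ, 0 < a → 0 < b → (R ≤ |x| ∨ R ≤ min a b) →
      logSize g ⟨x, b⟩ ≤ Real.exp (C * |Real.log b - Real.log a|) * logSize g ⟨x, a⟩ := by
    intro x a b ha hb hx
    have h1 := hCR (fun t => (x : ℂ) + (Real.exp t : ℝ) * I) (fun t => (Real.exp t : ℝ) * I)
      (Real.log a) (Real.log b) (fun t ht => by
      refine ⟨?_, ?_, ?_, ?_⟩
      · exact (((Real.hasDerivAt_exp t).ofReal_comp).mul_const I).const_add (x : ℂ)
      · simpa [-ofReal_exp] using Real.exp_pos t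
      · rcases hx with hx | hx
        · refine le_trans ?_ (habs _).1
          simpa using hx
        · refine le_trans ?_ (habs _).2
          have h2 : Real.log (min a b) ≤ t := by
            rcases le_total a b with h | h
            · rw [min_eq_left h]
              exact (uIcc_of_le (Real.log_le_log ha h) ▸ ht).1
            · rw [min_eq_right h]
              exact (uIcc_of_ge (Real.log_le_log hb h) ▸ ht).1
          rw [Real.log_le_iff_le_exp (lt_min ha hb)] at h2
          simpa [-ofReal_exp] using hx.trans h2
      · simp [-ofReal_exp])
    have h2 : ∀ s : ℝ, 0 < s → (x : ℂ) + (Real.exp (Real.log s) : ℝ) * I = ⟨x, s⟩ := fun s hs => by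
      rw [Real.exp_log hs]
      apply Complex.ext <;> simp
    simpa only [h2 a ha, h2 b hb] using h1
  obtain ⟨N, hN⟩ := exists_nat_ge C
  have hratio : ∀ η r : ℝ, 0 < η → η ≤ r →
      Real.exp (C * |Real.log r - Real.log η|) ≤ (r / η) ^ (N + 1) ∧
      Real.exp (C * |Real.log η - Real.log r|) ≤ (r / η) ^ (N + 1) := by
    intro η r hη hηr
    have hr := hη.trans_le hηr
    rw [abs_sub_comm (Real.log η), and_self, ← Real.log_div hr.ne' hη.ne',
      ← Real.exp_log (show 0 < (r / η) ^ (N + 1) by positivity), Real.exp_le_exp, Real.log_pow]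
    have h1 : 0 ≤ Real.log (r / η) := Real.log_nonneg ((one_le_div hη).2 hηr)
    rw [abs_of_nonneg h1]
    gcongr
    push_cast
    linarith
  set R₁ := max R 1 with hR₁
  have hRR : R ≤ R₁ := le_max_left _ _
  have hR1 : 1 ≤ R₁ := le_max_right _ _
  have hexp1 : 1 ≤ Real.exp (C * 4) := Real.one_le_exp (by positivity)
  set u₀ := logSize g ⟨0, R₁⟩ with hu₀
  have hu₀0 : 0 < u₀ := hpos _
  have hkey : ∀ x r η : ℝ, R₁ ≤ r → |x| ≤ 4 * r → 0 < η → η ≤ r → (R₁ ≤ |x| ∨ R₁ ≤ η) →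
        logSize g ⟨x, η⟩ ≤ Real.exp (C * 4) * (r / η) ^ (N + 1) * logSize g ⟨0, r⟩ ∧
        logSize g ⟨0, r⟩ ≤ Real.exp (C * 4) * (r / η) ^ (N + 1) * logSize g ⟨x, η⟩ := by
    intro x r η hr hx hη hηr hor
    have hr0 : 0 < r := by linarith
    have hor' : ∀ c, η ≤ c → (R ≤ |x| ∨ R ≤ min η c ∧ R ≤ min c η) := fun c hc => by
      rcases hor with h | h
      · exact Or.inl (hRR.trans h)
      · exact Or.inr ⟨le_min (hRR.trans h) (by linarith), le_min (by linarith) (hRR.trans h)⟩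
    obtain ⟨h1, h2⟩ := hratio η r hη hηr
    have p1 := hpos ⟨0, r⟩
    have p2 := hpos ⟨x, η⟩
    have p3 := hpos ⟨x, r⟩
    constructor
    · calc logSize g ⟨x, η⟩ ≤ Real.exp (C * |Real.log η - Real.log r|) * logSize g ⟨x, r⟩ :=
          hvert x r η hr0 hη ((hor' r hηr).imp_right And.right)
        _ ≤ (r / η) ^ (N + 1) * (Real.exp (C * 4) * logSize g ⟨0, r⟩) := by
          gcongr
          exact hhor 0 x r (hRR.trans hr) (by simpa using hx)
        _ = _ := by ring
    · calc logSize g ⟨0, r⟩ ≤ Real.exp (C * 4) * logSize g ⟨x, r⟩ :=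
          hhor x 0 r (hRR.trans hr) (by simpa using hx)
        _ ≤ Real.exp (C * 4) * ((r / η) ^ (N + 1) * logSize g ⟨x, η⟩) := by
          gcongr
          refine (hvert x η r hη hr0 ((hor' r hηr).imp_right And.left)).trans ?_
          gcongr
        _ = _ := by ring
  refine ⟨Real.exp (C * 4) * max 1 u₀, R₁, N + 1, ?_, hR1, by omega, fun x r η hr hx hη hηr hor => ?_,
    fun r hr => ?_⟩
  · nlinarith [le_max_left 1 u₀]
  · obtain ⟨h1, h2⟩ := hkey x r η hr hx hη hηr hor
    have hr0 : 0 < r := by linarith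
    have p1 := hpos ⟨0, r⟩
    have p2 := hpos ⟨x, η⟩
    have hle : Real.exp (C * 4) ≤ Real.exp (C * 4) * max 1 u₀ :=
      le_mul_of_one_le_right (by positivity) (le_max_left _ _)
    constructor
    · refine h1.trans ?_
      gcongr
    · refine h2.trans ?_
      gcongr
  · have hr0 : 0 < r := by linarith
    have h1 := (hkey 0 r R₁ hr (by simp; linarith) (by linarith) hr (Or.inr le_rfl)).2
    refine h1.trans ?_
    calc _ ≤ Real.exp (C * 4) * r ^ (N + 1) * max 1 u₀ := by
          gcongr
          · exact div_le_self hr0.le hR1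
          · exact le_max_right _ _
      _ = _ := by ring

/-- Powers of points in a thin sector have large real part. -/
theorem half_norm_pow_le_re_pow {w : ℂ} {τ : ℝ} {N : ℕ} (hw : |w.im| ≤ τ * w.re)
    (hτ : 0 < τ) (hN : 4 * N * τ ≤ 1) : ‖w‖ ^ N / 2 ≤ (w ^ N).re := by
  have hre : 0 ≤ w.re := by nlinarith [abs_nonneg w.im]
  have h0 : ‖w - (‖w‖ : ℂ)‖ ≤ 2 * τ * ‖w‖ := by
    have h1 : ‖w‖ ≤ |w.re| + |w.im| := norm_le_abs_re_add_abs_im w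
    have h2 := norm_le_abs_re_add_abs_im (w - (‖w‖ : ℂ))
    simp only [sub_re, sub_im, ofReal_re, ofReal_im, sub_zero] at h2
    have h3 := re_le_norm w
    rw [abs_of_nonpos (by linarith : w.re - ‖w‖ ≤ 0)] at h2
    rw [abs_of_nonneg hre] at h1
    nlinarith
  have h1 : ∀ n : ℕ, ‖w ^ n - (‖w‖ : ℂ) ^ n‖ ≤ n * (2 * τ) * ‖w‖ ^ n := by
    intro n
    induction n with
    | zero => simp
    | succ n ih =>
      have h2 : w ^ (n + 1) - (‖w‖ : ℂ) ^ (n + 1) =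
          w * (w ^ n - (‖w‖ : ℂ) ^ n) + (w - ‖w‖) * (‖w‖ : ℂ) ^ n := by ring
      rw [h2]
      refine (norm_add_le _ _).trans ?_
      rw [norm_mul, norm_mul, norm_pow, norm_real, norm_norm]
      calc _ ≤ ‖w‖ * (n * (2 * τ) * ‖w‖ ^ n) + 2 * τ * ‖w‖ * ‖w‖ ^ n := by gcongr
        _ = _ := by push_cast; ring
  have h2 := (abs_le.1 ((abs_re_le_norm _).trans (h1 N))).1
  rw [sub_re, ← ofReal_pow, ofReal_re] at h2
  nlinarith [pow_nonneg (norm_nonneg w) N]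

theorem abs_im_inv_le {w : ℂ} {τ : ℝ} (hw : |w.im| ≤ τ * w.re) :
    |w⁻¹.im| ≤ τ * w⁻¹.re := by
  rw [inv_im, inv_re, abs_div, abs_neg, abs_of_nonneg (normSq_nonneg w), ← mul_div_assoc]
  exact div_le_div_of_nonneg_right hw (normSq_nonneg w)

theorem re_le_norm_le_two_mul_re {w : ℂ} {τ : ℝ} (hw : |w.im| ≤ τ * w.re) (hτ : 0 < τ) (hτ1 : τ ≤ 1) :
    ‖w‖ ≤ 2 * w.re := by
  have hre : 0 ≤ w.re := by nlinarith [abs_nonneg w.im]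
  have h1 : ‖w‖ ≤ |w.re| + |w.im| := norm_le_abs_re_add_abs_im w
  rw [abs_of_nonneg hre] at h1
  nlinarith

theorem inv_two_mul_pow_le_re_inv_pow {w : ℂ} {τ : ℝ} {N : ℕ} (hw : |w.im| ≤ τ * w.re)
    (hτ : 0 < τ) (hτ1 : τ ≤ 1) (hN : 4 * N * τ ≤ 1) :
    ((2 * w.re) ^ N)⁻¹ / 2 ≤ (w⁻¹ ^ N).re := by
  refine le_trans ?_ (half_norm_pow_le_re_pow (abs_im_inv_le hw) hτ hN)
  have hre : 0 ≤ w.re := by nlinarith [abs_nonneg w.im]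
  rcases hre.eq_or_lt with h | h
  · have h0 : w = 0 := by
      apply Complex.ext
      · exact h.symm
      · rw [← h, mul_zero] at hw
        exact abs_eq_zero.1 (le_antisymm hw (abs_nonneg _))
    rcases N.eq_zero_or_pos with rfl | hN0
    · simp [h0]
    · simp [h0, hN0.ne']
  · have hw0 : 0 < ‖w‖ := h.trans_le (re_le_norm w)
    rw [norm_inv, inv_pow]
    gcongr
    exact re_le_norm_le_two_mul_re hw hτ hτ1

theorem exists_pos_lt_and_le_exp_inv_pow {N : ℕ} (hN : 1 ≤ N) {B : ℝ} (hB0 : 0 < B) (M : ℝ) :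
    ∃ ε : ℝ, 0 < ε ∧ ε < 1 / 4 ∧ M ≤ Real.exp (B * (((2 * ε) ^ N)⁻¹ / 2)) := by
  have ht : Tendsto (fun ε : ℝ => Real.exp (B * (((2 * ε) ^ N)⁻¹ / 2))) (𝓝[>] 0) atTop := by
    refine Real.tendsto_exp_atTop.comp (Tendsto.const_mul_atTop hB0 ?_)
    refine Tendsto.atTop_div_const (by norm_num) (tendsto_inv_nhdsGT_zero.comp ?_)
    refine tendsto_nhdsWithin_iff.2 ⟨?_, ?_⟩
    · have : Continuous fun ε : ℝ => (2 * ε) ^ N := by fun_prop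
      simpa [show N ≠ 0 by omega] using this.tendsto 0 |>.mono_left nhdsWithin_le_nhds
    · filter_upwards [self_mem_nhdsWithin] with ε hε
      have : (0 : ℝ) < ε := hε
      simp only [mem_Ioi]; positivity
  obtain ⟨ε, h5, h6⟩ := ((ht.eventually_ge_atTop M).and
    (Ioo_mem_nhdsGT (show (0 : ℝ) < 1 / 4 by norm_num))).exists
  exact ⟨ε, h6.1, h6.2, h5⟩

/-- A function with a polynomial-exponential singular bound near the real axis is bounded
by a comparable quantity inside. -/
theorem norm_le_exp_of_norm_le_exp_inv_pow {N : ℕ} (hN : 1 ≤ N) {τ : ℝ} (hτ : 0 < τ)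
    (hτN : 4 * N * τ ≤ 1) {f : ℂ → ℂ} (hf : Differentiable ℂ f) {K : ℝ} (hK : 0 < K)
    (hb : ∀ ζ : ℂ, 1 / 2 ≤ ζ.re → ζ.re ≤ 2 → ζ.im ≠ 0 → |ζ.im| ≤ 1 →
      ‖f ζ‖ ≤ Real.exp (K / |ζ.im| ^ N)) {ζ₀ : ℂ} (h1 : 3 / 4 ≤ ζ₀.re) (h2 : ζ₀.re ≤ 1)
    (h3 : |ζ₀.im| ≤ τ / 8) : ‖f ζ₀‖ ≤ Real.exp (4 * K * (8 / τ) ^ N) := by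
  have hN' : (1 : ℝ) ≤ N := by exact_mod_cast hN
  have hτ1 : τ ≤ 1 / 4 := by nlinarith
  set B : ℝ := 2 * K * (2 / τ) ^ N with hB
  have hB0 : 0 < B := by positivity
  have hBK : K / τ ^ N = B / 2 * (1 / 2) ^ N := by
    rw [hB, div_pow, div_pow]
    field_simp
    ring
  have hBτ : ∀ s : ℝ, K / (τ * s) ^ N = B / 2 * ((2 * s) ^ N)⁻¹ := by
    intro s
    rw [mul_pow, div_mul_eq_div_div, hBK, mul_pow, mul_inv, one_div, inv_pow]
    ring
  set E : ℂ → ℂ := fun ζ => f ζ * exp (-(B * ((ζ - 1 / 2)⁻¹ ^ N + (2 - ζ)⁻¹ ^ N))) with hE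
  have hnE : ∀ ζ, ‖E ζ‖ = ‖f ζ‖ *
      Real.exp (-(B * (((ζ - 1 / 2)⁻¹ ^ N).re + ((2 - ζ)⁻¹ ^ N).re))) := by
    intro ζ
    rw [hE, norm_mul, norm_exp, neg_re, re_ofReal_mul, add_re]
  have re1 : ∀ ζ : ℂ, (ζ - 1 / 2).re = ζ.re - 1 / 2 := fun ζ => by simp
  have im1 : ∀ ζ : ℂ, (ζ - 1 / 2).im = ζ.im := fun ζ => by simp
  have re2 : ∀ ζ : ℂ, (2 - ζ).re = 2 - ζ.re := fun ζ => by simp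
  have im2 : ∀ ζ : ℂ, |(2 - ζ).im| = |ζ.im| := fun ζ => by simp
  have hw1 : ∀ ζ : ℂ, |ζ.im| ≤ τ * (ζ.re - 1 / 2) →
      ((2 * (ζ.re - 1 / 2)) ^ N)⁻¹ / 2 ≤ ((ζ - 1 / 2)⁻¹ ^ N).re := fun ζ hζ => by
    rw [← re1]
    exact inv_two_mul_pow_le_re_inv_pow (by rw [re1, im1]; exact hζ) hτ (by linarith) hτN
  have hw2 : ∀ ζ : ℂ, |ζ.im| ≤ τ * (2 - ζ.re) →
      ((2 * (2 - ζ.re)) ^ N)⁻¹ / 2 ≤ ((2 - ζ)⁻¹ ^ N).re := fun ζ hζ => by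
    rw [← re2]
    exact inv_two_mul_pow_le_re_inv_pow (by rw [re2, im2]; exact hζ) hτ (by linarith) hτN
  obtain ⟨M, hM⟩ := (isCompact_closedBall (0 : ℂ) 4).exists_bound_of_continuousOn
    hf.continuous.continuousOn
  obtain ⟨ε, hε, hε4, hεM⟩ : ∃ ε : ℝ, 0 < ε ∧ ε < 1 / 4 ∧
      |M| ≤ Real.exp (B * (((2 * ε) ^ N)⁻¹ / 2)) :=
    exists_pos_lt_and_le_exp_inv_pow hN hB0 |M|
  have c0 : Continuous fun ζ : ℂ => |ζ.im| := continuous_im.abs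
  have c1 : Continuous fun ζ : ℂ => τ * (ζ.re - 1 / 2) :=
    (continuous_re.sub continuous_const).const_mul τ
  have c2 : Continuous fun ζ : ℂ => τ * (2 - ζ.re) :=
    (continuous_const.sub continuous_re).const_mul τ
  set U : Set ℂ := {ζ | |ζ.im| < τ * (ζ.re - 1 / 2) ∧ |ζ.im| < τ * (2 - ζ.re) ∧
    1 / 2 + ε < ζ.re ∧ ζ.re < 2 - ε} with hU
  have hUo : IsOpen U := by
    exact (isOpen_lt c0 c1).inter ((isOpen_lt c0 c2).inter
      ((isOpen_lt continuous_const continuous_re).inter (isOpen_lt continuous_re continuous_const)))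
  set V : Set ℂ := {ζ | |ζ.im| ≤ τ * (ζ.re - 1 / 2) ∧ |ζ.im| ≤ τ * (2 - ζ.re) ∧
    1 / 2 + ε ≤ ζ.re ∧ ζ.re ≤ 2 - ε} with hV
  have hVc : IsClosed V := by
    exact (isClosed_le c0 c1).inter ((isClosed_le c0 c2).inter
      ((isClosed_le continuous_const continuous_re).inter
        (isClosed_le continuous_re continuous_const)))
  have hcl : closure U ⊆ V := closure_minimal
    (fun ζ hζ => ⟨hζ.1.le, hζ.2.1.le, hζ.2.2.1.le, hζ.2.2.2.le⟩) hVc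
  have hV4 : V ⊆ closedBall 0 4 := by
    intro ζ hζ
    rw [mem_closedBall_zero_iff]
    have := norm_le_abs_re_add_abs_im ζ
    rw [abs_of_nonneg (by linarith [hζ.2.2.1] : 0 ≤ ζ.re)] at this
    nlinarith [hζ.2.1, hζ.2.2.1, hζ.2.2.2]
  have hEd : DifferentiableOn ℂ E V := by
    intro ζ hζ
    have d1 : ζ - 1 / 2 ≠ 0 := fun h => by
      have := congrArg re h
      rw [re1, zero_re] at this
      linarith [hζ.2.2.1]
    have d2 : 2 - ζ ≠ 0 := fun h => by
      have := congrArg re h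
      rw [re2, zero_re] at this
      linarith [hζ.2.2.2]
    refine DifferentiableAt.differentiableWithinAt ?_
    simp only [hE]
    have e1 : DifferentiableAt ℂ (fun ζ : ℂ => (ζ - 1 / 2)⁻¹ ^ N) ζ :=
      (DifferentiableAt.fun_inv (h := fun ζ : ℂ => ζ - 1 / 2) (by fun_prop) d1).fun_pow N
    have e2 : DifferentiableAt ℂ (fun ζ : ℂ => (2 - ζ)⁻¹ ^ N) ζ :=
      (DifferentiableAt.fun_inv (h := fun ζ : ℂ => 2 - ζ) (by fun_prop) d2).fun_pow N
    exact (hf ζ).fun_mul ((e1.fun_add e2).const_mul (B : ℂ)).fun_neg.cexp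
  have hEc : DiffContOnCl ℂ E U :=
    ⟨hEd.mono (subset_closure.trans hcl), hEd.continuousOn.mono hcl⟩
  have hfr : ∀ ζ ∈ frontier U, ‖E ζ‖ ≤ 1 := by
    intro ζ hζ
    have hζV := hcl hζ.1
    have hζU : ζ ∉ U := hUo.interior_eq ▸ hζ.2
    have a1 := hw1 ζ hζV.1
    have a2 := hw2 ζ hζV.2.1
    have s1 : 0 < ζ.re - 1 / 2 := by linarith [hζV.2.2.1]
    have s2 : 0 < 2 - ζ.re := by linarith [hζV.2.2.2]
    have b1 : 0 ≤ ((2 * (ζ.re - 1 / 2)) ^ N)⁻¹ / 2 := by positivity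
    have b2 : 0 ≤ ((2 * (2 - ζ.re)) ^ N)⁻¹ / 2 := by positivity
    rw [hnE, Real.exp_neg]
    rw [← div_eq_mul_inv, div_le_one (Real.exp_pos _)]
    have hslant : ∀ s : ℝ, 0 < s → |ζ.im| = τ * s →
        ‖f ζ‖ ≤ Real.exp (B * (((2 * s) ^ N)⁻¹ / 2)) := by
      intro s hs h
      have h4 := hb ζ (by linarith) (by linarith)
        (fun h0 => by rw [h0, abs_zero] at h; nlinarith [mul_pos hτ hs])
        (by nlinarith [hζV.1, hζV.2.2.1, hζV.2.2.2])
      rw [h, hBτ] at h4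
      refine h4.trans_eq ?_
      congr 1; ring
    have hend : ‖f ζ‖ ≤ Real.exp (B * (((2 * ε) ^ N)⁻¹ / 2)) :=
      ((hM ζ (hV4 hζV)).trans (le_abs_self M)).trans hεM
    rcases hζV.1.eq_or_lt with e1 | e1
    · refine (hslant _ s1 e1).trans ?_
      gcongr; linarith
    rcases hζV.2.1.eq_or_lt with e2 | e2
    · refine (hslant _ s2 e2).trans ?_
      gcongr; linarith
    rcases hζV.2.2.1.eq_or_lt with e3 | e3
    · refine hend.trans ?_
      rw [show ζ.re - 1 / 2 = ε by linarith] at a1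
      gcongr; linarith
    rcases hζV.2.2.2.eq_or_lt with e4 | e4
    · refine hend.trans ?_
      rw [show 2 - ζ.re = ε by linarith] at a2
      gcongr; linarith
    exact absurd ⟨e1, e2, e3, e4⟩ hζU
  have hbd : Bornology.IsBounded U :=
    isBounded_closedBall.subset ((subset_closure.trans hcl).trans hV4)
  have hζ₀ : ζ₀ ∈ closure U := subset_closure
    ⟨by nlinarith, by nlinarith, by linarith, by linarith⟩
  have h5 := Complex.norm_le_of_forall_mem_frontier_norm_le hbd hEc hfr hζ₀
  rw [hnE, Real.exp_neg, ← div_eq_mul_inv, div_le_one (Real.exp_pos _)] at h5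
  refine h5.trans (Real.exp_le_exp.2 ?_)
  have hpw : ∀ w : ℂ, 1 / 4 ≤ w.re → (w⁻¹ ^ N).re ≤ 4 ^ N := fun w hw => by
    refine (re_le_norm _).trans ?_
    rw [norm_pow, norm_inv]
    gcongr
    rw [inv_le_comm₀ (by linarith [re_le_norm w]) (by norm_num)]
    linarith [re_le_norm w]
  have h6 := hpw (ζ₀ - 1 / 2) (by rw [re1]; linarith)
  have h7 := hpw (2 - ζ₀) (by rw [re2]; linarith)
  calc _ ≤ B * (4 ^ N + 4 ^ N) := by gcongr
    _ = 4 * K * ((2 / τ) ^ N * 4 ^ N) := by rw [hB]; ring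
    _ = _ := by rw [← mul_pow]; congr 2; ring

theorem exists_polynomial_of_frequently_norm_le {g : ℂ → ℂ} (hg : Differentiable ℂ g) (M : ℕ)
    (h : ∀ R : ℝ, ∃ r, R ≤ r ∧ ∀ z : ℂ, ‖z‖ = r → ‖g z‖ ≤ r ^ M) :
    ∃ p : Polynomial ℂ, ∀ z, g z = p.eval z := by
  have hzero : ∀ n, M < n → iteratedDeriv n g 0 = 0 := by
    intro n hn
    refine norm_le_zero_iff.1 (le_of_forall_pos_le_add fun ε hε => ?_)
    obtain ⟨r, hr, hgr⟩ := h (max 1 (n.factorial / ε))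
    have hr1 : 1 ≤ r := (le_max_left _ _).trans hr
    have hr2 : n.factorial / ε ≤ r := (le_max_right _ _).trans hr
    have hr0 : 0 < r := by linarith
    have h1 := Complex.norm_iteratedDeriv_le_of_forall_mem_sphere_norm_le n hr0
      (c := 0) (C := r ^ M) hg.diffContOnCl fun z hz => hgr z (by simpa using hz)
    rw [zero_add]
    refine h1.trans ?_
    rw [div_le_iff₀ hε] at hr2
    rw [div_le_iff₀ (by positivity)]
    calc (n.factorial : ℝ) * r ^ M ≤ (r * ε) * r ^ M := by gcongr
      _ = ε * r ^ (M + 1) := by ring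
      _ ≤ ε * r ^ n := by gcongr; omega
  refine ⟨∑ n ∈ Finset.range (M + 1),
    Polynomial.C ((n.factorial : ℂ)⁻¹ * iteratedDeriv n g 0) * Polynomial.X ^ n, fun z => ?_⟩
  rw [← Complex.taylorSeries_eq_of_entire' 0 z hg, tsum_eq_sum (s := Finset.range (M + 1)),
    Polynomial.eval_finsetSum]
  · simp
  · intro n hn
    rw [Finset.mem_range, not_lt] at hn
    rw [hzero n (by omega)]
    simp

theorem norm_conj_eq {g : ℂ → ℂ} (hreal : ∀ z, g (conj z) = conj (g z)) (z : ℂ) :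
    ‖g (conj z)‖ = ‖g z‖ := by
  rw [hreal, norm_conj]

theorem exists_norm_le_exp_mul_logSize {g : ℂ → ℂ} (hg : Differentiable ℂ g)
    (hreal : ∀ z, g (conj z) = conj (g z))
    (hfin : {z : ℂ | deriv g z + g z ^ 2 = 0 ∧ 0 < z.im}.Finite) :
    ∃ C R : ℝ, 1 ≤ C ∧ 1 ≤ R ∧ ∀ r, R ≤ r → ∀ z : ℂ, ‖z‖ = r →
      ‖g z‖ ≤ Real.exp (C * logSize g ⟨0, r⟩) := by
  obtain ⟨K, R, N, hK, hR, hN, hcmp, -⟩ := exists_logSize_compare hg hfin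
  have hpt : ∀ (r : ℝ) (z : ℂ), R ≤ r → |z.re| ≤ 4 * r → z.im ≠ 0 → |z.im| ≤ r →
      (R ≤ |z.re| ∨ R ≤ |z.im|) →
      ‖g z‖ ≤ Real.exp ((K + 2) * logSize g ⟨0, r⟩ * (r / |z.im|) ^ N) := by
    intro r z hr hx hz hzr hor
    have hη : 0 < |z.im| := abs_pos.2 hz
    have hr1 : 1 ≤ r := hR.trans hr
    have hnorm : ‖g z‖ = ‖g ⟨z.re, |z.im|⟩‖ := by
      rcases abs_cases z.im with ⟨h, -⟩ | ⟨h, -⟩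
      · rw [h]
      · rw [h, ← norm_conj_eq hreal z]; rfl
    rw [hnorm]
    have h1 := (hcmp z.re r |z.im| hr hx hη hzr hor).1
    have h2 := im_mul_norm_le_exp_logSize g ⟨z.re, |z.im|⟩
    simp only at h2
    set A := ‖g ⟨z.re, |z.im|⟩‖ with hA
    set u := logSize g ⟨0, r⟩ with hu
    have hu0 : 1 / 2 < u := half_lt_logSize _ _
    set q := r / |z.im| with hq
    have hq1 : 1 ≤ q := (one_le_div hη).2 hzr
    have hqN : q ≤ q ^ N := le_self_pow₀ hq1 (by omega)
    have h3 : |z.im|⁻¹ ≤ Real.exp (2 * u * q ^ N) := by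
      calc |z.im|⁻¹ ≤ q := by rw [hq, div_eq_mul_inv]; exact le_mul_of_one_le_left (by positivity) hr1
        _ ≤ Real.exp q := by linarith [Real.add_one_le_exp q]
        _ ≤ _ := Real.exp_le_exp.2 (by nlinarith)
    calc A = (|z.im| * A) * |z.im|⁻¹ := by field_simp
      _ ≤ Real.exp (K * q ^ N * u) * Real.exp (2 * u * q ^ N) := by
        gcongr
        exact h2.trans (Real.exp_le_exp.2 h1)
      _ = _ := by rw [← Real.exp_add]; congr 1; ring
  set τ : ℝ := (4 * N)⁻¹ with hτ
  have hN0 : (0 : ℝ) < N := by exact_mod_cast hN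
  have hτ0 : 0 < τ := by positivity
  have hτ1 : τ ≤ 1 / 4 := by
    rw [hτ, one_div]
    gcongr
    have : (1 : ℝ) ≤ N := by exact_mod_cast hN
    linarith
  have h8 : 1 ≤ 8 / τ := (one_le_div hτ0).2 (by linarith)
  refine ⟨4 * (K + 2) * (8 / τ) ^ N, 2 * R, ?_, by linarith, fun r hr z hz => ?_⟩
  · have := one_le_pow₀ (n := N) h8
    nlinarith
  set u := logSize g ⟨0, r⟩ with hu
  have hu0 : 1 / 2 < u := half_lt_logSize _ _
  have hr0 : 0 < r := by linarith
  have hre : |z.re| ≤ r := hz ▸ abs_re_le_norm z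
  have him : |z.im| ≤ r := hz ▸ abs_im_le_norm z
  rcases le_or_gt |z.im| (τ / 8 * r) with hcase | hcase
  · have hside : ∀ s : ℝ, |s| = 1 → 0 ≤ s * z.re →
        ‖g z‖ ≤ Real.exp (4 * ((K + 2) * u) * (8 / τ) ^ N) := by
      intro s hs hsz
      have hs2 : s * s = 1 := by rw [← abs_mul_abs_self, hs, one_mul]
      have h1 := norm_le_exp_of_norm_le_exp_inv_pow hN hτ0 (by rw [hτ]; field_simp; rfl)
        (f := fun ζ => g ((r * s : ℝ) * ζ)) (hg.comp (differentiable_id.const_mul _))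
        (K := (K + 2) * u) (by positivity) (fun ζ h1 h2 h3 h4 => by
          have e1 : |(((r * s : ℝ) : ℂ) * ζ).re| = r * ζ.re := by
            rw [re_ofReal_mul, abs_mul, abs_mul, hs, abs_of_pos hr0, abs_of_nonneg (by linarith),
              mul_one]
          have e2 : |(((r * s : ℝ) : ℂ) * ζ).im| = r * |ζ.im| := by
            rw [im_ofReal_mul, abs_mul, abs_mul, hs, abs_of_pos hr0, mul_one]
          have h5 := hpt r ((r * s : ℝ) * ζ) (by linarith) (by rw [e1]; nlinarith)
            (by rw [← abs_pos, e2]; exact mul_pos hr0 (abs_pos.2 h3)) (by rw [e2]; nlinarith)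
            (Or.inl (by rw [e1]; nlinarith))
          refine h5.trans_eq ?_
          rw [e2, div_mul_cancel_left₀ hr0.ne', inv_pow, div_eq_mul_inv])
        (ζ₀ := (s / r : ℝ) * z) ?_ ?_ ?_
      · have e : ((r * s : ℝ) : ℂ) * ((s / r : ℝ) * z) = z := by
          rw [← mul_assoc, ← ofReal_mul, show r * s * (s / r) = 1 by field_simp; linarith,
            ofReal_one, one_mul]
        simpa only [e] using h1
      · rw [re_ofReal_mul, div_mul_eq_mul_div, le_div_iff₀ hr0]
        have h2 : z.re ^ 2 + z.im ^ 2 = r ^ 2 := by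
          rw [← hz, ← normSq_eq_norm_sq, normSq_apply]; ring
        have h3 : z.im ^ 2 ≤ (r / 32) ^ 2 := by
          rw [← sq_abs]
          gcongr
          nlinarith
        refine le_of_not_gt fun h => ?_
        have h4 : (s * z.re) ^ 2 ≤ (3 / 4 * r) ^ 2 := by gcongr
        have h5 : (s * z.re) ^ 2 = z.re ^ 2 := by linear_combination z.re ^ 2 * hs2
        nlinarith
      · rw [re_ofReal_mul, div_mul_eq_mul_div, div_le_one hr0]
        refine (le_abs_self _).trans ?_
        rw [abs_mul, hs, one_mul]
        exact hre
      · rw [im_ofReal_mul, abs_mul, abs_div, hs, abs_of_pos hr0, one_div, inv_mul_le_iff₀ hr0]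
        linarith
    have hfinal : ‖g z‖ ≤ Real.exp (4 * ((K + 2) * u) * (8 / τ) ^ N) := by
      rcases le_total 0 z.re with h | h
      · exact hside 1 (by simp) (by linarith)
      · exact hside (-1) (by simp) (by linarith)
    refine hfinal.trans_eq ?_
    congr 1; ring
  · have hη : 0 < |z.im| := lt_trans (by positivity) hcase
    have h1 := hpt r z (by linarith) (by linarith) (abs_pos.1 hη) him (by
      by_contra! h
      have h2 := norm_le_abs_re_add_abs_im z
      linarith)
    refine h1.trans (Real.exp_le_exp.2 ?_)
    have h2 : r / |z.im| ≤ 8 / τ := by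
      rw [div_le_div_iff₀ hη hτ0]
      linarith
    calc (K + 2) * u * (r / |z.im|) ^ N ≤ (K + 2) * u * (8 / τ) ^ N := by gcongr
      _ ≤ _ := by
        have : 0 ≤ (K + 2) * u * (8 / τ) ^ N := by positivity
        linarith

theorem exists_norm_le_exp_pow {g : ℂ → ℂ} (hg : Differentiable ℂ g)
    (hreal : ∀ z, g (conj z) = conj (g z))
    (hfin : {z : ℂ | deriv g z + g z ^ 2 = 0 ∧ 0 < z.im}.Finite) :
    ∃ (Q : ℕ) (R : ℝ), 1 ≤ R ∧ ∀ z : ℂ, R ≤ ‖z‖ → ‖g z‖ ≤ Real.exp (‖z‖ ^ Q) := by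
  obtain ⟨C, R, hC, hR, hCR⟩ := exists_norm_le_exp_mul_logSize hg hreal hfin
  obtain ⟨K, R', N, hK, hR', hN, -, hu⟩ := exists_logSize_compare hg hfin
  refine ⟨N + 1, max (max R R') (C * K), hR.trans ((le_max_left _ _).trans (le_max_left _ _)),
    fun z hz => ?_⟩
  simp only [max_le_iff] at hz
  obtain ⟨⟨h1, h2⟩, h3⟩ := hz
  refine (hCR _ h1 z rfl).trans (Real.exp_le_exp.2 ?_)
  calc C * logSize g ⟨0, ‖z‖⟩ ≤ C * (K * ‖z‖ ^ N) := by gcongr; exact hu _ h2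
    _ = (C * K) * ‖z‖ ^ N := by ring
    _ ≤ ‖z‖ * ‖z‖ ^ N := by gcongr
    _ = _ := by ring

theorem exists_pow_le_norm {g : ℂ → ℂ} (hg : Differentiable ℂ g)
    (hreal : ∀ z, g (conj z) = conj (g z))
    (htrans : ¬ ∃ p : Polynomial ℂ, ∀ z, g z = p.eval z)
    (hfin : {z : ℂ | deriv g z + g z ^ 2 = 0 ∧ 0 < z.im}.Finite) (n : ℕ) {δ : ℝ} (hδ : 0 < δ) :
    ∃ R : ℝ, 1 ≤ R ∧ ∀ z : ℂ, R ≤ ‖z‖ → δ * ‖z‖ ≤ z.im → ‖z‖ ^ n ≤ ‖g z‖ := by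
  obtain ⟨C, R, hC, hR, hCR⟩ := exists_norm_le_exp_mul_logSize hg hreal hfin
  obtain ⟨K, R', N, hK, hR', hN, hcmp, -⟩ := exists_logSize_compare hg hfin
  have hlog : ∀ B : ℝ, ∃ R₁, ∀ r, R₁ ≤ r → B * Real.log r < logSize g ⟨0, r⟩ := by
    intro B
    by_contra! hcon
    obtain ⟨M, hM⟩ := exists_nat_ge (C * B)
    refine htrans (exists_polynomial_of_frequently_norm_le hg M fun R₁ => ?_)
    obtain ⟨r, hr, hrB⟩ := hcon (max R₁ R)
    rw [max_le_iff] at hr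
    have hr1 : 1 ≤ r := hR.trans hr.2
    refine ⟨r, hr.1, fun z hz => (hCR r hr.2 z hz).trans ?_⟩
    rw [← Real.exp_log (show 0 < r ^ M by positivity), Real.exp_le_exp, Real.log_pow]
    have := Real.log_nonneg hr1
    calc C * logSize g ⟨0, r⟩ ≤ C * (B * Real.log r) := by gcongr
      _ = C * B * Real.log r := by ring
      _ ≤ _ := by gcongr
  obtain ⟨R₁, hR₁⟩ := hlog (K * (1 / δ) ^ N * (2 * n + 3 : ℕ))
  refine ⟨max (max R₁ 2) (max R' (R' / δ)), (by norm_num : (1 : ℝ) ≤ 2).trans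
    ((le_max_right _ _).trans (le_max_left _ _)), fun z hz hzδ => ?_⟩
  simp only [max_le_iff] at hz
  obtain ⟨⟨h1, h2⟩, h3, h4⟩ := hz
  set r := ‖z‖ with hr
  have hr0 : 0 < r := by linarith
  rw [div_le_iff₀ hδ] at h4
  have him : 0 < z.im := (mul_pos hδ hr0).trans_le hzδ
  have h5 := (hcmp z.re r z.im h3 (by linarith [abs_re_le_norm z]) him
    ((le_abs_self _).trans (abs_im_le_norm z)) (Or.inr (by linarith))).2
  have h6 := hR₁ r h1
  set u := logSize g z with hu
  have hu0 : 0 < u := by linarith [half_lt_logSize g z]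
  have h7 : r / z.im ≤ 1 / δ := by
    rw [div_le_div_iff₀ him hδ]; linarith
  have h8 : K * (1 / δ) ^ N * (2 * n + 3 : ℕ) * Real.log r < K * (1 / δ) ^ N * u := by
    refine h6.trans_le (h5.trans ?_)
    change K * (r / z.im) ^ N * u ≤ _
    gcongr
  rw [mul_assoc] at h8
  have h9 := lt_of_mul_lt_mul_left h8 (by positivity)
  rw [← Real.log_pow, ← Real.exp_lt_exp, Real.exp_log (by positivity), hu, exp_logSize] at h9
  have h10 : z.im ^ 2 * ‖g z‖ ^ 2 ≤ r ^ 2 * ‖g z‖ ^ 2 := by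
    gcongr
    exact (le_abs_self _).trans (abs_im_le_norm z)
  by_contra! hcon
  have h11 : ‖g z‖ ^ 2 ≤ (r ^ n) ^ 2 := by gcongr
  have h12 : r ^ 2 * ‖g z‖ ^ 2 ≤ r ^ 2 * (r ^ n) ^ 2 := by gcongr
  have h13 : r ^ (2 * n + 3) = r * (r ^ 2 * (r ^ n) ^ 2) := by ring
  have h14 : 2 ≤ r ^ 2 * (r ^ n) ^ 2 := by
    have := one_le_pow₀ (n := n) (by linarith : 1 ≤ r)
    nlinarith [one_le_pow₀ (n := 2) this]
  nlinarith

theorem mem_Ioo_of_sin_ne_zero {f : ℝ → ℝ} (hf : Continuous f) {x y a : ℝ}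
    (h : ∀ t, 0 < Real.sin (f t - a)) (hx : f x ∈ Ioo a (a + Real.pi)) :
    f y ∈ Ioo a (a + Real.pi) := by
  have hpre : IsPreconnected (range f) := isPreconnected_range hf
  have hval : ∀ c : ℝ, Real.sin (c - a) = 0 → c ∉ range f := by
    rintro c hc ⟨t, rfl⟩
    exact (h t).ne' hc
  constructor
  · by_contra! hy
    exact hval a (by simp) (hpre.ordConnected.out (mem_range_self y) (mem_range_self x)
      ⟨hy, hx.1.le⟩)
  · by_contra! hy
    exact hval (a + Real.pi) (by simp) (hpre.ordConnected.out (mem_range_self x) (mem_range_self y)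
      ⟨hx.2.le, hy⟩)

theorem isSimplyConnected_univ_prod : IsSimplyConnected (univ : Set (ℝ × ℝ)) := by
  have : ContractibleSpace (univ : Set (ℝ × ℝ)) :=
    (convex_univ (𝕜 := ℝ)).contractibleSpace univ_nonempty
  exact (inferInstance : SimplyConnectedSpace (univ : Set (ℝ × ℝ)))

/-- A curve joining the bottom to the top of a rectangle meets every curve joining the left side
to the right side. -/
theorem exists_eq_of_crossing {σ l : ℝ → ℂ} (hσ : Continuous σ) (hl : Continuous l)
    (him : ∀ t, (σ 0).im < (l t).im ∧ (l t).im < (σ 1).im)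
    (hre : ∀ s, (l 0).re < (σ s).re ∧ (σ s).re < (l 1).re) : ∃ s t, σ s = l t := by
  by_contra! hne
  obtain ⟨L, hL, hLe⟩ := exists_continuousOn_eqOn_exp_comp (X := ℝ × ℝ) (U := univ)
    isSimplyConnected_univ_prod isOpen_univ
    (g := fun p => σ p.1 - l p.2) (by fun_prop)
    (by rintro ⟨p, -, hp⟩; exact hne _ _ (sub_eq_zero.1 hp))
  rw [continuousOn_univ] at hL
  set D₀ := σ 0 - l 0 with hD₀
  have hD₀0 : D₀ ≠ 0 := sub_ne_zero.2 (hne 0 0)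
  set θ : ℝ → ℝ → ℝ := fun s t => (L (s, t) - L (0, 0) + log D₀).im with hθ
  have hexp : ∀ s t, exp (L (s, t) - L (0, 0) + log D₀) = σ s - l t := by
    intro s t
    have h1 : exp (L (s, t)) = σ s - l t := hLe (mem_univ (s, t))
    have h2 : exp (L (0, 0)) = D₀ := hLe (mem_univ ((0, 0) : ℝ × ℝ))
    rw [exp_add, exp_sub, exp_log hD₀0, h1, h2, div_mul_cancel₀ _ hD₀0]
  have hsin : ∀ s t, ∃ r : ℝ, 0 < r ∧ (σ s).im - (l t).im = r * Real.sin (θ s t) ∧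
      (σ s).re - (l t).re = r * Real.cos (θ s t) := by
    intro s t
    refine ⟨_, Real.exp_pos (L (s, t) - L (0, 0) + log D₀).re, ?_, ?_⟩
    · rw [← sub_im, ← hexp, exp_im]
    · rw [← sub_re, ← hexp, exp_re]
  have hcs : ∀ t, Continuous fun s => θ s t := fun t => by simp only [hθ]; fun_prop
  have hct : ∀ s, Continuous fun t => θ s t := fun s => by simp only [hθ]; fun_prop
  have bottom : ∀ t, Real.sin (θ 0 t) < 0 := fun t => by
    obtain ⟨r, hr, h1, -⟩ := hsin 0 t
    by_contra! h
    nlinarith [him t, mul_nonneg hr.le h]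
  have top : ∀ t, 0 < Real.sin (θ 1 t) := fun t => by
    obtain ⟨r, hr, h1, -⟩ := hsin 1 t
    by_contra! h
    nlinarith [him t, mul_nonneg hr.le (neg_nonneg.2 h)]
  have left : ∀ s, 0 < Real.cos (θ s 0) := fun s => by
    obtain ⟨r, hr, -, h1⟩ := hsin s 0
    by_contra! h
    nlinarith [hre s, mul_nonneg hr.le (neg_nonneg.2 h)]
  have right : ∀ s, Real.cos (θ s 1) < 0 := fun s => by
    obtain ⟨r, hr, -, h1⟩ := hsin s 1
    by_contra! h
    nlinarith [hre s, mul_nonneg hr.le h]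
  have hθ0 : θ 0 0 = arg D₀ := by simp [hθ, log_im]
  have hpi := Real.pi_pos
  have hstart : θ 0 0 ∈ Ioo (-(Real.pi / 2)) 0 := by
    rw [hθ0]
    refine ⟨?_, ?_⟩
    · exact (abs_lt.1 (abs_arg_lt_pi_div_two_iff.2 (Or.inl (by
        rw [hD₀, sub_re]; linarith [hre 0])))).1
    · exact arg_neg_iff.2 (by rw [hD₀, sub_im]; linarith [him 0])
  have h1 : θ 1 0 ∈ Ioo (-(Real.pi / 2)) (-(Real.pi / 2) + Real.pi) :=
    mem_Ioo_of_sin_ne_zero (hcs 0) (x := 0)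
      (fun s => by rw [sub_neg_eq_add, Real.sin_add_pi_div_two]; exact left s)
      ⟨hstart.1, by linarith [hstart.2]⟩
  have h1' : 0 < θ 1 0 := by
    by_contra! h
    exact absurd (top 0) (not_lt.2 (Real.sin_nonpos_of_nonpos_of_neg_pi_le h (by linarith [h1.1])))
  have h2 : θ 1 1 ∈ Ioo 0 (0 + Real.pi) :=
    mem_Ioo_of_sin_ne_zero (hct 1) (x := 0) (fun t => by rw [sub_zero]; exact top t)
      ⟨h1', by linarith [h1.2]⟩
  have h2' : Real.pi / 2 < θ 1 1 := by
    by_contra! h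
    exact absurd (right 1) (not_lt.2 (Real.cos_nonneg_of_mem_Icc ⟨by linarith [h2.1], h⟩))
  have h3 : θ 0 1 ∈ Ioo (Real.pi / 2) (Real.pi / 2 + Real.pi) :=
    mem_Ioo_of_sin_ne_zero (hcs 1) (x := 1)
      (fun s => by rw [Real.sin_sub_pi_div_two]; linarith [right s])
      ⟨h2', by linarith [h2.2]⟩
  have h3' : Real.pi < θ 0 1 := by
    by_contra! h
    exact absurd (bottom 1) (not_lt.2 (Real.sin_nonneg_of_nonneg_of_le_pi (by linarith [h3.1]) h))
  have h4 : θ 0 0 ∈ Ioo Real.pi (Real.pi + Real.pi) :=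
    mem_Ioo_of_sin_ne_zero (hct 0) (x := 1)
      (fun t => by rw [Real.sin_sub_pi]; linarith [bottom t])
      ⟨h3', by linarith [h3.2]⟩
  linarith [h4.1, hstart.2]

/-- A Phragmén–Lindelöf principle in a thin sector. -/
theorem norm_le_mul_exp_of_frontier {P : ℂ → ℂ} (hP : Differentiable ℂ P) {n : ℕ} {A R τ ρ ε M Λ : ℝ}
    (hgrowth : ∀ z : ℂ, R ≤ ‖z‖ → ‖P z‖ ≤ Real.exp (A * ‖z‖ ^ n)) (hτ : 0 < τ)
    (hτ1 : τ ≤ 1)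
    (hτn : 4 * (n + 1 : ℕ) * τ ≤ 1) (hρ : 0 < ρ) (hε : 0 < ε) (hΛ : 0 ≤ Λ)
    (hM : M ≤ ε * Real.exp (Λ / 2)) {D : Set ℂ}
    (hDs : ∀ z ∈ D, |z.im| ≤ τ * z.re ∧ ρ < ‖z‖)
    (hDf : ∀ z ∈ frontier D, (‖z‖ = ρ ∧ ‖P z‖ ≤ M) ∨ ‖P z‖ ≤ ε) {z₀ : ℂ} (hz₀ : z₀ ∈ D) :
    ‖P z₀‖ ≤ ε * Real.exp (Λ * ρ / ‖z₀‖) := by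
  have hDcl : ∀ z ∈ closure D, |z.im| ≤ τ * z.re ∧ ρ ≤ ‖z‖ := by
    have hc : IsClosed {z : ℂ | |z.im| ≤ τ * z.re ∧ ρ ≤ ‖z‖} :=
      (isClosed_le continuous_im.abs (continuous_re.const_mul τ)).inter
        (isClosed_le continuous_const continuous_norm)
    exact closure_minimal (fun z hz => ⟨(hDs z hz).1, (hDs z hz).2.le⟩) hc
  have hη : ∀ η : ℝ, 0 < η → ‖P z₀‖ ≤ ε * Real.exp (Λ * ρ / ‖z₀‖) * Real.exp (η * ‖z₀‖ ^ (n + 1)) := by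
    intro η hη
    set E : ℂ → ℂ := fun z => P z * exp (-((η : ℂ) * z ^ (n + 1) + (Λ * ρ : ℝ) * z⁻¹)) with hE
    have hnE : ∀ z, ‖E z‖ = ‖P z‖ *
        Real.exp (-(η * (z ^ (n + 1)).re + Λ * ρ * (z⁻¹).re)) := by
      intro z
      rw [hE, norm_mul, norm_exp, neg_re, add_re, re_ofReal_mul, re_ofReal_mul]
    set R' : ℝ := max (max R 1) (max (‖z₀‖ + 1) (2 * (A + |Real.log ε|) / η)) with hR'
    have hR1 : R ≤ R' := (le_max_left _ _).trans (le_max_left _ _)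
    have hR2 : 1 ≤ R' := (le_max_right _ _).trans (le_max_left _ _)
    have hR3 : ‖z₀‖ + 1 ≤ R' := (le_max_left _ _).trans (le_max_right _ _)
    have hR4 : 2 * (A + |Real.log ε|) / η ≤ R' := (le_max_right _ _).trans (le_max_right _ _)
    rw [div_le_iff₀ hη] at hR4
    set U := D ∩ ball 0 R' with hU
    have hUcl : closure U ⊆ closure D ∩ closedBall 0 R' := fun z hz =>
      ⟨closure_mono inter_subset_left hz,
        closure_ball_subset_closedBall (closure_mono inter_subset_right hz)⟩
    have hEd : DifferentiableOn ℂ E (closure D) := by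
      intro z hz
      have hz0 : z ≠ 0 := norm_pos_iff.1 (hρ.trans_le (hDcl z hz).2)
      refine DifferentiableAt.differentiableWithinAt ?_
      exact (hP z).fun_mul (((((differentiableAt_id (𝕜 := ℂ)).fun_pow (n + 1)).const_mul (η : ℂ)).fun_add
        ((DifferentiableAt.fun_inv (differentiableAt_id (𝕜 := ℂ)) hz0).const_mul _)).fun_neg.cexp)
    have hEc : DiffContOnCl ℂ E U :=
      ⟨hEd.mono (inter_subset_left.trans subset_closure), (hEd.continuousOn).mono
        (hUcl.trans inter_subset_left)⟩
    have hfr : ∀ z ∈ frontier U, ‖E z‖ ≤ ε := by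
      intro z hz
      have hzc := hUcl hz.1
      obtain ⟨hs, hzρ⟩ := hDcl z hzc.1
      have hpw := half_norm_pow_le_re_pow hs hτ hτn
      have hinv : 1 / (2 * ‖z‖) ≤ (z⁻¹).re := by
        have h1 := re_le_norm_le_two_mul_re (abs_im_inv_le hs) hτ hτ1
        rw [norm_inv] at h1
        rw [one_div, mul_inv]
        linarith
      have hinv0 : 0 ≤ (z⁻¹).re := le_trans (by positivity) hinv
      have hpw0 : 0 ≤ (z ^ (n + 1)).re := le_trans (by positivity) hpw
      have hw1 : 0 ≤ η * (z ^ (n + 1)).re := by positivity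
      have hw2 : 0 ≤ Λ * ρ * (z⁻¹).re := by positivity
      rw [hnE, Real.exp_neg, ← div_eq_mul_inv, div_le_iff₀ (Real.exp_pos _)]
      rcases hDo : frontier_inter_subset D (ball 0 R') hz with h | h
      · rcases hDf z h.1 with ⟨h1, h2⟩ | h1
        · refine h2.trans (hM.trans ?_)
          rw [h1] at hinv
          have h3 : Λ * ρ * (1 / (2 * ρ)) ≤ Λ * ρ * (z⁻¹).re := by gcongr
          have h4 : Λ * ρ * (1 / (2 * ρ)) = Λ / 2 := by field_simp
          gcongr
          linarith
        · refine h1.trans (le_mul_of_one_le_right hε.le (Real.one_le_exp (by positivity)))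
      · have h1 : ‖z‖ = R' := by
          have := frontier_ball_subset_sphere h.2
          simpa using this
        have h2 := hgrowth z (by rw [h1]; exact hR1)
        refine h2.trans ?_
        have h3 : 1 ≤ ‖z‖ ^ n := one_le_pow₀ (by rw [h1]; exact hR2)
        have h4 : A * ‖z‖ ^ n - Real.log ε ≤ η * (z ^ (n + 1)).re := by
          have h5 : η * (‖z‖ ^ (n + 1) / 2) ≤ η * (z ^ (n + 1)).re := by gcongr
          have h6 : η * (‖z‖ ^ (n + 1) / 2) = (R' * η / 2) * ‖z‖ ^ n := by rw [pow_succ, ← h1]; ring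
          have h7 : (A + |Real.log ε|) * ‖z‖ ^ n ≤ (R' * η / 2) * ‖z‖ ^ n := by
            gcongr; linarith
          nlinarith [neg_abs_le (Real.log ε), abs_nonneg (Real.log ε)]
        calc Real.exp (A * ‖z‖ ^ n) ≤ Real.exp (Real.log ε +
              (η * (z ^ (n + 1)).re + Λ * ρ * (z⁻¹).re)) := Real.exp_le_exp.2 (by linarith)
          _ = _ := by rw [Real.exp_add, Real.exp_log hε]
    have hz₀U : z₀ ∈ U := ⟨hz₀, by rw [mem_ball_zero_iff]; linarith⟩
    have h5 := Complex.norm_le_of_forall_mem_frontier_norm_le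
      (isBounded_ball.subset inter_subset_right) hEc hfr (subset_closure hz₀U)
    rw [hnE, Real.exp_neg, ← div_eq_mul_inv, div_le_iff₀ (Real.exp_pos _)] at h5
    refine h5.trans ?_
    rw [mul_assoc ε, ← Real.exp_add]
    gcongr ε * Real.exp ?_
    have h6 : (z₀ ^ (n + 1)).re ≤ ‖z₀‖ ^ (n + 1) := (re_le_norm _).trans_eq (norm_pow _ _)
    have h7 : (z₀⁻¹).re ≤ ‖z₀‖⁻¹ := (re_le_norm _).trans_eq (norm_inv _)
    rw [div_eq_mul_inv, add_comm]
    gcongr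
  have hlim : Tendsto (fun η : ℝ => ε * Real.exp (Λ * ρ / ‖z₀‖) * Real.exp (η * ‖z₀‖ ^ (n + 1)))
      (𝓝[>] 0) (𝓝 (ε * Real.exp (Λ * ρ / ‖z₀‖) * Real.exp (0 * ‖z₀‖ ^ (n + 1)))) :=
    (Continuous.tendsto (by fun_prop) 0).mono_left nhdsWithin_le_nhds
  rw [zero_mul, Real.exp_zero, mul_one] at hlim
  exact ge_of_tendsto hlim (by filter_upwards [self_mem_nhdsWithin] with η h using hη η h)

theorem frontier_connectedComponentIn_subset_compl {V : Set ℂ} (hV : IsOpen V) (x : ℂ) :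
    frontier (connectedComponentIn V x) ⊆ Vᶜ := by
  intro z hz hzV
  rw [hV.connectedComponentIn.frontier_eq] at hz
  obtain ⟨w, hw1, hw2⟩ := mem_closure_iff.1 hz.1 _ (hV.connectedComponentIn (x := z))
    (mem_connectedComponentIn hzV)
  apply hz.2
  rw [connectedComponentIn_eq hw2, ← connectedComponentIn_eq hw1]
  exact mem_connectedComponentIn hzV

theorem eq_of_norm_eq_of_im_eq {z w : ℂ} (hn : ‖z‖ = ‖w‖) (hi : z.im = w.im) (hz : 0 < z.re)
    (hw : 0 < w.re) : z = w := by
  refine Complex.ext ?_ hi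
  have h1 := Complex.sq_norm z
  have h2 := Complex.sq_norm w
  rw [normSq_apply] at h1 h2
  rw [hn, h2, hi] at h1
  have h3 : w.re ^ 2 = z.re ^ 2 := by linarith
  exact ((pow_left_inj₀ hw.le hz.le two_ne_zero).1 h3).symm

/-- The map `z ↦ ‖z‖ + i sin (arg z)`. -/
noncomputable def sectorCoord (z : ℂ) : ℂ := ⟨‖z‖, z.im / ‖z‖⟩

theorem continuous_sectorCoord_comp {f : ℝ → ℂ} (hf : Continuous f) (h0 : ∀ t, f t ≠ 0) :
    Continuous fun t => sectorCoord (f t) := by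
  have : (fun t => sectorCoord (f t)) = fun t => ((‖f t‖ : ℝ) : ℂ) + ((f t).im / ‖f t‖ : ℝ) * I := by
    funext t
    exact Complex.ext (by simp [sectorCoord]) (by simp [sectorCoord])
  rw [this]
  have h1 : Continuous fun t => (f t).im / ‖f t‖ :=
    (continuous_im.comp hf).div hf.norm fun t => norm_ne_zero_iff.2 (h0 t)
  exact (continuous_ofReal.comp hf.norm).add ((continuous_ofReal.comp h1).mul continuous_const)

/-- A path in the right half-plane from the real axis to the line `im z = δ ‖z‖` or above,
staying outside the ball of radius `‖l t₀‖`, meets every curve `l` to infinity in the sector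
`0 < im z < δ ‖z‖`. -/
theorem exists_mem_of_path {l : ℝ → ℂ} {t₀ T δ : ℝ} (hlc : ContinuousOn l (Ico t₀ T))
    (hl : ∀ t ∈ Ico t₀ T, 0 < (l t).im ∧ (l t).im < δ * ‖l t‖ ∧ 0 < (l t).re)
    (hinf : Tendsto (fun t => ‖l t‖) (𝓝[<] T) atTop) (ht₀ : t₀ < T) {f : ℝ → ℂ} (hf : Continuous f)
    (hb : ∃ B, ∀ t, ‖f t‖ ≤ B) (hre : ∀ t, 0 < (f t).re) (hfn : ∀ t, ‖l t₀‖ < ‖f t‖)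
    (hf0 : (f 0).im = 0) (hf1 : δ * ‖f 1‖ < (f 1).im) :
    ∃ s, ∃ t ∈ Ico t₀ T, f s = l t := by
  obtain ⟨B, hB⟩ := hb
  obtain ⟨t₂, ht₂, ht₂'⟩ : ∃ t₂, B < ‖l t₂‖ ∧ t₂ ∈ Ioo t₀ T :=
    ((hinf.eventually_gt_atTop B).and (Ioo_mem_nhdsLT ht₀)).exists
  have h02 : t₀ ≤ t₂ := ht₂'.1.le
  set c : ℝ → ℝ := fun t => projIcc t₀ t₂ h02 (t₀ + t * (t₂ - t₀)) with hc
  have hcc : Continuous c := continuous_subtype_val.comp (continuous_projIcc.comp (by fun_prop))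
  have hcm : ∀ t, c t ∈ Ico t₀ T := fun t =>
    ⟨(projIcc t₀ t₂ h02 _).2.1, (projIcc t₀ t₂ h02 _).2.2.trans_lt ht₂'.2⟩
  have hc0 : c 0 = t₀ := by simp [hc]
  have hc1 : c 1 = t₂ := by simp [hc]
  have hlcc : Continuous fun t => l (c t) := hlc.comp_continuous hcc hcm
  have hl0 : ∀ t, l (c t) ≠ 0 := fun t h => by
    have := (hl _ (hcm t)).1
    rw [h] at this
    simp at this
  have hf0' : ∀ t, f t ≠ 0 := fun t h => by
    have := hre t
    rw [h] at this
    simp at this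
  obtain ⟨s, t, hst⟩ := exists_eq_of_crossing (continuous_sectorCoord_comp hf hf0')
    (continuous_sectorCoord_comp hlcc hl0)
    (fun t => by
      have h1 := hl _ (hcm t)
      have h2 : 0 < ‖l (c t)‖ := norm_pos_iff.2 (hl0 t)
      have h3 : 0 < ‖f 1‖ := norm_pos_iff.2 (hf0' 1)
      refine ⟨?_, ?_⟩
      · simp only [sectorCoord, hf0, zero_div]
        exact div_pos h1.1 h2
      · simp only [sectorCoord]
        calc _ < δ := by rw [div_lt_iff₀ h2]; exact h1.2.1
          _ < _ := by rw [lt_div_iff₀ h3]; exact hf1)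
    (fun s => by
      simp only [sectorCoord, hc0, hc1]
      exact ⟨hfn s, (hB s).trans_lt ht₂⟩)
  refine ⟨s, c t, hcm t, ?_⟩
  have h1 : ‖f s‖ = ‖l (c t)‖ := congrArg Complex.re hst
  have h2 : (f s).im / ‖f s‖ = (l (c t)).im / ‖l (c t)‖ := congrArg Complex.im hst
  rw [h1] at h2
  have h3 := (div_left_inj' (norm_ne_zero_iff.2 (hl0 t))).1 h2
  exact eq_of_norm_eq_of_im_eq h1 h3 (hre s) (hl _ (hcm t)).2.2

/-- A function which is real on the real axis, of finite order, and of modulus at least `4 ε` on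
the positive real axis, cannot be smaller than `ε` on a curve tending to infinity tangentially to
the positive real axis. -/
theorem false_of_norm_lt_on_curve {P : ℂ → ℂ} (hP : Differentiable ℂ P)
    (hreal : ∀ z, ‖P (conj z)‖ = ‖P z‖) {n : ℕ} {A R : ℝ}
    (hgrowth : ∀ z : ℂ, R ≤ ‖z‖ → ‖P z‖ ≤ Real.exp (A * ‖z‖ ^ n)) {ε : ℝ} (hε : 0 < ε)
    (hPx : ∀ x : ℝ, 4 * ε ≤ ‖P x‖) {l : ℝ → ℂ} {t₀ T δ : ℝ} (hδ : 0 < δ)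
    (hδn : 4 * (n + 1 : ℕ) * (2 * δ) ≤ 1) (ht₀ : t₀ < T) (hlc : ContinuousOn l (Ico t₀ T))
    (hl : ∀ t ∈ Ico t₀ T, 0 < (l t).im ∧ (l t).im < δ * ‖l t‖ ∧ 0 < (l t).re)
    (hinf : Tendsto (fun t => ‖l t‖) (𝓝[<] T) atTop)
    (hlP : ∀ t ∈ Ico t₀ T, ‖P (l t)‖ < ε) : False := by
  have hδ8 : 8 * δ ≤ 1 := by
    have : (1 : ℝ) ≤ (n + 1 : ℕ) := by push_cast; linarith [Nat.cast_nonneg (α := ℝ) n]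
    nlinarith
  set ρ := ‖l t₀‖ with hρdef
  have hρ : 0 < ρ := norm_pos_iff.2 fun h => by
    have := (hl t₀ ⟨le_rfl, ht₀⟩).1
    rw [h] at this
    simp at this
  obtain ⟨M, hM⟩ : ∃ M, ∀ z : ℂ, ‖z‖ = ρ → ‖P z‖ ≤ M := by
    obtain ⟨M, hM⟩ := (isCompact_sphere (0 : ℂ) ρ).exists_bound_of_continuousOn
      hP.continuous.continuousOn
    exact ⟨M, fun z hz => hM z (by simpa using hz)⟩
  obtain ⟨Λ, hΛ, hΛ0⟩ : ∃ Λ : ℝ, M ≤ ε * Real.exp (Λ / 2) ∧ 0 ≤ Λ := by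
    have h1 : Tendsto (fun Λ : ℝ => ε * Real.exp (Λ / 2)) atTop atTop :=
      (Real.tendsto_exp_atTop.comp (tendsto_id.atTop_div_const two_pos)).const_mul_atTop hε
    exact ((h1.eventually_ge_atTop M).and (eventually_ge_atTop 0)).exists
  set x₀ : ℝ := max (ρ + 1) (Λ * ρ) with hx₀
  have hx₀1 : ρ + 1 ≤ x₀ := le_max_left _ _
  have hx₀2 : Λ * ρ ≤ x₀ := le_max_right _ _
  have hx₀0 : 0 < x₀ := by linarith
  have hnx₀ : ‖(x₀ : ℂ)‖ = x₀ := by rw [norm_real, Real.norm_of_nonneg hx₀0.le]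
  set V : Set ℂ := {z | 0 < z.re ∧ |z.im| < 2 * δ * ‖z‖ ∧ ρ < ‖z‖ ∧ ε < ‖P z‖} with hVdef
  have hV : IsOpen V := (isOpen_lt continuous_const continuous_re).inter
    ((isOpen_lt continuous_im.abs (continuous_norm.const_mul (2 * δ))).inter
    ((isOpen_lt continuous_const continuous_norm).inter
    (isOpen_lt continuous_const hP.continuous.norm)))
  have hx₀V : (x₀ : ℂ) ∈ V := by
    refine ⟨by simpa using hx₀0, ?_, by rw [hnx₀]; linarith, by linarith [hPx x₀]⟩
    rw [ofReal_im, abs_zero]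
    rw [hnx₀]
    positivity
  set D := connectedComponentIn V (x₀ : ℂ) with hDdef
  have hDV : D ⊆ V := connectedComponentIn_subset _ _
  have hDo : IsOpen D := hV.connectedComponentIn
  have hx₀D : (x₀ : ℂ) ∈ D := mem_connectedComponentIn hx₀V
  have hDpc : IsPathConnected D :=
    (hDo.isConnected_iff_isPathConnected).1 ⟨⟨_, hx₀D⟩, isPreconnected_connectedComponentIn⟩
  have hthin : ∀ z ∈ D, |z.im| ≤ δ * ‖z‖ := by
    intro z hz
    by_contra! hcon
    obtain ⟨γ, hγ⟩ := hDpc.joinedIn _ hx₀D _ hz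
    have hγV : ∀ t, γ.extend t ∈ V := fun t => hDV (hγ _)
    have hγb : ∃ B, ∀ t, ‖γ.extend t‖ ≤ B := by
      obtain ⟨B, hB⟩ := isCompact_univ.exists_bound_of_continuousOn (γ.continuous.continuousOn)
      exact ⟨B, fun t => hB _ (mem_univ _)⟩
    rcases lt_abs.1 hcon with h | h
    · obtain ⟨s, t, ht, hst⟩ := exists_mem_of_path hlc hl hinf ht₀ γ.continuous_extend hγb
        (fun t => (hγV t).1) (fun t => (hγV t).2.2.1) (by simp) (by simpa using h)
      have h1 := (hγV s).2.2.2
      rw [hst] at h1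
      exact lt_asymm h1 (hlP t ht)
    · obtain ⟨s, t, ht, hst⟩ := exists_mem_of_path (f := fun t => conj (γ.extend t)) hlc hl hinf ht₀
        (continuous_conj.comp γ.continuous_extend) (by simpa using hγb)
        (fun t => by simpa using (hγV t).1) (fun t => by simpa using (hγV t).2.2.1)
        (by simp) (by simpa using h)
      have h1 := (hγV s).2.2.2
      rw [← hreal, hst] at h1
      exact lt_asymm h1 (hlP t ht)
  have hsec : ∀ z : ℂ, |z.im| ≤ δ * ‖z‖ → 0 ≤ z.re → |z.im| ≤ 2 * δ * z.re := by
    intro z h1 h2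
    have h3 := Complex.norm_le_abs_re_add_abs_im z
    rw [abs_of_nonneg h2] at h3
    nlinarith [abs_nonneg z.im]
  have hcl : ∀ z ∈ closure D, |z.im| ≤ δ * ‖z‖ ∧ ρ ≤ ‖z‖ ∧ 0 ≤ z.re := by
    have hc : IsClosed {z : ℂ | |z.im| ≤ δ * ‖z‖ ∧ ρ ≤ ‖z‖ ∧ 0 ≤ z.re} :=
      (isClosed_le continuous_im.abs (continuous_norm.const_mul δ)).inter
        ((isClosed_le continuous_const continuous_norm).inter
          (isClosed_le continuous_const continuous_re))
    exact closure_minimal (fun z hz => ⟨hthin z hz, (hDV hz).2.2.1.le, (hDV hz).1.le⟩) hc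
  have hfr : ∀ z ∈ frontier D, (‖z‖ = ρ ∧ ‖P z‖ ≤ M) ∨ ‖P z‖ ≤ ε := by
    intro z hz
    obtain ⟨h1, h2, h3⟩ := hcl z hz.1
    rcases h2.eq_or_lt with h | h
    · exact Or.inl ⟨h.symm, hM z h.symm⟩
    · right
      by_contra! hcon
      refine frontier_connectedComponentIn_subset_compl hV _ hz ⟨?_, ?_, h, hcon⟩
      · have h4 := hsec z h1 h3
        refine h3.lt_of_ne fun h0 => ?_
        rw [← h0, mul_zero] at h4
        have h5 : z = 0 := Complex.ext h0.symm (abs_nonpos_iff.1 h4)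
        rw [h5, norm_zero] at h
        exact hρ.not_gt h
      · nlinarith
  have key := norm_le_mul_exp_of_frontier hP hgrowth (by positivity : 0 < 2 * δ) (by linarith) hδn hρ
    hε hΛ0 hΛ (D := D) (fun z hz => ⟨hsec z (hthin z hz) (hDV hz).1.le, (hDV hz).2.2.1⟩) hfr hx₀D
  have h1 : Real.exp (Λ * ρ / ‖(x₀ : ℂ)‖) ≤ Real.exp 1 := by
    rw [hnx₀, Real.exp_le_exp, div_le_one hx₀0]
    exact hx₀2
  nlinarith [hPx x₀, Real.exp_one_lt_d9]

theorem four_mul_sq_le_norm_sub_mul (q : ℝ) (a : ℂ) :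
    a.im ^ 2 ≤ ‖((q : ℂ) - a) * ((q : ℂ) - conj a)‖ := by
  have h1 : |a.im| ≤ ‖(q : ℂ) - a‖ := by simpa using abs_im_le_norm ((q : ℂ) - a)
  have h2 : |a.im| ≤ ‖(q : ℂ) - conj a‖ := by simpa using abs_im_le_norm ((q : ℂ) - conj a)
  rw [norm_mul, ← sq_abs, pow_two]
  exact mul_le_mul h1 h2 (abs_nonneg _) (norm_nonneg _)

theorem sq_mul_exp_add_le {r : ℝ} (hr : 1 ≤ r) (Q : ℕ) :
    r ^ 2 * Real.exp (r ^ Q) + 2 * r ≤ Real.exp (4 * r ^ (Q + 1)) := by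
  have h1 : r ≤ Real.exp r := by linarith [Real.add_one_le_exp r]
  have h2 : r ^ 2 ≤ Real.exp r ^ 2 := by gcongr
  have h3 : 2 * r ≤ Real.exp r ^ 2 := by nlinarith [Real.add_one_le_exp r]
  have h4 : 1 ≤ Real.exp (r ^ Q) := Real.one_le_exp (by positivity)
  have h5 : (2 : ℝ) ≤ Real.exp 1 := by linarith [Real.add_one_le_exp 1]
  have h6 : r ^ Q ≤ r ^ (Q + 1) := pow_le_pow_right₀ hr (by omega)
  have h7 : r ≤ r ^ (Q + 1) := le_self_pow₀ hr (by omega)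
  calc r ^ 2 * Real.exp (r ^ Q) + 2 * r
      ≤ Real.exp r ^ 2 * Real.exp (r ^ Q) + Real.exp r ^ 2 * Real.exp (r ^ Q) :=
        add_le_add (by gcongr) (h3.trans (le_mul_of_one_le_right (by positivity) h4))
    _ = Real.exp r ^ 2 * Real.exp (r ^ Q) * 2 := by ring
    _ ≤ Real.exp r ^ 2 * Real.exp (r ^ Q) * Real.exp 1 := by gcongr
    _ = Real.exp (2 * r + r ^ Q + 1) := by
        rw [Real.exp_add, Real.exp_add, two_mul, Real.exp_add]; ring
    _ ≤ _ := Real.exp_le_exp.2 (by linarith)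

theorem false_of_tendsto_right {g : ℂ → ℂ} (hg : Differentiable ℂ g)
    (hreal : ∀ z, g (conj z) = conj (g z)) {Q : ℕ} {R : ℝ}
    (hgrowth : ∀ z : ℂ, R ≤ ‖z‖ → ‖g z‖ ≤ Real.exp (‖z‖ ^ Q)) {l : ℝ → ℂ} {T : ℝ} (hT : 0 < T)
    (hlc : ContinuousOn l (Ico 0 T)) (him : ∀ t ∈ Ico 0 T, 0 < (l t).im)
    (hinf : Tendsto (fun t => ‖l t‖) (𝓝[<] T) atTop) {a : ℂ} (ha : 0 < a.im)
    (hF : Tendsto (fun t => l t - (g (l t))⁻¹) (𝓝[<] T) (𝓝 a))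
    (hthin : ∀ δ : ℝ, 0 < δ → ∀ᶠ t in 𝓝[<] T, (l t).im < δ * ‖l t‖)
    (hre : ∀ᶠ t in 𝓝[<] T, 0 < (l t).re) : False := by
  set q : ℂ → ℂ := fun z => z ^ 2 * g z - z with hq
  set P : ℂ → ℂ := fun z => (q z - a) * (q z - conj a) with hP
  have hqd : Differentiable ℂ q := by fun_prop
  have hPd : Differentiable ℂ P := by fun_prop
  have hqreal : ∀ z, q (conj z) = conj (q z) := fun z => by simp [hq, hreal]
  have hPreal : ∀ z, ‖P (conj z)‖ = ‖P z‖ := norm_conj_eq fun z => by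
    simp only [hP, hqreal, map_mul, map_sub, conj_conj]
    ring
  have hqx : ∀ x : ℝ, q x = ((q x).re : ℂ) := fun x => by
    have h := hqreal x
    rw [conj_ofReal] at h
    exact (conj_eq_iff_re.1 h.symm).symm
  have hPx : ∀ x : ℝ, 4 * (a.im ^ 2 / 4) ≤ ‖P x‖ := fun x => by
    have h := four_mul_sq_le_norm_sub_mul (q x).re a
    rw [← hqx] at h
    linarith
  have hPg : ∀ z : ℂ, max R (max 1 ‖a‖) ≤ ‖z‖ → ‖P z‖ ≤ Real.exp (8 * ‖z‖ ^ (Q + 1)) := by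
    intro z hz
    have h1 := (le_max_left _ _).trans hz
    have h2 : 1 ≤ ‖z‖ := ((le_max_left _ _).trans (le_max_right _ _)).trans hz
    have h3 : ‖a‖ ≤ ‖z‖ := ((le_max_right _ _).trans (le_max_right _ _)).trans hz
    have h4 : ‖q z‖ ≤ ‖z‖ ^ 2 * Real.exp (‖z‖ ^ Q) + ‖z‖ := by
      refine (norm_sub_le _ _).trans ?_
      rw [norm_mul, norm_pow]
      gcongr
      exact hgrowth z h1
    have h5 := sq_mul_exp_add_le h2 Q
    have h6 : ‖q z - a‖ ≤ Real.exp (4 * ‖z‖ ^ (Q + 1)) := (norm_sub_le _ _).trans (by linarith)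
    have h7 : ‖q z - conj a‖ ≤ Real.exp (4 * ‖z‖ ^ (Q + 1)) :=
      (norm_sub_le _ _).trans (by rw [norm_conj]; linarith)
    calc ‖P z‖ = ‖q z - a‖ * ‖q z - conj a‖ := norm_mul _ _
      _ ≤ Real.exp (4 * ‖z‖ ^ (Q + 1)) * Real.exp (4 * ‖z‖ ^ (Q + 1)) := by gcongr
      _ = _ := by rw [← Real.exp_add]; ring_nf
  have hq_lim : Tendsto (fun t => q (l t)) (𝓝[<] T) (𝓝 a) := by
    set F : ℝ → ℂ := fun t => l t - (g (l t))⁻¹ with hFdef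
    have hinv : Tendsto (fun t => (l t)⁻¹) (𝓝[<] T) (𝓝 0) :=
      tendsto_inv₀_cobounded.comp (tendsto_norm_atTop_iff_cobounded.1 hinf)
    have h1 : Tendsto (fun t => F t / (1 - F t * (l t)⁻¹)) (𝓝[<] T) (𝓝 (a / (1 - a * 0))) :=
      hF.div (tendsto_const_nhds.sub (hF.mul hinv)) (by simp)
    rw [mul_zero, sub_zero, div_one] at h1
    refine h1.congr' ?_
    filter_upwards [hF.norm.eventually_lt_const (lt_add_one ‖a‖),
      hinf.eventually_gt_atTop (‖a‖ + 1)] with t h2 h3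
    have h4 : l t ≠ 0 := norm_pos_iff.1 (by linarith [norm_nonneg a])
    have h5 : l t - F t ≠ 0 := fun h => by
      rw [sub_eq_zero.1 h] at h3
      linarith
    have h6 : (g (l t))⁻¹ = l t - F t := by simp [hFdef]
    have h7 : g (l t) = (l t - F t)⁻¹ := by rw [← h6, inv_inv]
    have h8 : 1 - F t * (l t)⁻¹ ≠ 0 := fun h => h5 (by
      field_simp at h
      rwa [mul_zero] at h)
    simp only [hq]
    rw [h7]
    have h9 : 1 - F t * (l t)⁻¹ = (l t - F t) / l t := by field_simp
    rw [h9]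
    field_simp
    ring
  have hP_lim : Tendsto (fun t => ‖P (l t)‖) (𝓝[<] T) (𝓝 0) := by
    have h := ((hq_lim.sub_const a).mul (hq_lim.sub_const (conj a))).norm
    simpa [hP] using h
  have hε : 0 < a.im ^ 2 / 4 := by positivity
  set δ : ℝ := 1 / (8 * (Q + 2 : ℕ)) with hδ
  have hδ0 : 0 < δ := by positivity
  obtain ⟨t₁, ht₁, ht⟩ : ∃ t₁ < T, ∀ t ∈ Ioo t₁ T, (‖P (l t)‖ < a.im ^ 2 / 4 ∧
      (l t).im < δ * ‖l t‖ ∧ 0 < (l t).re) ∧ 0 < t := by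
    have h := ((hP_lim.eventually_lt_const hε).and ((hthin δ hδ0).and hre)).and
      (Ioo_mem_nhdsLT hT)
    obtain ⟨t₁, ht₁, hs⟩ := (mem_nhdsLT_iff_exists_Ioo_subset).1 h
    exact ⟨t₁, ht₁, fun t ht => ⟨(hs ht).1, (hs ht).2.1⟩⟩
  obtain ⟨t₀, ht₀⟩ := exists_between ht₁
  have hsub : ∀ t ∈ Ico t₀ T, t ∈ Ioo t₁ T := fun t h => ⟨ht₀.1.trans_le h.1, h.2⟩
  have hsub' : ∀ t ∈ Ico t₀ T, t ∈ Ico 0 T := fun t h => ⟨(ht t (hsub t h)).2.le, h.2⟩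
  refine false_of_norm_lt_on_curve hPd hPreal hPg hε hPx hδ0 ?_ ht₀.2 (hlc.mono hsub')
    (fun t h => ⟨him t (hsub' t h), (ht t (hsub t h)).1.2⟩) hinf
    (fun t h => (ht t (hsub t h)).1.1)
  rw [hδ]
  have : (0 : ℝ) < (Q + 2 : ℕ) := by positivity
  push_cast
  field_simp
  linarith

/-- If `g' + g²` has finitely many zeros in the upper half-plane, then `z - 1 / g z` has no
asymptotic value in the upper half-plane along curves in the upper half-plane. -/
theorem false_of_tendsto_of_tendsto_norm {g : ℂ → ℂ} (hg : Differentiable ℂ g)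
    (hreal : ∀ z, g (conj z) = conj (g z)) (htrans : ¬ ∃ p : Polynomial ℂ, ∀ z, g z = p.eval z)
    (hfin : {z : ℂ | deriv g z + g z ^ 2 = 0 ∧ 0 < z.im}.Finite) {l : ℝ → ℂ} {T : ℝ} (hT : 0 < T)
    (hlc : ContinuousOn l (Ico 0 T)) (him : ∀ t ∈ Ico 0 T, 0 < (l t).im)
    (hinf : Tendsto (fun t => ‖l t‖) (𝓝[<] T) atTop) {a : ℂ} (ha : 0 < a.im)
    (hF : Tendsto (fun t => l t - (g (l t))⁻¹) (𝓝[<] T) (𝓝 a)) : False := by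
  obtain ⟨Q, R, -, hgrowth⟩ := exists_norm_le_exp_pow hg hreal hfin
  have hthin : ∀ δ : ℝ, 0 < δ → ∀ᶠ t in 𝓝[<] T, (l t).im < δ * ‖l t‖ := by
    intro δ hδ
    obtain ⟨R₁, hR₁, hlow⟩ := exists_pow_le_norm hg hreal htrans hfin 1 hδ
    filter_upwards [hF.norm.eventually_lt_const (lt_add_one ‖a‖),
      hinf.eventually_gt_atTop (‖a‖ + 3 + R₁)] with t h1 h2
    by_contra! h3
    have h4 := hlow (l t) (by linarith [norm_nonneg a]) h3
    rw [pow_one] at h4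
    have h5 : ‖(g (l t))⁻¹‖ ≤ 1 := by
      rw [norm_inv]
      exact inv_le_one_of_one_le₀ (by linarith [norm_nonneg a])
    have h6 := norm_sub_norm_le (l t) (g (l t))⁻¹
    linarith
  have hne : ∃ t₁ < T, ∀ t ∈ Ioo t₁ T, (l t).re ≠ 0 ∧ 0 < t := by
    have h := (hthin (1 / 2) (by norm_num)).and (Ioo_mem_nhdsLT hT)
    obtain ⟨t₁, ht₁, hs⟩ := (mem_nhdsLT_iff_exists_Ioo_subset).1 h
    refine ⟨t₁, ht₁, fun t ht => ⟨fun h0 => ?_, (hs ht).2.1⟩⟩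
    have h1 : (l t).im < 1 / 2 * ‖l t‖ := (hs ht).1
    have h2 := Complex.norm_le_abs_re_add_abs_im (l t)
    have h3 := him t ⟨(hs ht).2.1.le, ht.2⟩
    rw [h0, abs_zero, abs_of_pos h3] at h2
    linarith
  obtain ⟨t₁, ht₁, hne⟩ := hne
  have hIoo : ∀ᶠ t in 𝓝[<] T, t ∈ Ioo t₁ T := Ioo_mem_nhdsLT ht₁
  have hord : OrdConnected ((fun t => (l t).re) '' Ioo t₁ T) :=
    (isPreconnected_Ioo.image _ (continuous_re.comp_continuousOn (hlc.mono fun t ht =>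
      ⟨(hne t ht).2.le, ht.2⟩))).ordConnected
  have h0 : (0 : ℝ) ∉ (fun t => (l t).re) '' Ioo t₁ T := by
    rintro ⟨t, ht, h⟩
    exact (hne t ht).1 h
  by_cases hpos : ∃ s ∈ Ioo t₁ T, 0 < (l s).re
  · obtain ⟨s, hs, hs0⟩ := hpos
    refine false_of_tendsto_right hg hreal hgrowth hT hlc him hinf ha hF hthin ?_
    filter_upwards [hIoo] with t ht
    by_contra! h
    exact h0 (hord.out ⟨t, ht, rfl⟩ ⟨s, hs, rfl⟩ ⟨h, hs0.le⟩)
  · push Not at hpos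
    have hg' : Differentiable ℂ fun z => -g (-z) := (hg.comp differentiable_neg).neg
    refine false_of_tendsto_right (g := fun z => -g (-z)) (l := fun t => -conj (l t))
      (a := -conj a) (R := R) (Q := Q) hg'
      (fun z => by rw [← map_neg, hreal, map_neg]) (fun z hz => by simpa using hgrowth (-z) (by simpa using hz)) hT
      (continuous_conj.comp_continuousOn hlc).neg (fun t ht => by simpa using him t ht)
      (by simpa using hinf) (by simpa using ha) ?_ (by simpa using hthin) ?_
    · have h := ((continuous_conj.tendsto a).comp hF).neg
      refine h.congr fun t => ?_
      simp [hreal]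
      ring
    · filter_upwards [hIoo] with t ht
      simpa using (hpos t ht).lt_of_ne (hne t ht).1

/-- A path lifts through a local homeomorphism as soon as partial lifts have limit points. -/
theorem exists_path_lift {E X : Type*} [TopologicalSpace E] [T2Space E] [TopologicalSpace X]
    [T2Space X] {p : E → X} (hp : IsLocalHomeomorph p) {γ : ℝ → X} (hγ : Continuous γ) {e₀ : E}
    (he₀ : p e₀ = γ 0)
    (hlim : ∀ T ∈ Ioc (0 : ℝ) 1, ∀ l : ℝ → E, ContinuousOn l (Ico 0 T) →
      (∀ t ∈ Ico 0 T, p (l t) = γ t) → ∃ (e : E) (u : ℕ → ℝ), (∀ n, u n ∈ Ico 0 T) ∧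
        Tendsto u atTop (𝓝 T) ∧ Tendsto (fun n => l (u n)) atTop (𝓝 e)) :
    ∃ l : ℝ → E, ContinuousOn l (Icc 0 1) ∧ l 0 = e₀ ∧ ∀ t ∈ Icc (0 : ℝ) 1, p (l t) = γ t := by
  set S : Set ℝ := {T | 0 ≤ T ∧ ∃ l : ℝ → E, ContinuousOn l (Icc 0 T) ∧ l 0 = e₀ ∧
    ∀ t ∈ Icc 0 T, p (l t) = γ t} with hS
  have huniq : ∀ T₁ T₂ : ℝ, T₁ ≤ T₂ → ∀ l₁ l₂ : ℝ → E, ContinuousOn l₁ (Icc 0 T₁) →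
      ContinuousOn l₂ (Icc 0 T₂) → l₁ 0 = e₀ → l₂ 0 = e₀ → (∀ t ∈ Icc 0 T₁, p (l₁ t) = γ t) →
      (∀ t ∈ Icc 0 T₂, p (l₂ t) = γ t) → EqOn l₁ l₂ (Icc 0 T₁) := by
    intro T₁ T₂ h12 l₁ l₂ hc₁ hc₂ h₁ h₂ hl₁ hl₂ t ht
    have hsub : Icc 0 T₁ ⊆ Icc 0 T₂ := Icc_subset_Icc_right h12
    exact (T2Space.isSeparatedMap p).eqOn_of_comp_eqOn hp.isLocallyInjective isPreconnected_Icc hc₁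
      (hc₂.mono hsub) (fun s hs => by
        simp only [Function.comp_apply]
        rw [hl₁ s hs, hl₂ s (hsub hs)]) (a := 0) ⟨le_rfl, ht.1.trans ht.2⟩ (h₁.trans h₂.symm) ht
  have hextend : ∀ T : ℝ, 0 ≤ T → ∀ s ∈ Icc 0 T, ∀ l : ℝ → E, ContinuousOn l (Icc 0 s) → l 0 = e₀ →
      (∀ t ∈ Icc 0 s, p (l t) = γ t) → ∀ q : OpenPartialHomeomorph E X, p = q → l s ∈ q.source →
      (∀ t ∈ Icc s T, γ t ∈ q.target) → T ∈ S := by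
    intro T hT s hs l hc hl0 hl q hq hls hγq
    refine ⟨hT, fun t => if t ≤ s then l t else q.symm (γ t), ?_, by simp [hs.1, hl0], ?_⟩
    · refine ContinuousOn.if ?_ ?_ ?_
      · rintro t ⟨-, ht⟩
        have : t = s := frontier_Iic_subset s ht
        rw [this, ← hl s ⟨hs.1, le_rfl⟩, hq, q.left_inv hls]
      · refine hc.mono ?_
        rintro t ⟨ht1, ht2⟩
        exact ⟨ht1.1, by simpa using closure_le_eq continuous_id continuous_const |>.subset ht2⟩
      · refine q.continuousOn_symm.comp hγ.continuousOn ?_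
        rintro t ⟨ht1, ht2⟩
        refine hγq t ⟨?_, ht1.2⟩
        have h3 : {t | ¬ t ≤ s} = Ioi s := by ext; simp
        rw [h3] at ht2
        simpa using ht2
    · intro t ht
      by_cases h : t ≤ s
      · simp only [h, if_true]
        exact hl t ⟨ht.1, h⟩
      · simp only [h, if_false]
        rw [hq, q.right_inv (hγq t ⟨(not_le.1 h).le, ht.2⟩)]
  have hdown : ∀ T ∈ S, ∀ s, 0 ≤ s → s ≤ T → s ∈ S := by
    rintro T ⟨-, l, hc, h0, hl⟩ s hs hsT
    exact ⟨hs, l, hc.mono (Icc_subset_Icc_right hsT), h0, fun t ht => hl t ⟨ht.1, ht.2.trans hsT⟩⟩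
  have hstep : ∀ T : ℝ, 0 ≤ T → T ≤ 1 → (∀ s, 0 ≤ s → s < T → s ∈ S) →
      ∃ η > 0, T + η ∈ S := by
    intro T hT hT1 hbelow
    obtain ⟨e, hs₀⟩ : ∃ e : E, p e = γ T ∧ ∀ U ∈ 𝓝 e, ∀ δ > 0, ∃ s ∈ Icc 0 T,
        T - δ < s ∧ ∃ l : ℝ → E, ContinuousOn l (Icc 0 s) ∧ l 0 = e₀ ∧
          (∀ t ∈ Icc 0 s, p (l t) = γ t) ∧ l s ∈ U := by
      rcases hT.eq_or_lt with rfl | hT0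
      · refine ⟨e₀, he₀, fun U hU δ hδ => ⟨0, ⟨le_rfl, le_rfl⟩, by linarith, fun _ => e₀,
          continuousOn_const, rfl, ?_, mem_of_mem_nhds hU⟩⟩
        intro t ht
        rw [Icc_self] at ht
        rw [ht, he₀]
      · have : Nonempty (ℝ → E) := ⟨fun _ => e₀⟩
        choose! L hL using fun s (hs : 0 ≤ s ∧ s < T) => (hbelow s hs.1 hs.2).2
        have hLeq : ∀ s, 0 ≤ s → s < T → EqOn (fun t => L t t) (L s) (Icc 0 s) := by
          intro s hs hsT t ht
          have h1 := hL s ⟨hs, hsT⟩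
          have h2 := hL t ⟨ht.1, ht.2.trans_lt hsT⟩
          exact huniq t s ht.2 _ _ h2.1 h1.1 h2.2.1 h1.2.1 h2.2.2 h1.2.2 ⟨ht.1, le_rfl⟩
        have hLlift : ∀ t ∈ Ico 0 T, p (L t t) = γ t := fun t ht =>
          (hL t ht).2.2 t ⟨ht.1, le_rfl⟩
        have hLc : ContinuousOn (fun t => L t t) (Ico 0 T) := by
          intro t ht
          obtain ⟨s, hs⟩ := exists_between ht.2
          have h1 : ContinuousWithinAt (fun t => L t t) (Icc 0 s) t :=
            ((hL s ⟨ht.1.trans hs.1.le, hs.2⟩).1.congr (hLeq s (ht.1.trans hs.1.le) hs.2)) t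
              ⟨ht.1, hs.1.le⟩
          refine h1.mono_of_mem_nhdsWithin ?_
          filter_upwards [self_mem_nhdsWithin, mem_nhdsWithin_of_mem_nhds (Iio_mem_nhds hs.1)]
            with r hr1 hr2 using ⟨hr1.1, le_of_lt hr2⟩
        obtain ⟨e, u, hu, huT, hue⟩ := hlim T ⟨hT0, hT1⟩ _ hLc hLlift
        refine ⟨e, ?_, ?_⟩
        · refine tendsto_nhds_unique ((hp.continuous.tendsto e).comp hue) ?_
          refine ((hγ.tendsto T).comp huT).congr fun n => ?_
          exact (hLlift _ (hu n)).symm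
        · intro U hU δ hδ
          obtain ⟨n, hn1, hn2⟩ := ((hue.eventually_mem hU).and
            (huT.eventually_const_lt (sub_lt_self T hδ))).exists
          exact ⟨u n, ⟨(hu n).1, (hu n).2.le⟩, hn2, L (u n), (hL _ (hu n)).1, (hL _ (hu n)).2.1,
            (hL _ (hu n)).2.2, hn1⟩
    obtain ⟨q, heq, hpq⟩ := hp e
    have hnhds : ∀ᶠ t in 𝓝 T, γ t ∈ q.target := by
      refine hγ.continuousAt.eventually_mem (q.open_target.mem_nhds ?_)
      rw [← hs₀.1, hpq]
      exact q.map_source heq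
    obtain ⟨δ, hδ, hball⟩ := Metric.eventually_nhds_iff.1 hnhds
    obtain ⟨s, hs, hsδ, l, hlc, hl0, hl, hls⟩ := hs₀.2 _ (q.open_source.mem_nhds heq) δ hδ
    refine ⟨δ / 2, by positivity, hextend (T + δ / 2) (by linarith) s ⟨hs.1, by linarith [hs.2]⟩ l
      hlc hl0 hl q hpq hls fun t ht => hball ?_⟩
    rw [Real.dist_eq, abs_lt]
    constructor <;> linarith [ht.1, ht.2]
  suffices h : (1 : ℝ) ∈ S by
    obtain ⟨-, l, h1, h2, h3⟩ := h
    exact ⟨l, h1, h2, h3⟩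
  by_contra h1
  have hS1 : ∀ T ∈ S, T < 1 := fun T hT => by
    by_contra! h
    exact h1 (hdown T hT 1 zero_le_one h)
  have hbdd : BddAbove S := ⟨1, fun T hT => (hS1 T hT).le⟩
  obtain ⟨η₀, hη₀, h0⟩ := hstep 0 le_rfl zero_le_one fun s hs hs' => absurd hs hs'.not_ge
  have hne : S.Nonempty := ⟨_, h0⟩
  obtain ⟨η, hη, hηS⟩ := hstep (sSup S) (by linarith [le_csSup hbdd h0])
    (csSup_le hne fun T hT => (hS1 T hT).le) fun s hs hs' => by
      obtain ⟨T, hT, hsT⟩ := exists_lt_of_lt_csSup hne hs'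
      exact hdown T hT s hs hsT.le
  linarith [le_csSup hbdd hηS]

theorem exists_lift_of_starConvex {E : Type*} [TopologicalSpace E] [T2Space E] {p : E → ℂ}
    (hp : IsLocalHomeomorph p) {S : Set ℂ} {w₀ : ℂ} (hw₀ : w₀ ∈ S)
    (hS : ∀ w ∈ S, ∀ t ∈ Icc (0 : ℝ) 1, w₀ + t * (w - w₀) ∈ S) {f : ℂ → ℂ}
    (hf : ContinuousOn f S) {e₀ : E} (he₀ : p e₀ = f w₀)
    (hlift : ∀ w ∈ S, ∃ l : ℝ → E, ContinuousOn l (Icc 0 1) ∧ l 0 = e₀ ∧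
      ∀ t ∈ Icc (0 : ℝ) 1, p (l t) = f (w₀ + t * (w - w₀))) :
    ∃ Φ : S → E, Continuous Φ ∧ Φ ⟨w₀, hw₀⟩ = e₀ ∧ ∀ w, p (Φ w) = f w := by
  choose L hLc hL0 hL using fun w : S => hlift w w.2
  have hLc' : ∀ w, Continuous fun t : unitInterval => L w t := fun w =>
    continuousOn_iff_continuous_domRestrict.1 (hLc w)
  set f' : C(unitInterval × S, ℂ) :=
    ⟨fun x => f (w₀ + (x.1 : ℝ) * ((x.2 : ℂ) - w₀)), hf.comp_continuous (by fun_prop)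
      fun x => hS _ x.2.2 _ x.1.2⟩ with hf'
  have hG : Continuous fun x : unitInterval × S => L x.2 x.1 := by
    refine hp.continuous_lift (T2Space.isSeparatedMap p) f' ?_ ?_ ?_
    · funext x
      exact hL x.2 x.1 x.1.2
    · refine (continuous_const (y := e₀)).congr fun w => ?_
      exact (hL0 w).symm
    · exact hLc'
  refine ⟨fun w => L w 1, hG.comp (Continuous.prodMk_right (1 : unitInterval)), ?_, fun w => ?_⟩
  · have h := (T2Space.isSeparatedMap p).eq_of_comp_eq hp.isLocallyInjective
      (hLc' ⟨w₀, hw₀⟩) (continuous_const (y := e₀)) (by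
        funext t
        simp only [Function.comp_apply, he₀]
        rw [hL _ _ t.2]
        simp) 0 (hL0 _)
    exact congrFun h 1
  · rw [hL w 1 ⟨zero_le_one, le_rfl⟩]
    simp

/-- Holomorphic lifting of `f` through the locally univalent function `F`, assuming that lifts
of paths do not run into the boundary. -/
theorem exists_holomorphic_lift {E : Set ℂ} (hE : IsOpen E) {F : ℂ → ℂ}
    (hF : DifferentiableOn ℂ F E) (hF' : ∀ z ∈ E, deriv F z ≠ 0) {S : Set ℂ} (hSo : IsOpen S)
    (hS : Convex ℝ S) {w₀ : ℂ} (hw₀ : w₀ ∈ S) {f : ℂ → ℂ} (hf : DifferentiableOn ℂ f S) {z₀ : ℂ}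
    (hz₀ : z₀ ∈ E) (hFz₀ : F z₀ = f w₀)
    (hlim : ∀ γ : ℝ → ℂ, Continuous γ → (∀ t, γ t ∈ f '' S) → ∀ T > 0, ∀ l : ℝ → ℂ,
      ContinuousOn l (Ico 0 T) → (∀ t ∈ Ico 0 T, l t ∈ E ∧ F (l t) = γ t) →
      ∃ z ∈ E, ∃ u : ℕ → ℝ, (∀ n, u n ∈ Ico 0 T) ∧ Tendsto u atTop (𝓝 T) ∧
        Tendsto (fun n => l (u n)) atTop (𝓝 z)) :
    ∃ Φ : ℂ → ℂ, DifferentiableOn ℂ Φ S ∧ Φ w₀ = z₀ ∧ ∀ w ∈ S, Φ w ∈ E ∧ F (Φ w) = f w := by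
  classical
  have hstrict : ∀ z ∈ E, HasStrictDerivAt F (deriv F z) z := fun z hz =>
    (hF.analyticAt (hE.mem_nhds hz)).hasStrictDerivAt
  have hlocF : IsLocalHomeomorphOn F E := fun z hz =>
    ⟨((hstrict z hz).hasStrictFDerivAt_equiv (hF' z hz)).toOpenPartialHomeomorph F,
      HasStrictFDerivAt.mem_toOpenPartialHomeomorph_source _, rfl⟩
  have hp : IsLocalHomeomorph fun z : E => F z :=
    isLocalHomeomorph_iff_isLocalHomeomorphOn_univ.2
      (hlocF.comp (isLocalHomeomorph_iff_isLocalHomeomorphOn_univ.1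
        hE.isOpenEmbedding_subtypeVal.isLocalHomeomorph) fun z _ => z.2)
  have hseg : ∀ w ∈ S, ∀ t ∈ Icc (0 : ℝ) 1, w₀ + t * (w - w₀) ∈ S := fun w hw t ht => by
    have := hS.add_smul_sub_mem hw₀ hw ht
    rwa [real_smul] at this
  obtain ⟨Φ, hΦc, hΦ0, hΦ⟩ := exists_lift_of_starConvex hp hw₀ hseg hf.continuousOn
    (e₀ := ⟨z₀, hz₀⟩) hFz₀ (by
    intro w hw
    set c : ℝ → ℝ := fun t => max 0 (min t 1) with hc
    have hcm : ∀ t, c t ∈ Icc (0 : ℝ) 1 := fun t =>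
      ⟨le_max_left _ _, max_le zero_le_one (min_le_right _ _)⟩
    have hcc : Continuous c := by fun_prop
    have hc' : ∀ t ∈ Icc (0 : ℝ) 1, c t = t := fun t ht => by simp [hc, ht.1, ht.2]
    have hγ : Continuous fun t => f (w₀ + c t * (w - w₀)) :=
      hf.continuousOn.comp_continuous (by fun_prop) fun t => hseg w hw _ (hcm t)
    obtain ⟨l, hl1, hl2, hl3⟩ := exists_path_lift hp hγ (e₀ := ⟨z₀, hz₀⟩)
      (by simp [hc, hFz₀]) (by
        intro T hT l hlc hl
        obtain ⟨z, hz, u, hu, huT, hlu⟩ := hlim _ hγ (fun t => ⟨_, hseg w hw _ (hcm t), rfl⟩) T hT.1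
          (fun t => l t) (continuous_subtype_val.comp_continuousOn hlc) fun t ht => ⟨(l t).2, hl t ht⟩
        exact ⟨⟨z, hz⟩, u, hu, huT, tendsto_subtype_rng.2 hlu⟩)
    exact ⟨l, hl1, hl2, fun t ht => by rw [hl3 t ht, hc' t ht]⟩)
  set Ψ : ℂ → ℂ := fun w => if h : w ∈ S then Φ ⟨w, h⟩ else 0 with hΨ
  have hΨS : ∀ w (h : w ∈ S), Ψ w = Φ ⟨w, h⟩ := fun w h => by simp [hΨ, h]
  have hΨc : ContinuousOn Ψ S := by
    rw [continuousOn_iff_continuous_domRestrict]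
    refine (continuous_subtype_val.comp hΦc).congr fun w => ?_
    exact (hΨS w w.2).symm
  refine ⟨Ψ, fun w hw => ?_, by rw [hΨS w₀ hw₀, hΦ0], fun w hw => by
    rw [hΨS w hw]; exact ⟨(Φ ⟨w, hw⟩).2, hΦ ⟨w, hw⟩⟩⟩
  have hΨE : Ψ w ∈ E := by rw [hΨS w hw]; exact (Φ ⟨w, hw⟩).2
  have hFΨ : ∀ w ∈ S, F (Ψ w) = f w := fun w hw => by rw [hΨS w hw]; exact hΦ ⟨w, hw⟩
  have hst := hstrict _ hΨE
  have hinv := hst.to_localInverse (hF' _ hΨE)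
  have hleft := (hst.hasStrictFDerivAt_equiv (hF' _ hΨE)).eventually_left_inverse
  have hSn : S ∈ 𝓝 w := hSo.mem_nhds hw
  have h1 : ∀ᶠ w' in 𝓝 w, Ψ w' = hst.localInverse F _ _ (hF' _ hΨE) (f w') := by
    filter_upwards [(hΨc.continuousAt hSn).eventually hleft, hSn] with w' h2 h3
    rw [← hFΨ w' h3]
    exact h2.symm
  rw [hFΨ w hw] at hinv
  have h2 : DifferentiableAt ℂ (fun w' => hst.localInverse F _ _ (hF' _ hΨE) (f w')) w :=
    hinv.hasDerivAt.differentiableAt.comp w (hf.differentiableAt hSn)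
  exact (h2.congr_of_eventuallyEq h1).differentiableWithinAt

theorem norm_sub_conj_sq_sub (W c : ℂ) :
    ‖W - conj c‖ ^ 2 - ‖W - c‖ ^ 2 = 4 * W.im * c.im := by
  rw [Complex.sq_norm, Complex.sq_norm, normSq_apply, normSq_apply]
  simp
  ring

/-- Harnack's inequality in the upper half-plane. -/
theorem im_mul_le_im_mul {Φ : ℂ → ℂ} (hΦ : DifferentiableOn ℂ Φ {W | 0 < W.im})
    (him : ∀ W : ℂ, 0 < W.im → 0 < (Φ W).im) {c W : ℂ} (hc : 0 < c.im) (hW : 0 < W.im) :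
    (Φ c).im * (‖W - conj c‖ - ‖W - c‖) ≤ (Φ W).im * (‖W - conj c‖ + ‖W - c‖) := by
  set m : ℂ → ℂ := fun ζ => (c - conj c * ζ) / (1 - ζ) with hm
  have hne : ∀ ζ ∈ ball (0 : ℂ) 1, 1 - ζ ≠ 0 := fun ζ hζ h => by
    rw [mem_ball_zero_iff, ← sub_eq_zero.1 h, norm_one] at hζ
    exact lt_irrefl _ hζ
  have hmim : ∀ ζ ∈ ball (0 : ℂ) 1, 0 < (m ζ).im := by
    intro ζ hζ
    have h1 : 0 < normSq (1 - ζ) := normSq_pos.2 (hne ζ hζ)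
    have h2 : (m ζ).im = c.im * (1 - normSq ζ) / normSq (1 - ζ) := by
      simp only [hm, div_im, normSq_apply]
      simp
      ring
    have h3 : normSq ζ < 1 := by
      rw [mem_ball_zero_iff] at hζ
      rw [normSq_eq_norm_sq]
      nlinarith [norm_nonneg ζ]
    rw [h2]
    exact div_pos (mul_pos hc (by linarith)) h1
  have hmd : DifferentiableOn ℂ m (ball 0 1) := fun ζ hζ =>
    (DifferentiableAt.div (by fun_prop) (by fun_prop) (hne ζ hζ)).differentiableWithinAt
  have hd : 0 < ‖W - conj c‖ := norm_pos_iff.2 fun h => by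
    have := congrArg Complex.im h
    simp at this
    linarith
  have hd0 := norm_pos_iff.1 hd
  set ζ := (W - c) / (W - conj c) with hζ
  have hnζ : ‖ζ‖ = ‖W - c‖ / ‖W - conj c‖ := norm_div _ _
  have hζ1 : ζ ∈ ball (0 : ℂ) 1 := by
    rw [mem_ball_zero_iff, hnζ, div_lt_one hd]
    have h := norm_sub_conj_sq_sub W c
    have : 0 < 4 * W.im * c.im := by positivity
    exact lt_of_pow_lt_pow_left₀ 2 hd.le (by linarith)
  have hmζ : m ζ = W := by
    have h1 : 1 - ζ = (c - conj c) / (W - conj c) := by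
      rw [hζ]; field_simp; ring
    have h2 : c - conj c ≠ 0 := fun h => by
      have := congrArg Complex.im h
      simp at this
      linarith
    simp only [hm]
    rw [h1, hζ]
    field_simp
    ring
  have hm0 : m 0 = c := by simp [hm]
  have key := re_le_of_re_pos (f := fun ζ => -I * Φ (m ζ)) (c := 0) (R := 1)
    ((hΦ.comp hmd hmim).const_mul (-I)) (fun ζ hζ => by simpa using him _ (hmim ζ hζ)) hζ1
  rw [hm0, hmζ, sub_zero, hnζ] at key
  simp only [neg_mul, neg_re, mul_re, I_re, zero_mul, I_im, one_mul, zero_sub, neg_neg] at key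
  have h1 : 1 - ‖W - c‖ / ‖W - conj c‖ = (‖W - conj c‖ - ‖W - c‖) / ‖W - conj c‖ := by field_simp
  have h2 : 1 + ‖W - c‖ / ‖W - conj c‖ = (‖W - conj c‖ + ‖W - c‖) / ‖W - conj c‖ := by field_simp
  rw [h1, h2, ← mul_div_assoc, ← mul_div_assoc, div_le_div_iff_of_pos_right hd] at key
  exact key

/-- Julia's lemma in the upper half-plane. -/
theorem im_le_im_of_tendsto {Φ : ℂ → ℂ} (hΦ : DifferentiableOn ℂ Φ {W | 0 < W.im})
    (him : ∀ W : ℂ, 0 < W.im → 0 < (Φ W).im) {x : ℝ}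
    (hlim : ∀ᶠ y : ℝ in atTop, y - 1 ≤ (Φ (x + y * I)).im) {W : ℂ} (hW : 0 < W.im) :
    W.im ≤ (Φ W).im := by
  set K : ℝ := ‖W - x‖ with hK
  have h1 : ∀ᶠ y : ℝ in atTop, (1 - y⁻¹) * W.im ≤ (Φ W).im * (1 + K * y⁻¹) ^ 2 := by
    filter_upwards [hlim, eventually_gt_atTop 1] with y hy hy0
    have hy0' : 0 < y := by linarith
    have h2 := im_mul_le_im_mul hΦ him (c := x + y * I) (by simpa using hy0') hW
    have h3 := norm_sub_conj_sq_sub W (x + y * I)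
    have e1 : ‖W - (x + y * I)‖ ≤ K + y := by
      rw [← sub_sub]
      refine (norm_sub_le _ _).trans_eq ?_
      simp [hK, abs_of_pos hy0']
    have e2 : ‖W - conj (x + y * I)‖ ≤ K + y := by
      have : W - conj (x + y * I) = (W - x) + y * I := by simp; ring
      rw [this]
      refine (norm_add_le _ _).trans_eq ?_
      simp [hK, abs_of_pos hy0']
    set A := ‖W - conj (x + y * I)‖
    set B := ‖W - (x + y * I)‖
    have hA : 0 ≤ A := norm_nonneg _
    have hB : 0 ≤ B := norm_nonneg _
    have him0 := him W hW
    have h4 : (Φ (x + y * I)).im * (4 * W.im * y) ≤ (Φ W).im * (A + B) ^ 2 := by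
      have : (x + y * I : ℂ).im = y := by simp
      rw [this] at h3
      calc _ = (Φ (x + y * I)).im * (A - B) * (A + B) := by rw [← h3]; ring
        _ ≤ (Φ W).im * (A + B) * (A + B) := by gcongr
        _ = _ := by ring
    have h5 : (y - 1) * (4 * W.im * y) ≤ (Φ W).im * (2 * (K + y)) ^ 2 := by
      calc (y - 1) * (4 * W.im * y) ≤ (Φ (x + y * I)).im * (4 * W.im * y) := by gcongr
        _ ≤ _ := h4
        _ ≤ _ := by gcongr; linarith
    have h6 : (1 - y⁻¹) * W.im = (y - 1) * (4 * W.im * y) / (4 * y ^ 2) := by field_simp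
    have h7 : (Φ W).im * (1 + K * y⁻¹) ^ 2 = (Φ W).im * (2 * (K + y)) ^ 2 / (4 * y ^ 2) := by
      field_simp; ring
    rw [h6, h7]
    gcongr
  have h2 : Tendsto (fun y : ℝ => (1 - y⁻¹) * W.im) atTop (𝓝 ((1 - 0) * W.im)) :=
    (tendsto_const_nhds.sub tendsto_inv_atTop_zero).mul_const _
  have h3 : Tendsto (fun y : ℝ => (Φ W).im * (1 + K * y⁻¹) ^ 2) atTop
      (𝓝 ((Φ W).im * (1 + K * 0) ^ 2)) :=
    ((tendsto_const_nhds.add (tendsto_inv_atTop_zero.const_mul K)).pow 2).const_mul _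
  simpa using le_of_tendsto_of_tendsto h2 h3 h1

theorem im_lt_im_of_exists_lt {Φ : ℂ → ℂ} (hΦ : DifferentiableOn ℂ Φ {W | 0 < W.im})
    (hle : ∀ W : ℂ, 0 < W.im → W.im ≤ (Φ W).im) {W₁ : ℂ} (hW₁ : 0 < W₁.im)
    (hlt : W₁.im < (Φ W₁).im) {W : ℂ} (hW : 0 < W.im) : W.im < (Φ W).im := by
  refine (hle W hW).lt_of_ne fun heq => hlt.ne ?_
  have hH : IsPreconnected {W : ℂ | 0 < W.im} := (convex_halfSpace_im_gt 0).isPreconnected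
  have hd : DifferentiableOn ℂ (fun W => exp (I * (Φ W - W))) {W | 0 < W.im} :=
    ((hΦ.sub differentiableOn_id).const_mul I).cexp
  have hn : ∀ W, ‖exp (I * (Φ W - W))‖ = Real.exp (W.im - (Φ W).im) := fun W => by
    rw [norm_exp]
    simp
  have h := Complex.norm_eqOn_of_isPreconnected_of_isMaxOn hH (isOpen_lt continuous_const continuous_im)
    hd hW (fun V hV => by
      simp only [mem_ofPred_eq, Function.comp_apply, hn, ← heq, sub_self, Real.exp_le_exp]
      linarith [hle V hV]) hW₁
  simp only [Function.comp_apply, hn, Function.const_apply, ← heq, sub_self] at h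
  linarith [Real.exp_injective h]

theorem im_div_eq (c : ℝ) (z : ℂ) : ((c : ℂ) / z).im = -(c * z.im / ‖z‖ ^ 2) := by
  rw [Complex.sq_norm, div_im]
  simp

/-- A branch of the inverse of the Joukowski map `z ↦ z + c / z` in the upper half-plane. -/
theorem exists_joukowski_inverse {c : ℝ} (hc : 0 < c) :
    ∃ j : ℂ → ℂ, DifferentiableOn ℂ j {W | 0 < W.im} ∧ ∀ W : ℂ, 0 < W.im →
      W.im ≤ (j W).im ∧ c < ‖j W‖ ^ 2 ∧ j W + c / j W = W := by
  set s : ℂ → ℂ := fun W => exp (log (4 * c - W ^ 2) / 2) with hs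
  have hslit : ∀ W : ℂ, 0 < W.im → 4 * c - W ^ 2 ∈ slitPlane := by
    intro W hW
    rw [mem_slitPlane_iff]
    have h1 : (4 * c - W ^ 2 : ℂ).re = 4 * c - (W.re ^ 2 - W.im ^ 2) := by
      simp [pow_two]
    have h2 : (4 * c - W ^ 2 : ℂ).im = -(2 * W.re * W.im) := by
      simp [pow_two]; ring
    rw [h1, h2]
    by_cases h : W.re = 0
    · left
      rw [h]
      nlinarith [sq_nonneg W.im]
    · right
      have := mul_ne_zero (mul_ne_zero two_ne_zero h) hW.ne'
      simpa using this
  have hs2 : ∀ W : ℂ, 0 < W.im → s W ^ 2 = 4 * c - W ^ 2 := by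
    intro W hW
    rw [hs, ← exp_nat_mul]
    push_cast
    rw [mul_div_cancel₀ _ (two_ne_zero' ℂ), exp_log (slitPlane_ne_zero (hslit W hW))]
  have hsre : ∀ W : ℂ, 0 < W.im → 0 < (s W).re := by
    intro W hW
    have h := mem_slitPlane_iff_arg.1 (hslit W hW)
    rw [hs, exp_re]
    refine mul_pos (Real.exp_pos _) (Real.cos_pos_of_mem_Ioo ?_)
    have h1 : (log (4 * c - W ^ 2) / 2).im = arg (4 * c - W ^ 2) / 2 := by
      rw [show (2 : ℂ) = ((2 : ℝ) : ℂ) by norm_num, div_ofReal_im, log_im]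
    rw [h1]
    have h2 := neg_pi_lt_arg (4 * c - W ^ 2)
    have h3 := (arg_le_pi (4 * c - W ^ 2)).lt_of_ne h.1
    constructor <;> linarith
  refine ⟨fun W => (W + I * s W) / 2, fun W hW => ?_, fun W hW => ?_⟩
  · have h1 : DifferentiableAt ℂ (fun W : ℂ => log (4 * c - W ^ 2)) W :=
      DifferentiableAt.clog (by fun_prop) (hslit W hW)
    have h2 : DifferentiableAt ℂ s W := (h1.div_const 2).cexp
    exact DifferentiableAt.differentiableWithinAt
      ((differentiableAt_id.add (h2.const_mul I)).div_const 2)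
  · set z := (W + I * s W) / 2 with hz
    have hzim : z.im = (W.im + (s W).re) / 2 := by
      rw [hz, show (2 : ℂ) = ((2 : ℝ) : ℂ) by norm_num, div_ofReal_im]
      simp
    have hzpos : 0 < z.im := by rw [hzim]; linarith [hsre W hW]
    have hz0 : z ≠ 0 := fun h => by rw [h] at hzpos; simp at hzpos
    have hprod : z * (W - z) = c := by
      have := hs2 W hW
      rw [hz]
      linear_combination (1 / 4 : ℂ) * this - (1 / 4 : ℂ) * (s W) ^ 2 * I_sq
    have hW' : z + c / z = W := by
      rw [← hprod, mul_div_cancel_left₀ _ hz0]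
      ring
    have him := congrArg Complex.im hW'
    rw [add_im, im_div_eq] at him
    have hn : 0 < ‖z‖ ^ 2 := by positivity
    refine ⟨?_, ?_, hW'⟩
    · have : 0 ≤ c * z.im / ‖z‖ ^ 2 := by positivity
      linarith
    · by_contra! h
      have : 1 * z.im ≤ c / ‖z‖ ^ 2 * z.im := by
        gcongr
        rwa [one_le_div hn]
      rw [div_mul_eq_mul_div] at this
      linarith

theorem eq_of_add_div_eq {c : ℝ} (hc : 0 < c) {z w : ℂ} (hz : c < ‖z‖ ^ 2) (hw : c < ‖w‖ ^ 2)
    (h : z + c / z = w + c / w) : z = w := by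
  have hz0 : z ≠ 0 := fun h0 => by rw [h0] at hz; simp at hz; linarith
  have hw0 : w ≠ 0 := fun h0 => by rw [h0] at hw; simp at hw; linarith
  have h1 : (z - w) * (z * w - c) = 0 := by
    field_simp at h
    linear_combination h
  rcases mul_eq_zero.1 h1 with h2 | h2
  · exact sub_eq_zero.1 h2
  · exfalso
    have h3 := congrArg norm (sub_eq_zero.1 h2)
    rw [norm_mul, norm_real, Real.norm_of_nonneg hc.le] at h3
    have h4 : c * c < ‖z‖ ^ 2 * ‖w‖ ^ 2 := by gcongr
    rw [← mul_pow, h3] at h4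
    linarith

/-- `Φ` maps the upper half-plane to itself, and is asymptotic to `j` to infinite order along a
vertical half-line. -/
structure IsFlatNear (j : ℂ → ℂ) (x : ℝ) (Φ : ℂ → ℂ) : Prop where
  differentiableOn : DifferentiableOn ℂ Φ {W | 0 < W.im}
  im_pos : ∀ W : ℂ, 0 < W.im → 0 < (Φ W).im
  tendsto : ∀ N : ℕ, Tendsto (fun y : ℝ => y ^ N * ‖Φ (x + y * I) - j (x + y * I)‖) atTop (𝓝 0)

section Rigidity

variable {c : ℝ} {j Φ : ℂ → ℂ} {x : ℝ}

theorem eventually_norm_le_two_mul (hc : 0 < c)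
    (hj : ∀ W : ℂ, 0 < W.im → W.im ≤ (j W).im ∧ c < ‖j W‖ ^ 2 ∧ j W + c / j W = W) :
    ∀ᶠ y : ℝ in atTop, ‖j (x + y * I)‖ ≤ 2 * y := by
  filter_upwards [eventually_gt_atTop 0, eventually_ge_atTop (|x| + c), eventually_ge_atTop 1]
    with y hy0 hy hy1
  have him : (x + y * I : ℂ).im = y := by simp
  obtain ⟨h1, -, h3⟩ := hj (x + y * I) (by rw [him]; exact hy0)
  rw [him] at h1
  have h4 : y ≤ ‖j (x + y * I)‖ := h1.trans (im_le_norm _)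
  have h5 : ‖(c : ℂ) / j (x + y * I)‖ ≤ c := by
    rw [norm_div, norm_real, Real.norm_of_nonneg hc.le]
    exact div_le_self hc.le (by linarith)
  have h6 : j (x + y * I) = x + y * I - c / j (x + y * I) := eq_sub_of_add_eq h3
  calc ‖j (x + y * I)‖ = ‖x + y * I - c / j (x + y * I)‖ := by rw [← h6]
    _ ≤ ‖(x : ℂ)‖ + ‖y * I‖ + ‖(c : ℂ) / j (x + y * I)‖ :=
      (norm_sub_le _ _).trans (by gcongr; exact norm_add_le _ _)
    _ ≤ |x| + y + c := by
      simp only [norm_mul, norm_real, norm_I, Real.norm_eq_abs, abs_of_pos hy0, mul_one]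
      linarith
    _ ≤ 2 * y := by linarith

theorem IsFlatNear.im_lt_im (hc : 0 < c)
    (hj : ∀ W : ℂ, 0 < W.im → W.im ≤ (j W).im ∧ c < ‖j W‖ ^ 2 ∧ j W + c / j W = W)
    (hΦ : IsFlatNear j x Φ) {W : ℂ} (hW : 0 < W.im) :
    W.im < (Φ W).im := by
  have hsmall : ∀ᶠ y : ℝ in atTop, ‖Φ (x + y * I) - j (x + y * I)‖ ≤ 1 := by
    have h := hΦ.tendsto 0
    simp only [pow_zero, one_mul] at h
    exact h.eventually_le_const one_pos
  have hsmall' : ∀ᶠ y : ℝ in atTop, y ^ 1 * ‖Φ (x + y * I) - j (x + y * I)‖ < c / 4 :=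
    (hΦ.tendsto 1).eventually_lt_const (by positivity)
  have hle : ∀ W : ℂ, 0 < W.im → W.im ≤ (Φ W).im := fun W hW => by
    refine im_le_im_of_tendsto hΦ.differentiableOn hΦ.im_pos (x := x) ?_ hW
    filter_upwards [hsmall, eventually_gt_atTop 0] with y hy hy0
    have h1 := (hj (x + y * I) (by simpa using hy0)).1
    have h2 := (abs_le.1 ((abs_im_le_norm _).trans hy)).1
    rw [sub_im] at h2
    have him : (x + y * I : ℂ).im = y := by simp
    linarith
  obtain ⟨y, hy1, hy2, hy0⟩ := (hsmall'.and ((eventually_norm_le_two_mul hc hj (x := x)).and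
    (eventually_gt_atTop 0))).exists
  have him : (x + y * I : ℂ).im = y := by simp
  obtain ⟨h1, h2, h3⟩ := hj (x + y * I) (by rw [him]; exact hy0)
  refine im_lt_im_of_exists_lt hΦ.differentiableOn hle (W₁ := x + y * I) (by rw [him]; exact hy0) ?_
    hW
  have h4 := congrArg Complex.im h3
  rw [add_im, im_div_eq, him] at h4
  rw [him] at h1 ⊢
  have h5 : c / (4 * y) ≤ c * (j (x + y * I)).im / ‖j (x + y * I)‖ ^ 2 := by
    have hpos : 0 < ‖j (x + y * I)‖ ^ 2 := by linarith
    rw [div_le_div_iff₀ (by positivity) hpos]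
    have : ‖j (x + y * I)‖ ^ 2 ≤ (2 * y) ^ 2 := by gcongr
    calc c * ‖j (x + y * I)‖ ^ 2 ≤ c * (2 * y) ^ 2 := by gcongr
      _ = c * y * (4 * y) := by ring
      _ ≤ _ := by gcongr
  have h6 : ‖Φ (x + y * I) - j (x + y * I)‖ < c / (4 * y) := by
    rw [lt_div_iff₀ (by positivity)]
    linarith
  have h7 := (abs_le.1 (abs_im_le_norm (Φ (x + y * I) - j (x + y * I)))).1
  rw [sub_im] at h7
  linarith

theorem IsFlatNear.div_sub (hc : 0 < c)
    (hj : ∀ W : ℂ, 0 < W.im → W.im ≤ (j W).im ∧ c < ‖j W‖ ^ 2 ∧ j W + c / j W = W)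
    (hΦ : IsFlatNear j x Φ) : IsFlatNear j x fun W => c / (W - Φ W) := by
  have hne : ∀ W : ℂ, 0 < W.im → W - Φ W ≠ 0 := fun W hW h => by
    have := congrArg Complex.im h
    rw [sub_im, zero_im] at this
    linarith [hΦ.im_lt_im hc hj hW]
  refine ⟨?_, fun W hW => ?_, fun N => ?_⟩
  · exact (differentiableOn_const _).div (differentiableOn_id.sub hΦ.differentiableOn) hne
  · rw [im_div_eq, neg_pos]
    refine div_neg_of_neg_of_pos (mul_neg_of_pos_of_neg hc ?_) (by
      have := hne W hW
      positivity)
    rw [sub_im]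
    linarith [hΦ.im_lt_im hc hj hW]
  · have hlim := (hΦ.tendsto (N + 2)).const_mul (8 / c)
    rw [mul_zero] at hlim
    refine squeeze_zero' ?_ ?_ hlim
    · filter_upwards [eventually_gt_atTop 0] with y hy using by positivity
    · filter_upwards [eventually_gt_atTop 0, eventually_norm_le_two_mul hc hj (x := x),
        (hΦ.tendsto 1).eventually_lt_const (by positivity : 0 < c / 4)] with y hy0 hy1 hy2
      have him : (x + y * I : ℂ).im = y := by simp
      set W : ℂ := x + y * I
      obtain ⟨h1, h2, h3⟩ := hj W (by rw [him]; exact hy0)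
      have hjn : 0 < ‖j W‖ := by
        have := im_le_norm (j W)
        linarith
      have hj0 := norm_pos_iff.1 hjn
      have hd := hne W (by rw [him]; exact hy0)
      have h5 : W - Φ W = c / j W - (Φ W - j W) := by linear_combination -h3
      have h6 : c / (4 * y) ≤ ‖W - Φ W‖ := by
        have e1 : c / (2 * y) ≤ ‖(c : ℂ) / j W‖ := by
          rw [norm_div, norm_real, Real.norm_of_nonneg hc.le]
          gcongr
        have e2 : ‖Φ W - j W‖ ≤ c / (4 * y) := by
          rw [le_div_iff₀ (by positivity)]
          linarith
        have e3 := norm_sub_norm_le ((c : ℂ) / j W) (Φ W - j W)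
        rw [← h5] at e3
        have e4 : c / (2 * y) = c / (4 * y) + c / (4 * y) := by field_simp; norm_num
        linarith
      have h7 : c / (W - Φ W) - j W = (Φ W - j W) * j W / (W - Φ W) := by
        have h8 : (c : ℂ) = j W * (W - j W) := by
          have e : (c : ℂ) / j W = W - j W := by linear_combination h3
          rw [← e, mul_div_cancel₀ _ hj0]
        rw [div_sub' hd, h8]
        congr 1
        ring
      rw [h7, norm_div, norm_mul]
      calc y ^ N * (‖Φ W - j W‖ * ‖j W‖ / ‖W - Φ W‖)
          ≤ y ^ N * (‖Φ W - j W‖ * (2 * y) / (c / (4 * y))) := by gcongr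
        _ = _ := by field_simp; ring

theorem IsFlatNear.norm_sub_le_half (hc : 0 < c)
    (hj : ∀ W : ℂ, 0 < W.im → W.im ≤ (j W).im ∧ c < ‖j W‖ ^ 2 ∧ j W + c / j W = W)
    (hΦ : IsFlatNear j x Φ) {W : ℂ} (hW : 0 < W.im)
    (hcW : 2 * c ≤ W.im ^ 2) : ‖Φ W - j W‖ ≤ 1 / 2 * ‖c / (W - Φ W) - j W‖ := by
  have h1 := (hΦ.div_sub hc hj).im_lt_im hc hj hW
  obtain ⟨h2, -, h3⟩ := hj W hW
  set Z := c / (W - Φ W) with hZ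
  have hZn : W.im ≤ ‖Z‖ := h1.le.trans (im_le_norm _)
  have hjn : W.im ≤ ‖j W‖ := h2.trans (im_le_norm _)
  have hZ0 : Z ≠ 0 := norm_pos_iff.1 (hW.trans_le hZn)
  have hj0 : j W ≠ 0 := norm_pos_iff.1 (hW.trans_le hjn)
  have hc0 : (c : ℂ) ≠ 0 := ofReal_ne_zero.2 hc.ne'
  have h4 : c / Z = W - Φ W := by rw [hZ, div_div_cancel₀ hc0]
  have h5 : Φ W - j W = c * (Z - j W) / (j W * Z) := by
    have : Φ W - j W = c / j W - c / Z := by linear_combination h4 - h3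
    rw [this]
    field_simp
  rw [h5, norm_div, norm_mul, norm_mul, norm_real, Real.norm_of_nonneg hc.le,
    div_le_iff₀ (by positivity)]
  have h6 : W.im * W.im ≤ ‖j W‖ * ‖Z‖ := by gcongr
  nlinarith [norm_nonneg (Z - j W)]

theorem IsFlatNear.norm_sub_le_div (hc : 0 < c)
    (hj : ∀ W : ℂ, 0 < W.im → W.im ≤ (j W).im ∧ c < ‖j W‖ ^ 2 ∧ j W + c / j W = W)
    (hΦ : IsFlatNear j x Φ) {W : ℂ} (hW : 0 < W.im) :
    ‖Φ W - j W‖ ≤ 2 * c / W.im := by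
  have h1 := (hΦ.div_sub hc hj).im_lt_im hc hj hW
  obtain ⟨h2, -, h3⟩ := hj W hW
  set Z := c / (W - Φ W) with hZ
  have hZn : W.im ≤ ‖Z‖ := h1.le.trans (im_le_norm _)
  have hjn : W.im ≤ ‖j W‖ := h2.trans (im_le_norm _)
  have hc0 : (c : ℂ) ≠ 0 := ofReal_ne_zero.2 hc.ne'
  have h4 : c / Z = W - Φ W := by rw [hZ, div_div_cancel₀ hc0]
  have h5 : Φ W - j W = c / j W - c / Z := by linear_combination h4 - h3
  rw [h5]
  refine (norm_sub_le _ _).trans ?_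
  rw [norm_div, norm_div, norm_real, Real.norm_of_nonneg hc.le]
  calc c / ‖j W‖ + c / ‖Z‖ ≤ c / W.im + c / W.im := by gcongr
    _ = _ := by ring

theorem IsFlatNear.eq (hc : 0 < c)
    (hj : ∀ W : ℂ, 0 < W.im → W.im ≤ (j W).im ∧ c < ‖j W‖ ^ 2 ∧ j W + c / j W = W)
    (hΦ : IsFlatNear j x Φ) {W : ℂ} (hW : 0 < W.im)
    (hcW : 2 * c ≤ W.im ^ 2) : Φ W = j W := by
  have key : ∀ n : ℕ, ∀ Ψ : ℂ → ℂ, IsFlatNear j x Ψ →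
      ‖Ψ W - j W‖ ≤ (1 / 2) ^ n * (2 * c / W.im) := by
    intro n
    induction n with
    | zero => exact fun Ψ hΨ => by simpa using hΨ.norm_sub_le_div hc hj hW
    | succ n ih =>
      intro Ψ hΨ
      refine (hΨ.norm_sub_le_half hc hj hW hcW).trans ?_
      rw [pow_succ', mul_assoc]
      gcongr
      exact ih _ (hΨ.div_sub hc hj)
  have hlim : Tendsto (fun n : ℕ => (1 / 2 : ℝ) ^ n * (2 * c / W.im)) atTop
      (𝓝 (0 * (2 * c / W.im))) :=
    (tendsto_pow_atTop_nhds_zero_of_lt_one (by norm_num) (by norm_num)).mul_const _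
  rw [zero_mul] at hlim
  have h := ge_of_tendsto' hlim fun n => key n Φ hΦ
  exact sub_eq_zero.1 (norm_le_zero_iff.1 h)

end Rigidity

/-- The points of the upper half-plane at which the Newton map `z ↦ z - 1 / g z` is finite and
locally injective. -/
def regularSet (g : ℂ → ℂ) : Set ℂ := {z | 0 < z.im ∧ g z ≠ 0 ∧ deriv g z + g z ^ 2 ≠ 0}

section

variable {g : ℂ → ℂ}

theorem isOpen_regularSet (hg : Differentiable ℂ g) : IsOpen (regularSet g) := by
  have hd : Continuous (deriv g) := (hg.contDiff (n := 1)).continuous_deriv le_rfl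
  have hc := hg.continuous
  exact (isOpen_lt continuous_const continuous_im).inter
    ((isOpen_ne_fun hc continuous_const).inter
      (isOpen_ne_fun (hd.add (hc.pow 2)) continuous_const))

theorem hasDerivAt_sub_inv (hg : Differentiable ℂ g) {z : ℂ} (hz : g z ≠ 0) :
    HasDerivAt (fun z => z - (g z)⁻¹) ((deriv g z + g z ^ 2) / g z ^ 2) z := by
  have h := (hasDerivAt_id z).sub ((hg z).hasDerivAt.inv hz)
  refine h.congr_deriv ?_
  field_simp
  ring

theorem exists_tendsto_mem_regularSet (hg : Differentiable ℂ g)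
    (hreal : ∀ z, g (conj z) = conj (g z))
    (htrans : ¬ ∃ p : Polynomial ℂ, ∀ z, g z = p.eval z)
    (hfin : {z : ℂ | deriv g z + g z ^ 2 = 0 ∧ 0 < z.im}.Finite) {R : ℝ}
    (hR : ∀ z : ℂ, 0 < z.im → deriv g z + g z ^ 2 = 0 → ‖z - (g z)⁻¹‖ ≤ R) {γ : ℝ → ℂ}
    (hγ : Continuous γ) {T : ℝ} (hT : 0 < T) (him : 0 < (γ T).im) (hRT : R < ‖γ T‖) {l : ℝ → ℂ}
    (hlc : ContinuousOn l (Ico 0 T))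
    (hl : ∀ t ∈ Ico 0 T, l t ∈ regularSet g ∧ l t - (g (l t))⁻¹ = γ t) :
    ∃ z ∈ regularSet g, ∃ u : ℕ → ℝ, (∀ n, u n ∈ Ico 0 T) ∧ Tendsto u atTop (𝓝 T) ∧
      Tendsto (fun n => l (u n)) atTop (𝓝 z) := by
  have hIco : ∀ᶠ t in 𝓝[<] T, t ∈ Ico 0 T := Ico_mem_nhdsLT hT
  have hγT : Tendsto γ (𝓝[<] T) (𝓝 (γ T)) := (hγ.tendsto T).mono_left nhdsWithin_le_nhds
  have hninf : ¬ Tendsto (fun t => ‖l t‖) (𝓝[<] T) atTop := fun hinf =>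
    false_of_tendsto_of_tendsto_norm hg hreal htrans hfin hT hlc (fun t ht => (hl t ht).1.1) hinf
      him (hγT.congr' (hIco.mono fun t ht => (hl t ht).2.symm))
  rw [Filter.tendsto_atTop] at hninf
  push Not at hninf
  obtain ⟨B, hB⟩ := hninf
  obtain ⟨u, hu, huB⟩ := exists_seq_forall_of_frequently (hB.and_eventually hIco)
  obtain ⟨z, -, φ, hφ, hz⟩ := tendsto_subseq_of_bounded (isBounded_closedBall (x := (0 : ℂ)) (r := B))
    (x := fun n => l (u n)) fun n => by
      rw [mem_closedBall_zero_iff]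
      exact (huB n).1.le
  have huφ : Tendsto (fun n => u (φ n)) atTop (𝓝[<] T) := hu.comp hφ.tendsto_atTop
  have hγu : Tendsto (fun n => γ (u (φ n))) atTop (𝓝 (γ T)) := hγT.comp huφ
  have hgu : Tendsto (fun n => g (l (u (φ n)))) atTop (𝓝 (g z)) := (hg.continuous.tendsto z).comp hz
  have heq : g z * (z - γ T) = 1 := by
    refine tendsto_nhds_unique (hgu.mul (hz.sub hγu)) (tendsto_const_nhds.congr fun n => ?_)
    obtain ⟨⟨-, h1, -⟩, h2⟩ := hl _ (huB (φ n)).2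
    simp only [Function.comp_apply]
    rw [← h2, sub_sub_cancel, mul_inv_cancel₀ h1]
  have hgz : g z ≠ 0 := left_ne_zero_of_mul_eq_one heq
  have hF : z - (g z)⁻¹ = γ T := by
    rw [← eq_inv_of_mul_eq_one_right heq]
    ring
  have hz0 : 0 ≤ z.im := ge_of_tendsto' ((continuous_im.tendsto z).comp hz) fun n =>
    (hl _ (huB (φ n)).2).1.1.le
  have hzpos : 0 < z.im := by
    refine hz0.lt_of_ne fun h => ?_
    have hc : conj z = z := conj_eq_iff_im.2 h.symm
    have h1 : conj (γ T) = γ T := by rw [← hF, map_sub, map_inv₀, ← hreal, hc]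
    exact him.ne' (conj_eq_iff_im.1 h1)
  refine ⟨z, ⟨hzpos, hgz, fun h => ?_⟩, fun n => u (φ n), fun n => (huB (φ n)).2,
    huφ.mono_right nhdsWithin_le_nhds, hz⟩
  have := hR z hzpos h
  rw [hF] at this
  linarith

theorem abs_re_le_im_of_norm_sub_le {R x y : ℝ} (hx : |x| ≤ 1 + R) (hy : 3 * R + 4 ≤ y + 1 + R)
    {j p : ℂ} (hjy : y ≤ j.im) (hj : ‖(x + y * I : ℂ) - j‖ ≤ R) (hp : ‖p - j‖ ≤ 1) :
    |p.re| ≤ p.im ∧ y - 1 ≤ p.im := by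
  have h1 := (abs_le.1 ((abs_im_le_norm _).trans hp)).1
  have h2 := abs_le.1 ((abs_re_le_norm _).trans hp)
  have h3 := abs_le.1 ((abs_re_le_norm _).trans hj)
  have h4 := abs_le.1 hx
  simp only [sub_re, add_re, mul_re, ofReal_re, ofReal_im, I_re, I_im, sub_im] at h1 h2 h3
  refine ⟨abs_le.2 ⟨?_, ?_⟩, ?_⟩ <;> linarith

theorem isFlatNear_of_norm_sub_le (hg : Differentiable ℂ g)
    (hreal : ∀ z, g (conj z) = conj (g z))
    (htrans : ¬ ∃ p : Polynomial ℂ, ∀ z, g z = p.eval z)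
    (hfin : {z : ℂ | deriv g z + g z ^ 2 = 0 ∧ 0 < z.im}.Finite) {j Φ : ℂ → ℂ} {x y₀ : ℝ}
    (hΦ : DifferentiableOn ℂ Φ {W | 0 < W.im})
    (hΦF : ∀ W : ℂ, 0 < W.im → Φ W ∈ regularSet g ∧ Φ W - (g (Φ W))⁻¹ = j W)
    (hp : ∀ y : ℝ, y₀ ≤ y → |(Φ (x + y * I)).re| ≤ (Φ (x + y * I)).im ∧
      y - 1 ≤ (Φ (x + y * I)).im) : IsFlatNear j x Φ := by
  refine ⟨hΦ, fun W hW => (hΦF W hW).1.1, fun N => ?_⟩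
  obtain ⟨R, hR1, hR⟩ := exists_pow_le_norm hg hreal htrans hfin (N + 1) (δ := 1 / 2) (by norm_num)
  have hlim : Tendsto (fun y : ℝ => 2 ^ (N + 1) / y) atTop (𝓝 0) := tendsto_id.const_div_atTop _
  refine squeeze_zero' ?_ ?_ hlim
  · filter_upwards [eventually_gt_atTop 0] with y hy using by positivity
  · filter_upwards [eventually_ge_atTop y₀, eventually_ge_atTop (R + 1), eventually_ge_atTop 2]
      with y hy0 hyR hy2
    obtain ⟨h1, h2⟩ := hp y hy0
    obtain ⟨-, h3⟩ := hΦF (x + y * I) (by simp; linarith)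
    set p := Φ (x + y * I)
    have h4 : p.im ≤ ‖p‖ := im_le_norm p
    have h5 : ‖p‖ ^ (N + 1) ≤ ‖g p‖ := by
      refine hR p (by linarith) ?_
      have := norm_le_abs_re_add_abs_im p
      rw [abs_of_nonneg ((abs_nonneg _).trans h1)] at this
      linarith
    have h6 : (y / 2) ^ (N + 1) ≤ ‖g p‖ := le_trans (by gcongr; linarith) h5
    rw [← h3, sub_sub_cancel, norm_inv]
    calc y ^ N * ‖g p‖⁻¹ ≤ y ^ N * ((y / 2) ^ (N + 1))⁻¹ := by gcongr
      _ = 2 ^ (N + 1) / y := by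
        have : y ≠ 0 := by linarith
        rw [div_pow]
        field_simp
        rw [pow_succ]

theorem false_of_finite (hg : Differentiable ℂ g)
    (hreal : ∀ z, g (conj z) = conj (g z))
    (htrans : ¬ ∃ p : Polynomial ℂ, ∀ z, g z = p.eval z)
    (hfin : {z : ℂ | deriv g z + g z ^ 2 = 0 ∧ 0 < z.im}.Finite) : False := by
  obtain ⟨R, hR0, hR⟩ : ∃ R : ℝ, 0 < R ∧
      ∀ z : ℂ, 0 < z.im → deriv g z + g z ^ 2 = 0 → ‖z - (g z)⁻¹‖ ≤ R := by
    obtain ⟨R, hR0, hR⟩ := (hfin.image fun z => z - (g z)⁻¹).isBounded.exists_pos_norm_le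
    exact ⟨R, hR0, fun z hz h => hR _ ⟨z, ⟨h, hz⟩, rfl⟩⟩
  have hc : 0 < R ^ 2 := by positivity
  obtain ⟨j, hjd, hj⟩ := exists_joukowski_inverse hc
  have hjR : ∀ W : ℂ, 0 < W.im → R < ‖j W‖ := fun W hW =>
    lt_of_pow_lt_pow_left₀ 2 (norm_nonneg _) (hj W hW).2.1
  have hdiv : ∀ w : ℂ, R < ‖w‖ → ‖((R ^ 2 : ℝ) : ℂ) / w‖ ≤ R := fun w hw => by
    rw [norm_div, norm_real, Real.norm_of_nonneg hc.le, div_le_iff₀ (hR0.trans hw), pow_two]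
    gcongr
  obtain ⟨R₁, hR₁, hgrow⟩ := exists_pow_le_norm hg hreal htrans hfin 1 (δ := 1 / 2) (by norm_num)
  simp only [pow_one] at hgrow
  set Y : ℝ := R₁ + 3 * R + 4 with hY
  have hinv : ∀ p : ℂ, |p.re| ≤ p.im → R₁ + 2 * R + 2 ≤ p.im → ‖(g p)⁻¹‖ ≤ 1 / 2 := fun p h1 h2 => by
    have h3 := norm_le_abs_re_add_abs_im p
    rw [abs_of_nonneg ((abs_nonneg _).trans h1)] at h3
    have h4 := im_le_norm p
    have h5 := hgrow p (by linarith) (by linarith)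
    rw [norm_inv, one_div]
    gcongr
    linarith
  set b : ℂ := Y * I with hb
  have hbim : b.im = Y := by simp [hb]
  have hgb : ‖(g b)⁻¹‖ ≤ 1 / 2 := hinv b (by rw [hbim]; simp [hb]; linarith) (by rw [hbim]; linarith)
  have hbn : ‖b‖ = Y := by
    rw [hb, norm_mul, norm_I, mul_one, norm_real, Real.norm_of_nonneg (by linarith)]
  have hgb0 : g b ≠ 0 := by
    have := hgrow b (by linarith) (by rw [hbn, hbim]; linarith)
    exact norm_pos_iff.1 (by linarith)
  set w : ℂ := b - (g b)⁻¹ with hw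
  have hwim : Y - 1 / 2 ≤ w.im := by
    have := (abs_le.1 ((abs_im_le_norm _).trans hgb)).2
    rw [hw, sub_im, hbim]
    linarith
  have hwR : R < ‖w‖ := by
    have := im_le_norm w
    linarith
  set W₀ : ℂ := w + (R ^ 2 : ℝ) / w with hW₀
  have hW₀b : ‖W₀ - b‖ ≤ 1 / 2 + R := by
    have : W₀ - b = (R ^ 2 : ℝ) / w - (g b)⁻¹ := by rw [hW₀, hw]; ring
    rw [this]
    refine (norm_sub_le _ _).trans ?_
    linarith [hdiv w hwR]
  have hW₀im : Y - 1 / 2 - R ≤ W₀.im := by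
    have := (abs_le.1 ((abs_im_le_norm _).trans hW₀b)).1
    rw [sub_im, hbim] at this
    linarith
  have hW₀re : |W₀.re| ≤ 1 + R := by
    have := (abs_re_le_norm _).trans hW₀b
    have h0 : b.re = 0 := by simp [hb]
    rw [sub_re, h0, sub_zero] at this
    linarith
  have hW₀pos : 0 < W₀.im := by linarith
  have hjW₀ : j W₀ = w := eq_of_add_div_eq hc (hj W₀ hW₀pos).2.1 (by gcongr) (hj W₀ hW₀pos).2.2
  have hbE : b ∈ regularSet g := by
    refine ⟨by rw [hbim]; linarith, hgb0, fun h => ?_⟩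
    have := hR b (by rw [hbim]; linarith) h
    linarith
  have hopen : IsOpen {W : ℂ | 0 < W.im} := isOpen_lt continuous_const continuous_im
  obtain ⟨Φ, hΦd, hΦ0, hΦ⟩ := exists_holomorphic_lift (isOpen_regularSet hg)
    (F := fun z => z - (g z)⁻¹)
    (fun z hz => (hasDerivAt_sub_inv hg hz.2.1).differentiableAt.differentiableWithinAt)
    (fun z hz => by
      rw [(hasDerivAt_sub_inv hg hz.2.1).deriv]
      exact div_ne_zero hz.2.2 (pow_ne_zero 2 hz.2.1))
    hopen (convex_halfSpace_im_gt 0) hW₀pos hjd hbE hjW₀.symm (by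
      intro γ hγ hγS T hT l hlc hl
      obtain ⟨W, hW, hWT⟩ := hγS T
      refine exists_tendsto_mem_regularSet hg hreal htrans hfin hR hγ hT ?_ ?_ hlc hl
      · rw [← hWT]
        exact lt_of_lt_of_le hW (hj W hW).1
      · rw [← hWT]
        exact hjR W hW)
  have hdiff : ∀ W : ℂ, 0 < W.im → Φ W - j W = (g (Φ W))⁻¹ := fun W hW => by
    rw [← (hΦ W hW).2, sub_sub_cancel]
  have hstep : ∀ y : ℝ, W₀.im ≤ y → ‖Φ (W₀.re + y * I) - j (W₀.re + y * I)‖ ≤ 1 →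
      |(Φ (W₀.re + y * I)).re| ≤ (Φ (W₀.re + y * I)).im ∧
        y - 1 ≤ (Φ (W₀.re + y * I)).im := fun y hy h => by
    have him : (W₀.re + y * I : ℂ).im = y := by simp
    have hy0 : 0 < (W₀.re + y * I : ℂ).im := by rw [him]; linarith
    obtain ⟨h1, -, h3⟩ := hj _ hy0
    rw [him] at h1
    refine abs_re_le_im_of_norm_sub_le hW₀re (by linarith) h1 ?_ h
    rw [← eq_sub_of_add_eq' h3]
    exact hdiv _ (hjR _ hy0)
  have hhalf : ∀ y : ℝ, W₀.im ≤ y → ‖Φ (W₀.re + y * I) - j (W₀.re + y * I)‖ ≤ 1 →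
      ‖Φ (W₀.re + y * I) - j (W₀.re + y * I)‖ ≤ 1 / 2 := fun y hy h => by
    obtain ⟨h1, h2⟩ := hstep y hy h
    rw [hdiff _ (by simp; linarith)]
    exact hinv _ h1 (by linarith)
  have hone : ∀ y : ℝ, W₀.im ≤ y → ‖Φ (W₀.re + y * I) - j (W₀.re + y * I)‖ ≤ 1 := fun y hy => by
    by_contra! h
    have hcont : ContinuousOn (fun y : ℝ => ‖Φ (W₀.re + y * I) - j (W₀.re + y * I)‖)
        (Icc W₀.im y) := by
      have hmaps : MapsTo (fun y : ℝ => (W₀.re + y * I : ℂ)) (Icc W₀.im y) {W | 0 < W.im} :=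
        fun t ht => by
          have := ht.1
          simp only [mem_ofPred_eq, add_im, ofReal_im, mul_im, ofReal_re, I_im, I_re]
          linarith
      have hline : ContinuousOn (fun y : ℝ => (W₀.re + y * I : ℂ)) (Icc W₀.im y) := by fun_prop
      exact ((hΦd.continuousOn.comp hline hmaps).sub (hjd.continuousOn.comp hline hmaps)).norm
    have hbase : ‖Φ (W₀.re + W₀.im * I) - j (W₀.re + W₀.im * I)‖ ≤ 1 / 2 := by
      rw [re_add_im, hdiff _ hW₀pos, hΦ0]
      exact hgb
    obtain ⟨t, ht, hte⟩ := intermediate_value_Icc hy hcont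
      (show (3 / 4 : ℝ) ∈ Icc _ _ from ⟨by linarith, by linarith⟩)
    simp only at hte
    have := hhalf t ht.1 (by rw [hte]; norm_num)
    rw [hte] at this
    norm_num at this
  have hflat : IsFlatNear j W₀.re Φ := isFlatNear_of_norm_sub_le hg hreal htrans hfin hΦd hΦ
    fun y hy => hstep y hy (hone y hy)
  have hV : (((2 * R : ℝ) : ℂ) * I).im = 2 * R := by simp
  have hVpos : 0 < (((2 * R : ℝ) : ℂ) * I).im := by rw [hV]; positivity
  have heq := hflat.eq hc hj hVpos (by rw [hV]; nlinarith)
  have := hdiff _ hVpos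
  rw [heq, sub_self, eq_comm, inv_eq_zero, ← heq] at this
  exact (hΦ _ hVpos).1.2.1 this

end

end RiccatiZeros

/-- If `g` is a real transcendental entire function, then `g' + g²` has infinitely many
non-real zeros. -/
theorem nonreal_zeros_of_gprime_add_gsq (g : ℂ → ℂ)
    (hg : Differentiable ℂ g)
    (hreal : ∀ z, g (starRingEnd ℂ z) = starRingEnd ℂ (g z))
    (htrans : ¬ ∃ p : Polynomial ℂ, ∀ z, g z = p.eval z) :
    {z : ℂ | deriv g z + (g z) ^ 2 = 0 ∧ z.im ≠ 0}.Infinite := by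
  intro hfin
  exact RiccatiZeros.false_of_finite hg hreal htrans
    (hfin.subset fun z hz => ⟨hz.1, hz.2.ne'⟩)
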